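/- arXiv:1411.3366 — 2 statements merged into one kernel-verified Lean document; each statement's English description precedes it below -/
import Mathlib

section
/- A Banach space X is not superreflexive if and only if there exists a constant 1 ≤ C < ∞ such that for every n ∈ ℕ the unweighted diamond graph D_n (with its shortest path metric) admits a bilipschitz embedding into X with distortion at most C. -/
noncomputable section

/-- `X` is finitely representable in `Y`. -/
def FinitelyRepresentable (X Y : Type) [NormedAddCommGroup X] [NormedSpace ℝ X]
    [NormedAddCommGroup Y] [NormedSpace ℝ Y] : Prop :=
  ∀ ε : ℝ, 0 < ε → ∀ F : Submodule ℝ X, FiniteDimensional ℝ F →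
    ∃ G : Submodule ℝ Y, FiniteDimensional ℝ G ∧
      ∃ T : F ≃L[ℝ] G, ‖(T : F →L[ℝ] G)‖ * ‖(T.symm : G →L[ℝ] F)‖ ≤ 1 + ε

/-- A Banach space is reflexive if the canonical embedding into the double dual is
surjective. -/
def IsReflexiveBanach (X : Type) [NormedAddCommGroup X] [NormedSpace ℝ X] : Prop :=
  Function.Surjective (NormedSpace.inclusionInDoubleDual ℝ X)

/-- `Y` is superreflexive: every Banach space finitely representable in `Y` is reflexive. -/
def SuperReflexive (Y : Type) [NormedAddCommGroup Y] [NormedSpace ℝ Y] : Prop :=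
  ∀ (X : Type) [NormedAddCommGroup X] [NormedSpace ℝ X] [CompleteSpace X],
    FinitelyRepresentable X Y → IsReflexiveBanach X

/-- Auxiliary relation: a new (subdivision) vertex indexed by an ordered edge `p` is
related to the two endpoints of `p`. -/
def subdivRel {V : Type} (A : V → V → Prop) :
    (V ⊕ {p : V × V // A p.1 p.2}) → (V ⊕ {p : V × V // A p.1 p.2}) → Prop
  | Sum.inl u, Sum.inr p => u = p.1.1 ∨ u = p.1.2
  | _, _ => False

/-- The diamond graphs: `D₀` is a single edge; `Dₙ₊₁` is obtained from `Dₙ` by replacing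
each edge `uv` by a quadrilateral `u, a, v, b` (each undirected edge of `Dₙ` gives the two
ordered pairs `(u,v)`, `(v,u)`, serving as the two new vertices `a`, `b`). -/
def DiamondData : ℕ → (V : Type) × SimpleGraph V
  | 0 => ⟨Bool, SimpleGraph.fromRel fun a b => a ≠ b⟩
  | n + 1 =>
    ⟨(DiamondData n).1 ⊕
        {p : (DiamondData n).1 × (DiamondData n).1 // (DiamondData n).2.Adj p.1 p.2},
      SimpleGraph.fromRel (subdivRel (DiamondData n).2.Adj)⟩

/-- The vertex set of the diamond graph `Dₙ`. -/
def DiamondV (n : ℕ) : Type := (DiamondData n).1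

/-- The shortest path distance on the unweighted diamond graph `Dₙ`. -/
def diamondDist (n : ℕ) (x y : DiamondV n) : ℝ :=
  ((DiamondData n).2.dist x y : ℝ)

open SimpleGraph

/-- The graph obtained from `G` by replacing each edge by a quadrilateral. -/
abbrev diamondSubdivision {V : Type} (G : SimpleGraph V) :
    SimpleGraph (V ⊕ {p : V × V // G.Adj p.1 p.2}) :=
  SimpleGraph.fromRel (subdivRel G.Adj)

/-- A map that moves the ends of each edge by at most `K` is `K`-Lipschitz. -/
theorem norm_sub_le_of_adj {V E : Type*} [SeminormedAddCommGroup E] {G : SimpleGraph V}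
    (hG : G.Connected) {f : V → E} {K : ℝ} (h : ∀ u v, G.Adj u v → ‖f u - f v‖ ≤ K) (u v : V) :
    ‖f u - f v‖ ≤ K * G.dist u v := by
  obtain ⟨p, hp⟩ := hG.exists_walk_length_eq_dist u v
  rw [← hp]
  clear hp
  induction p with
  | nil => simp
  | @cons a b c hab q ih =>
    calc ‖f a - f c‖ = ‖(f a - f b) + (f b - f c)‖ := by congr 1; abel
      _ ≤ ‖f a - f b‖ + ‖f b - f c‖ := norm_add_le _ _
      _ ≤ K + K * q.length := add_le_add (h _ _ hab) ih
      _ = K * (Walk.cons hab q).length := by rw [Walk.length_cons]; push_cast; ring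

section Subdivision

variable {V : Type} {G : SimpleGraph V}

theorem diamondSubdivision_adj_inl_inr {u : V} {p : {p : V × V // G.Adj p.1 p.2}} :
    (diamondSubdivision G).Adj (Sum.inl u) (Sum.inr p) ↔ u = p.1.1 ∨ u = p.1.2 := by
  simp [diamondSubdivision, SimpleGraph.fromRel_adj, subdivRel]

theorem diamondSubdivision_adj_cases
    {x y : V ⊕ {p : V × V // G.Adj p.1 p.2}} (h : (diamondSubdivision G).Adj x y) :
    ∃ u p, (u = p.1.1 ∨ u = p.1.2) ∧
      (x = Sum.inl u ∧ y = Sum.inr p ∨ x = Sum.inr p ∧ y = Sum.inl u) := by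
  rcases x with u | p <;> rcases y with v | q
  · simp [diamondSubdivision, SimpleGraph.fromRel_adj, subdivRel] at h
  · exact ⟨u, q, diamondSubdivision_adj_inl_inr.1 h, Or.inl ⟨rfl, rfl⟩⟩
  · exact ⟨v, p, diamondSubdivision_adj_inl_inr.1 h.symm, Or.inr ⟨rfl, rfl⟩⟩
  · simp [diamondSubdivision, SimpleGraph.fromRel_adj, subdivRel] at h

theorem exists_walk_diamondSubdivision {u v : V} (p : G.Walk u v) :
    ∃ q : (diamondSubdivision G).Walk (Sum.inl u) (Sum.inl v), q.length = 2 * p.length := by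
  induction p with
  | nil => exact ⟨Walk.nil, rfl⟩
  | @cons a b c hab p ih =>
    obtain ⟨q, hq⟩ := ih
    have h₁ : (diamondSubdivision G).Adj (Sum.inl a) (Sum.inr ⟨(a, b), hab⟩) :=
      diamondSubdivision_adj_inl_inr.2 (Or.inl rfl)
    have h₂ : (diamondSubdivision G).Adj (Sum.inr ⟨(a, b), hab⟩) (Sum.inl b) :=
      (diamondSubdivision_adj_inl_inr.2 (Or.inr rfl)).symm
    refine ⟨Walk.cons h₁ (Walk.cons h₂ q), ?_⟩
    simp only [Walk.length_cons, hq]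
    ring

theorem diamondSubdivision_connected (hG : G.Connected) : (diamondSubdivision G).Connected := by
  have hreach : ∀ x : V ⊕ {p : V × V // G.Adj p.1 p.2}, ∃ u : V,
      (diamondSubdivision G).Reachable x (Sum.inl u) := by
    rintro (u | p)
    · exact ⟨u, Reachable.refl _⟩
    · exact ⟨p.1.1, (diamondSubdivision_adj_inl_inr.2 (Or.inl rfl)).symm.reachable⟩
  have : Nonempty V := hG.nonempty
  refine ⟨fun x y => ?_⟩
  obtain ⟨u, hu⟩ := hreach x
  obtain ⟨v, hv⟩ := hreach y
  obtain ⟨p⟩ := hG.preconnected u v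
  obtain ⟨q, -⟩ := exists_walk_diamondSubdivision p
  exact hu.trans (q.reachable.trans hv.symm)

theorem dist_diamondSubdivision_inl (hG : G.Connected) (u v : V) :
    (diamondSubdivision G).dist (Sum.inl u) (Sum.inl v) = 2 * G.dist u v := by
  apply le_antisymm
  · obtain ⟨p, hp⟩ := hG.exists_walk_length_eq_dist u v
    obtain ⟨q, hq⟩ := exists_walk_diamondSubdivision p
    rw [← hp, ← hq]
    exact SimpleGraph.dist_le q
  · let φ : V ⊕ {p : V × V // G.Adj p.1 p.2} → ℝ :=
      Sum.elim (fun w => 2 * (G.dist u w : ℝ)) fun p => G.dist u p.1.1 + G.dist u p.1.2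
    have hlip : ∀ a b, G.Adj a b → (G.dist u a : ℝ) ≤ G.dist u b + 1 := by
      intro a b hab
      have h := hG.dist_triangle (u := u) (v := b) (w := a)
      rw [SimpleGraph.dist_eq_one_iff_adj.2 hab.symm] at h
      exact_mod_cast h
    have key : ∀ (w : V) (p : {p : V × V // G.Adj p.1 p.2}), (w = p.1.1 ∨ w = p.1.2) →
        |φ (Sum.inl w) - φ (Sum.inr p)| ≤ 1 := by
      rintro w ⟨⟨a, b⟩, hab⟩ hw
      have h₁ := hlip a b hab
      have h₂ := hlip b a hab.symm
      rw [abs_le]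
      rcases hw with rfl | rfl <;> simp only [φ, Sum.elim_inl, Sum.elim_inr] <;>
        constructor <;> linarith
    have h := norm_sub_le_of_adj (diamondSubdivision_connected hG) (f := φ) (K := 1) (by
      intro x y hxy
      obtain ⟨w, p, hw, ⟨rfl, rfl⟩ | ⟨rfl, rfl⟩⟩ := diamondSubdivision_adj_cases hxy
      · exact key w p hw
      · rw [norm_sub_rev]; exact key w p hw) (Sum.inl v) (Sum.inl u)
    have h' : (2 * G.dist u v : ℝ) ≤ (diamondSubdivision G).dist (Sum.inl v) (Sum.inl u) := by
      have := le_trans (le_abs_self _) h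
      simpa [φ] using this
    rw [SimpleGraph.dist_comm (u := Sum.inl v)] at h'
    exact_mod_cast h'

theorem two_le_dist_diamondSubdivision_inr {u v : V} (hG : G.Connected) (h : G.Adj u v) :
    2 ≤ (diamondSubdivision G).dist (Sum.inr ⟨(u, v), h⟩) (Sum.inr ⟨(v, u), h.symm⟩) := by
  by_contra hlt
  have hlt : (diamondSubdivision G).dist (Sum.inr ⟨(u, v), h⟩) (Sum.inr ⟨(v, u), h.symm⟩) = 0 ∨
      (diamondSubdivision G).dist (Sum.inr ⟨(u, v), h⟩) (Sum.inr ⟨(v, u), h.symm⟩) = 1 := by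
    omega
  rcases hlt with h0 | h1
  · have := (diamondSubdivision_connected hG).dist_eq_zero_iff.1 h0
    simp only [Sum.inr.injEq, Subtype.mk.injEq, Prod.mk.injEq] at this
    exact h.ne this.1
  · obtain ⟨w, p, -, ⟨h₁, -⟩ | ⟨-, h₂⟩⟩ :=
      diamondSubdivision_adj_cases (SimpleGraph.dist_eq_one_iff_adj.1 h1)
    · simp at h₁
    · simp at h₂

end Subdivision

theorem diamondData_connected : ∀ n, (DiamondData n).2.Connected
  | 0 => by
    have : Nonempty (DiamondData 0).1 := ⟨(false : Bool)⟩
    refine ⟨fun a b => ?_⟩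
    by_cases hab : a = b
    · rw [hab]
    · exact Adj.reachable ((SimpleGraph.fromRel_adj _ _ _).2 ⟨hab, Or.inl hab⟩)
  | n + 1 => diamondSubdivision_connected (diamondData_connected n)

/-- `u` and `v` are the images in `Dₙ` of the ends of an edge of `D₍ₙ₋ⱼ₎`. -/
def IsCoarseEdge : ∀ n : ℕ, ℕ → (DiamondData n).1 → (DiamondData n).1 → Prop
  | n, 0, u, v => (DiamondData n).2.Adj u v
  | 0, _ + 1, _, _ => False
  | n + 1, j + 1, u, v => ∃ u' v' : (DiamondData n).1,
      u = Sum.inl u' ∧ v = Sum.inl v' ∧ IsCoarseEdge n j u' v'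

theorem exists_isCoarseEdge_self : ∀ n, ∃ u v, IsCoarseEdge n n u v
  | 0 => ⟨(false : Bool), (true : Bool), by
      show (SimpleGraph.fromRel fun a b : Bool => a ≠ b).Adj false true
      simp [SimpleGraph.fromRel_adj]⟩
  | n + 1 => by
    obtain ⟨u, v, h⟩ := exists_isCoarseEdge_self n
    exact ⟨Sum.inl u, Sum.inl v, u, v, rfl, rfl, h⟩

theorem IsCoarseEdge.dist_le : ∀ {n j : ℕ} {u v : (DiamondData n).1}, IsCoarseEdge n j u v →
    (DiamondData n).2.dist u v ≤ 2 ^ j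
  | n, 0, u, v, h => by
    have h' : (DiamondData n).2.Adj u v := by
      cases n <;> exact h
    rw [SimpleGraph.dist_eq_one_iff_adj.2 h']
    simp
  | 0, _ + 1, _, _, h => h.elim
  | n + 1, j + 1, _, _, ⟨u, v, rfl, rfl, h⟩ => by
    have ih := h.dist_le
    have := dist_diamondSubdivision_inl (diamondData_connected n) u v
    rw [pow_succ]
    exact this.le.trans (by omega)

theorem IsCoarseEdge.exists_quadrilateral : ∀ {n j : ℕ} {u v : (DiamondData n).1},
    IsCoarseEdge n (j + 1) u v → ∃ a b, IsCoarseEdge n j u a ∧ IsCoarseEdge n j a v ∧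
      IsCoarseEdge n j u b ∧ IsCoarseEdge n j b v ∧
      2 ^ (j + 1) ≤ (DiamondData n).2.dist a b
  | 0, _, _, _, h => h.elim
  | n + 1, 0, _, _, ⟨u, v, rfl, rfl, h⟩ => by
    have h' : (DiamondData n).2.Adj u v := by
      cases n <;> exact h
    exact ⟨Sum.inr ⟨(u, v), h'⟩, Sum.inr ⟨(v, u), h'.symm⟩,
      diamondSubdivision_adj_inl_inr.2 (Or.inl rfl),
      (diamondSubdivision_adj_inl_inr.2 (Or.inr rfl)).symm,
      diamondSubdivision_adj_inl_inr.2 (Or.inr rfl),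
      (diamondSubdivision_adj_inl_inr.2 (Or.inl rfl)).symm,
      two_le_dist_diamondSubdivision_inr (diamondData_connected n) h'⟩
  | n + 1, j + 1, _, _, ⟨u, v, rfl, rfl, h⟩ => by
    obtain ⟨a, b, h₁, h₂, h₃, h₄, h₅⟩ := h.exists_quadrilateral
    refine ⟨Sum.inl a, Sum.inl b, ⟨u, a, rfl, rfl, h₁⟩, ⟨a, v, rfl, rfl, h₂⟩,
      ⟨u, b, rfl, rfl, h₃⟩, ⟨b, v, rfl, rfl, h₄⟩, ?_⟩
    have := dist_diamondSubdivision_inl (diamondData_connected n) a b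
    rw [pow_succ]
    exact le_trans (by omega) this.ge

section TailCount

variable {V : Type} {A : V → V → Prop}

/-- Each vertex of a diamond graph is coded by a finite set of naturals; `T w k` counts the
elements of the code of `w` that are at least `k`. Subdividing doubles each block of the code, and
the two new vertices on an edge receive complementary halves of the block of that edge. -/
def subdivTail (T : V → ℕ → ℤ) : V ⊕ {p : V × V // A p.1 p.2} → ℕ → ℤ
  | Sum.inl w, k => T w ((k + 1) / 2) + T w (k / 2)
  | Sum.inr p, k => T p.1.2 ((k + 1) / 2) + T p.1.1 (k / 2)

/-- The four labelled, upward oriented edges into which the edge from `b` up to `t` with label `i`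
is divided. -/
inductive ChildEdge (b t : V) (i : ℕ) :
    V ⊕ {p : V × V // A p.1 p.2} → V ⊕ {p : V × V // A p.1 p.2} → ℕ → Prop
  | lowerLeft (a : A b t) : ChildEdge b t i (Sum.inl b) (Sum.inr ⟨(b, t), a⟩) (2 * i)
  | upperLeft (a : A b t) : ChildEdge b t i (Sum.inr ⟨(b, t), a⟩) (Sum.inl t) (2 * i + 1)
  | lowerRight (a : A t b) : ChildEdge b t i (Sum.inl b) (Sum.inr ⟨(t, b), a⟩) (2 * i + 1)
  | upperRight (a : A t b) : ChildEdge b t i (Sum.inr ⟨(t, b), a⟩) (Sum.inl t) (2 * i)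

theorem ChildEdge.subdivTail_eq {T : V → ℕ → ℤ} {b t : V} {i : ℕ}
    (hT : ∀ k, T t k = T b k + if k ≤ i then 1 else 0)
    {x y : V ⊕ {p : V × V // A p.1 p.2}} {j : ℕ} (h : ChildEdge b t i x y j) (k : ℕ) :
    subdivTail T y k = subdivTail T x k + if k ≤ j then 1 else 0 := by
  rcases h with a | a | a | a <;> simp only [subdivTail, hT] <;> split_ifs <;> omega

/-- The vertex `x` lies between the ends `b`, `t` of a block with label `i`. -/
structure LiesBetween (d : V → V → ℤ) (T : V → ℕ → ℤ) (b t : V) (i : ℕ) (x : V) : Prop where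
  dist_bot : d x b ≤ T x 0 - T b 0
  dist_top : d x t ≤ T t 0 - T x 0
  tail : ∀ k, T x k = T b k + if k ≤ i then T x 0 - T b 0 else 0

/-- The possible relative positions of two edges `(b, t)` and `(b', t')` with labels `i`, `i'`. -/
inductive EdgePosition (d : V → V → ℤ) (T : V → ℕ → ℤ) (b t : V) (i : ℕ) (b' t' : V) (i' : ℕ) :
    Prop
  | comparable (h : d t b' ≤ T b' 0 - T t 0)
  | low (k : ℕ) (c : ℤ) (hi : i < k) (hi' : k ≤ i') (hd : d b b' ≤ T b 0 + T b' 0 - 2 * c)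
      (hb : c ≤ T b 0) (hb' : c ≤ T b' 0) (hT : T b' k - T b k = T b' 0 - c)
  | high (k : ℕ) (c : ℤ) (hi : k ≤ i) (hi' : i' < k) (hd : d t t' ≤ 2 * c - T t 0 - T t' 0)
      (ht : T t 0 ≤ c) (ht' : T t' 0 ≤ c) (hT : T b' k - T b k = c - T b 0)
  | oppositeLeft (k : ℕ) (c L : ℤ) (hi : i < k) (hi' : i' < k)
      (hd : d b b' ≤ T b 0 + T b' 0 - 2 * c) (hd' : d t t' ≤ 2 * (c + 2 * L) - T t 0 - T t' 0)
      (hT : T b' k - T b k = L)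
  | oppositeRight (k : ℕ) (c L : ℤ) (hi : k ≤ i) (hi' : k ≤ i')
      (hd : d b b' ≤ T b 0 + T b' 0 - 2 * c) (hd' : d t t' ≤ 2 * (c + 2 * L) - T t 0 - T t' 0)
      (hT : (T b 0 - T b k) - (T b' 0 - T b' k) = L)

/-- Vertices on edges in one of the listed positions are separated by tail counts. -/
theorem EdgePosition.exists_tail_sub_ge {d : V → V → ℤ} {T : V → ℕ → ℤ} {b t b' t' x y : V}
    {i i' : ℕ} (hsymm : ∀ x y, d x y = d y x) (htri : ∀ x y z, d x z ≤ d x y + d y z)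
    (h : EdgePosition d T b t i b' t' i') (hx : LiesBetween d T b t i x)
    (hy : LiesBetween d T b' t' i' y) (hxt : T x 0 ≤ T t 0) (hby : T b' 0 ≤ T y 0) : ∃ k, d x y ≤ 4 * |T y k - T x k| := by
  by_contra! hcon
  have bot : d x y ≤ d b b' + (T x 0 - T b 0) + (T y 0 - T b' 0) := by
    linarith [htri x b y, htri b b' y, hx.dist_bot, hy.dist_bot, hsymm b' y]
  have top : d x y ≤ d t t' + (T t 0 - T x 0) + (T t' 0 - T y 0) := by
    linarith [htri x t y, htri t t' y, hx.dist_top, hy.dist_top, hsymm t' y]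
  have h0 := hcon 0
  rcases h with h | ⟨k, c, hi, hi', hd, hb, hb', hT⟩ | ⟨k, c, hi, hi', hd, ht, ht', hT⟩ |
    ⟨k, c, L, hi, hi', hd, hd', hT⟩ | ⟨k, c, L, hi, hi', hd, hd', hT⟩
  · have : d x y ≤ T y 0 - T x 0 := by
      linarith [htri x t y, htri t b' y, hx.dist_top, hy.dist_bot, hsymm b' y]
    rcases abs_cases (T y 0 - T x 0) with ⟨h1, h2⟩ | ⟨h1, h2⟩ <;> omega
  all_goals
    have hk := hcon k
    have hxk := hx.tail k
    have hyk := hy.tail k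
    split_ifs at hxk hyk <;> try omega
  all_goals
    rcases abs_cases (T y 0 - T x 0) with ⟨h1, h2⟩ | ⟨h1, h2⟩ <;>
    rcases abs_cases (T y k - T x k) with ⟨h3, h4⟩ | ⟨h3, h4⟩ <;> omega

end TailCount

section SubdivisionEdges

variable {V : Type} {G : SimpleGraph V} {T : V → ℕ → ℤ}

/-- A child of the edge `(b, t)` of label `i`, placed in the subdivided graph. -/
structure IsChildEdge (d : V → V → ℤ) (T : V → ℕ → ℤ) (b t : V) (i : ℕ) (x y : V) (j : ℕ) :
    Prop where
  label : j = 2 * i ∨ j = 2 * i + 1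
  bot_bot : d x b ≤ T x 0 - T b 0
  top_top : d y t ≤ T t 0 - T y 0
  bot_le : T b 0 ≤ T x 0
  le_top : T y 0 ≤ T t 0
  tail : ∀ k, T x (2 * k) = T b (2 * k) + if k ≤ i then T x 0 - T b 0 else 0

theorem ChildEdge.isChildEdge {b t : V} {i : ℕ}
    (hT : ∀ k, T t k = T b k + if k ≤ i then 1 else 0)
    {x y : V ⊕ {p : V × V // G.Adj p.1 p.2}} {j : ℕ} (h : ChildEdge b t i x y j) :
    IsChildEdge (fun u v => ((diamondSubdivision G).dist u v : ℤ))
      (subdivTail T) (Sum.inl b) (Sum.inl t) i x y j := by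
  have key : ∀ k : ℕ, (2 * k + 1) / 2 = k := fun k => by omega
  have h0 := hT 0
  simp only [zero_le, if_true] at h0
  rcases h with a | a | a | a <;> refine ⟨?_, ?_, ?_, ?_, ?_, fun k => ?_⟩ <;>
    try simp [subdivTail, h0, key]
  all_goals first
    | omega
    | exact (SimpleGraph.dist_eq_one_iff_adj.2
        (diamondSubdivision_adj_inl_inr.2 (by simp)).symm).le
    | (rw [hT]; split_ifs <;> omega)

theorem ChildEdge.sibling {b t : V} {i : ℕ}
    (hT : ∀ k, T t k = T b k + if k ≤ i then 1 else 0)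
    {x y x' y' : V ⊕ {p : V × V // G.Adj p.1 p.2}} {j j' : ℕ}
    (h : ChildEdge b t i x y j) (h' : ChildEdge b t i x' y' j') :
    (x = x' ∧ y = y' ∧ j = j') ∨
      EdgePosition (fun u v => ((diamondSubdivision G).dist u v : ℤ)) (subdivTail T)
        x y j x' y' j' ∨
      EdgePosition (fun u v => ((diamondSubdivision G).dist u v : ℤ)) (subdivTail T)
        x' y' j' x y j := by
  have key : ∀ k : ℕ, (2 * k + 1) / 2 = k := fun k => by omega
  have key' : ∀ k : ℕ, (2 * k + 1 + 1) / 2 = k + 1 := fun k => by omega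
  have h0 := hT 0
  have hi := hT i
  have hi' := hT (i + 1)
  simp only [zero_le, if_true, le_refl, add_le_iff_nonpos_right, nonpos_iff_eq_zero, one_ne_zero,
    if_false] at h0 hi hi'
  rcases h with a | a | a | a <;> rcases h' with a' | a' | a' | a'
  case lowerLeft.lowerLeft | upperLeft.upperLeft | lowerRight.lowerRight | upperRight.upperRight =>
    exact Or.inl ⟨rfl, rfl, rfl⟩
  case lowerLeft.upperLeft | lowerRight.upperRight =>
    exact Or.inr (Or.inl (.comparable (by simp [subdivTail])))
  case upperLeft.lowerLeft | upperRight.lowerRight =>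
    exact Or.inr (Or.inr (.comparable (by simp [subdivTail])))
  case lowerLeft.lowerRight =>
    exact Or.inr (Or.inl (.low (2 * i + 1) (2 * T b 0) (by omega) (by omega)
      (by simp [subdivTail]; try omega) (by simp [subdivTail]; try omega)
      (by simp [subdivTail]; try omega) (by simp [subdivTail, key, key']; try omega)))
  case lowerRight.lowerLeft =>
    exact Or.inr (Or.inr (.low (2 * i + 1) (2 * T b 0) (by omega) (by omega)
      (by simp [subdivTail]; try omega) (by simp [subdivTail]; try omega)
      (by simp [subdivTail]; try omega) (by simp [subdivTail, key, key']; try omega)))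
  case upperLeft.upperRight =>
    exact Or.inr (Or.inl (.high (2 * i + 1) (2 * T t 0) (by omega) (by omega)
      (by simp [subdivTail]; try omega) (by simp [subdivTail]; try omega)
      (by simp [subdivTail]; try omega) (by simp [subdivTail, key, key']; try omega)))
  case upperRight.upperLeft =>
    exact Or.inr (Or.inr (.high (2 * i + 1) (2 * T t 0) (by omega) (by omega)
      (by simp [subdivTail]; try omega) (by simp [subdivTail]; try omega)
      (by simp [subdivTail]; try omega) (by simp [subdivTail, key, key']; try omega)))
  all_goals
    have hA : G.Adj b t := by first | exact a | exact a.symm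
    have d1 : ∀ {u v}, (diamondSubdivision G).Adj u v → (diamondSubdivision G).dist u v = 1 :=
      SimpleGraph.dist_eq_one_iff_adj.2
  case lowerLeft.upperRight =>
    exact Or.inr (Or.inl (.oppositeLeft (2 * i + 1) (2 * T b 0) 1 (by omega) (by omega)
      (by rw [d1 (diamondSubdivision_adj_inl_inr.2 (by simp))]; simp [subdivTail]; try omega)
      (by rw [d1 (diamondSubdivision_adj_inl_inr.2 (by simp)).symm]; simp [subdivTail]; try omega)
      (by simp [subdivTail, key, key']; try omega)))
  case upperRight.lowerLeft =>
    exact Or.inr (Or.inr (.oppositeLeft (2 * i + 1) (2 * T b 0) 1 (by omega) (by omega)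
      (by rw [d1 (diamondSubdivision_adj_inl_inr.2 (by simp))]; simp [subdivTail]; try omega)
      (by rw [d1 (diamondSubdivision_adj_inl_inr.2 (by simp)).symm]; simp [subdivTail]; try omega)
      (by simp [subdivTail, key, key']; try omega)))
  case upperLeft.lowerRight =>
    exact Or.inr (Or.inl (.oppositeRight (2 * i + 1) (2 * T b 0) 1 (by omega) (by omega)
      (by rw [d1 (diamondSubdivision_adj_inl_inr.2 (by simp)).symm]; simp [subdivTail]; try omega)
      (by rw [d1 (diamondSubdivision_adj_inl_inr.2 (by simp))]; simp [subdivTail]; try omega)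
      (by simp [subdivTail, key, key']; try omega)))
  case lowerRight.upperLeft =>
    exact Or.inr (Or.inr (.oppositeRight (2 * i + 1) (2 * T b 0) 1 (by omega) (by omega)
      (by rw [d1 (diamondSubdivision_adj_inl_inr.2 (by simp)).symm]; simp [subdivTail]; try omega)
      (by rw [d1 (diamondSubdivision_adj_inl_inr.2 (by simp))]; simp [subdivTail]; try omega)
      (by simp [subdivTail, key, key']; try omega)))

theorem EdgePosition.child (hG : G.Connected) {b t b' t' : V} {i i' : ℕ}
    (h : EdgePosition (fun u v => (G.dist u v : ℤ)) T b t i b' t' i')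
    {x y x' y' : V ⊕ {p : V × V // G.Adj p.1 p.2}} {j j' : ℕ}
    (hc : IsChildEdge (fun u v => ((diamondSubdivision G).dist u v : ℤ))
      (subdivTail T) (Sum.inl b) (Sum.inl t) i x y j)
    (hc' : IsChildEdge (fun u v => ((diamondSubdivision G).dist u v : ℤ))
      (subdivTail T) (Sum.inl b') (Sum.inl t') i' x' y' j') :
    EdgePosition (fun u v => ((diamondSubdivision G).dist u v : ℤ)) (subdivTail T)
      x y j x' y' j' := by
  have htri : ∀ u v w, ((diamondSubdivision G).dist u w : ℤ) ≤
      (diamondSubdivision G).dist u v + (diamondSubdivision G).dist v w := fun u v w => by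
    exact_mod_cast (diamondSubdivision_connected hG).dist_triangle
  have hsymm : ∀ u v, ((diamondSubdivision G).dist u v : ℤ) = (diamondSubdivision G).dist v u :=
    fun u v => by rw [SimpleGraph.dist_comm]
  have hdbl : ∀ u v, ((diamondSubdivision G).dist (Sum.inl u) (Sum.inl v) : ℤ) = 2 * G.dist u v :=
    fun u v => by exact_mod_cast dist_diamondSubdivision_inl hG u v
  have key : ∀ k : ℕ, (2 * k + 1) / 2 = k := fun k => by omega
  have hinl : ∀ (w : V) k, subdivTail (A := G.Adj) T (Sum.inl w) (2 * k) = 2 * T w k := by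
    intro w k; simp [subdivTail, key]; ring
  have hinl0 : ∀ w : V, subdivTail (A := G.Adj) T (Sum.inl w) 0 = 2 * T w 0 := fun w => hinl w 0
  obtain ⟨hl, hbb, htt, hbl, htl, htail⟩ := hc
  obtain ⟨hl', hbb', htt', hbl', htl', htail'⟩ := hc'
  simp only [hinl, hinl0] at *
  have bot : ((diamondSubdivision G).dist x x' : ℤ) ≤ 2 * G.dist b b' +
      (subdivTail T x 0 - 2 * T b 0) + (subdivTail T x' 0 - 2 * T b' 0) := by
    linarith [htri x (Sum.inl b) x', htri (Sum.inl b) (Sum.inl b') x', hdbl b b',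
      hsymm (Sum.inl b') x']
  have top : ((diamondSubdivision G).dist y y' : ℤ) ≤ 2 * G.dist t t' +
      (2 * T t 0 - subdivTail T y 0) + (2 * T t' 0 - subdivTail T y' 0) := by
    linarith [htri y (Sum.inl t) y', htri (Sum.inl t) (Sum.inl t') y', hdbl t t',
      hsymm (Sum.inl t') y']
  rcases h with h | ⟨k, c, hi, hi', hd, hb, hb', hT⟩ | ⟨k, c, hi, hi', hd, ht, ht', hT⟩ |
    ⟨k, c, L, hi, hi', hd, hd', hT⟩ | ⟨k, c, L, hi, hi', hd, hd', hT⟩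
  · exact .comparable (by
      linarith [htri y (Sum.inl t) x', htri (Sum.inl t) (Sum.inl b') x', hdbl t b',
        hsymm (Sum.inl b') x'])
  all_goals
    have hk := htail k
    have hk' := htail' k
  · rw [if_neg (by omega)] at hk
    rw [if_pos (by omega)] at hk'
    exact .low (2 * k) (2 * c) (by omega) (by omega) (by linarith) (by linarith) (by linarith)
      (by linarith)
  · rw [if_pos (by omega)] at hk
    rw [if_neg (by omega)] at hk'
    exact .high (2 * k) (2 * c) (by omega) (by omega) (by linarith) (by linarith) (by linarith)
      (by linarith)
  · rw [if_neg (by omega)] at hk hk'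
    exact .oppositeLeft (2 * k) (2 * c) (2 * L) (by omega) (by omega) (by linarith) (by linarith)
      (by linarith)
  · rw [if_pos (by omega)] at hk hk'
    exact .oppositeRight (2 * k) (2 * c) (2 * L) (by omega) (by omega) (by linarith) (by linarith)
      (by linarith)

end SubdivisionEdges

section DiamondCoding

/-- The tail counts of the codes of the vertices of `Dₙ` by subsets of `{0, …, 2 ^ n - 1}`. -/
def diamondTail : ∀ n : ℕ, (DiamondData n).1 → ℕ → ℤ
  | 0 => fun (b : Bool) k => if b = true ∧ k = 0 then 1 else 0
  | n + 1 => subdivTail (diamondTail n)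

/-- The edges of `Dₙ`, oriented upwards and labelled by the natural they add to the code. -/
def DiamondEdge : ∀ n : ℕ, (DiamondData n).1 → (DiamondData n).1 → ℕ → Prop
  | 0 => fun (b t : Bool) i => b = false ∧ t = true ∧ i = 0
  | n + 1 => fun x y j => ∃ b t i, DiamondEdge n b t i ∧ ChildEdge b t i x y j

theorem DiamondEdge.tail_eq : ∀ {n : ℕ} {b t : (DiamondData n).1} {i : ℕ},
    DiamondEdge n b t i → ∀ k, diamondTail n t k = diamondTail n b k + if k ≤ i then 1 else 0
  | 0, _, _, _, ⟨rfl, rfl, rfl⟩, k => by simp [diamondTail]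
  | _ + 1, _, _, _, ⟨_, _, _, h, hc⟩, k => hc.subdivTail_eq h.tail_eq k

theorem DiamondEdge.adj : ∀ {n : ℕ} {b t : (DiamondData n).1} {i : ℕ},
    DiamondEdge n b t i → (DiamondData n).2.Adj b t
  | 0, _, _, _, ⟨rfl, rfl, rfl⟩ => by
    show (SimpleGraph.fromRel fun a b : Bool => a ≠ b).Adj false true
    simp [SimpleGraph.fromRel_adj]
  | n + 1, _, _, _, ⟨b, t, i, h, hc⟩ => by
    show (diamondSubdivision (DiamondData n).2).Adj _ _
    rcases hc with a | a | a | a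
    · exact diamondSubdivision_adj_inl_inr.2 (Or.inl rfl)
    · exact (diamondSubdivision_adj_inl_inr.2 (Or.inr rfl)).symm
    · exact diamondSubdivision_adj_inl_inr.2 (Or.inr rfl)
    · exact (diamondSubdivision_adj_inl_inr.2 (Or.inl rfl)).symm

theorem exists_diamondEdge_of_adj : ∀ {n : ℕ} {u v : (DiamondData n).1},
    (DiamondData n).2.Adj u v → ∃ i < 2 ^ n, DiamondEdge n u v i ∨ DiamondEdge n v u i
  | 0, u, v, h => by
    refine ⟨0, by simp, ?_⟩
    change Bool at u v
    have h : u ≠ v := h.ne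
    cases u <;> cases v <;> simp [DiamondEdge] at h ⊢
  | n + 1, x, y, h => by
    obtain ⟨u, ⟨⟨v, w⟩, a⟩, hu, hxy⟩ := diamondSubdivision_adj_cases (G := (DiamondData n).2) h
    suffices hs : ∃ i < 2 ^ (n + 1), DiamondEdge (n + 1) (Sum.inl u) (Sum.inr ⟨(v, w), a⟩) i ∨
        DiamondEdge (n + 1) (Sum.inr ⟨(v, w), a⟩) (Sum.inl u) i by
      obtain ⟨i, hi, hs⟩ := hs
      rcases hxy with ⟨rfl, rfl⟩ | ⟨rfl, rfl⟩
      · exact ⟨i, hi, hs⟩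
      · exact ⟨i, hi, hs.symm⟩
    obtain ⟨i, hi, he⟩ := exists_diamondEdge_of_adj a
    rw [pow_succ]
    rcases hu with rfl | rfl <;> rcases he with he | he
    · exact ⟨2 * i, by omega, Or.inl ⟨_, _, _, he, .lowerLeft a⟩⟩
    · exact ⟨2 * i, by omega, Or.inr ⟨_, _, _, he, .upperRight a⟩⟩
    · exact ⟨2 * i + 1, by omega, Or.inr ⟨_, _, _, he, .upperLeft a⟩⟩
    · exact ⟨2 * i + 1, by omega, Or.inl ⟨_, _, _, he, .lowerRight a⟩⟩

theorem diamondTail_eq_zero : ∀ {n : ℕ} (u : (DiamondData n).1) {k : ℕ}, 2 ^ n ≤ k →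
    diamondTail n u k = 0
  | 0, u, k, hk => by
    have : k ≠ 0 := by rintro rfl; simp at hk
    simp [diamondTail, this]
  | n + 1, u, k, hk => by
    rw [pow_succ] at hk
    have h₁ : 2 ^ n ≤ (k + 1) / 2 := by omega
    have h₂ : 2 ^ n ≤ k / 2 := by omega
    rcases u with w | p <;>
      simp [diamondTail, subdivTail, diamondTail_eq_zero _ h₁, diamondTail_eq_zero _ h₂]

theorem DiamondEdge.position : ∀ {n : ℕ} {b t b' t' : (DiamondData n).1} {i i' : ℕ},
    DiamondEdge n b t i → DiamondEdge n b' t' i' → (b = b' ∧ t = t' ∧ i = i') ∨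
      EdgePosition (fun u v => ((DiamondData n).2.dist u v : ℤ)) (diamondTail n) b t i b' t' i' ∨
      EdgePosition (fun u v => ((DiamondData n).2.dist u v : ℤ)) (diamondTail n) b' t' i' b t i
  | 0, _, _, _, _, _, _, ⟨h₁, h₂, h₃⟩, ⟨h₄, h₅, h₆⟩ =>
    Or.inl ⟨h₁.trans h₄.symm, h₂.trans h₅.symm, h₃.trans h₆.symm⟩
  | n + 1, _, _, _, _, _, _, ⟨b, t, i, h, hc⟩, ⟨b', t', i', h', hc'⟩ => by
    rcases h.position h' with ⟨rfl, rfl, rfl⟩ | hp | hp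
    · exact hc.sibling h.tail_eq hc'
    · exact Or.inr (Or.inl (hp.child (diamondData_connected n) (hc.isChildEdge h.tail_eq)
        (hc'.isChildEdge h'.tail_eq)))
    · exact Or.inr (Or.inr (hp.child (diamondData_connected n) (hc'.isChildEdge h'.tail_eq)
        (hc.isChildEdge h.tail_eq)))

theorem DiamondEdge.liesBetween {n : ℕ} {b t x : (DiamondData n).1} {i : ℕ}
    (h : DiamondEdge n b t i) (hx : x = b ∨ x = t) :
    LiesBetween (fun u v => ((DiamondData n).2.dist u v : ℤ)) (diamondTail n) b t i x ∧
      diamondTail n b 0 ≤ diamondTail n x 0 ∧ diamondTail n x 0 ≤ diamondTail n t 0 := by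
  have h0 := h.tail_eq 0
  simp only [zero_le, if_true] at h0
  have hd := SimpleGraph.dist_eq_one_iff_adj.2 h.adj
  have hd' := SimpleGraph.dist_eq_one_iff_adj.2 h.adj.symm
  rcases hx with rfl | rfl
  · refine ⟨⟨by simp, by simp [hd, h0], by simp⟩, le_rfl, by omega⟩
  · refine ⟨⟨by simp [hd', h0], by simp, fun k => ?_⟩, by omega, le_rfl⟩
    rw [h.tail_eq k, h0]
    simp

theorem exists_diamondEdge_mem {n : ℕ} (x : (DiamondData n).1) :
    ∃ b t i, DiamondEdge n b t i ∧ (x = b ∨ x = t) := by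
  have : Nontrivial (DiamondData n).1 := by
    obtain ⟨u, v, h⟩ : ∃ u v, (DiamondData n).2.Adj u v := by
      induction n with
      | zero => exact ⟨_, _, DiamondEdge.adj (n := 0) ⟨rfl, rfl, rfl⟩⟩
      | succ n ih =>
        obtain ⟨u, v, h⟩ : ∃ u v, (DiamondData n).2.Adj u v := by
          rcases x with w | p
          · exact ih w
          · exact ih p.1.1
        exact ⟨Sum.inl u, Sum.inr ⟨(u, v), h⟩, diamondSubdivision_adj_inl_inr.2 (Or.inl rfl)⟩
    exact ⟨u, v, h.ne⟩
  obtain ⟨y, hy⟩ := (diamondData_connected n).preconnected.exists_adj_of_nontrivial x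
  obtain ⟨i, -, h | h⟩ := exists_diamondEdge_of_adj hy
  · exact ⟨x, y, i, h, Or.inl rfl⟩
  · exact ⟨y, x, i, h, Or.inr rfl⟩

theorem exists_dist_le_diamondTail {n : ℕ} (x y : (DiamondData n).1) :
    ∃ k, ((DiamondData n).2.dist x y : ℤ) ≤ 4 * |diamondTail n y k - diamondTail n x k| := by
  have hsymm : ∀ u v, ((DiamondData n).2.dist u v : ℤ) = (DiamondData n).2.dist v u :=
    fun u v => by rw [SimpleGraph.dist_comm]
  have htri : ∀ u v w, ((DiamondData n).2.dist u w : ℤ) ≤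
      (DiamondData n).2.dist u v + (DiamondData n).2.dist v w := fun u v w => by
    exact_mod_cast (diamondData_connected n).dist_triangle
  obtain ⟨b, t, i, h, hx⟩ := exists_diamondEdge_mem x
  obtain ⟨b', t', i', h', hy⟩ := exists_diamondEdge_mem y
  obtain ⟨lx, hbx, hxt⟩ := h.liesBetween hx
  obtain ⟨ly, hby, hyt⟩ := h'.liesBetween hy
  rcases h.position h' with ⟨rfl, rfl, rfl⟩ | hp | hp
  · refine ⟨0, ?_⟩
    have h0 := h.tail_eq 0
    simp only [zero_le, if_true] at h0
    have hd := SimpleGraph.dist_eq_one_iff_adj.2 h.adj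
    have hd' := SimpleGraph.dist_eq_one_iff_adj.2 h.adj.symm
    rcases hx with rfl | rfl <;> rcases hy with rfl | rfl <;> simp [h0, hd, hd']
  · exact hp.exists_tail_sub_ge hsymm htri lx ly hxt hby
  · obtain ⟨k, hk⟩ := hp.exists_tail_sub_ge hsymm htri ly lx hyt hbx
    exact ⟨k, by rw [hsymm x y, abs_sub_comm]; exact hk⟩

end DiamondCoding

theorem sum_range_sub_mul_ite (a : ℕ → ℝ) (θ : ℝ) {k M : ℕ} (h : k ≤ M) :
    ∑ j ∈ Finset.range M, (a j - a (j + 1)) * (if k ≤ j then θ else 0) = θ * (a k - a M) := by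
  induction M, h using Nat.le_induction with
  | base =>
    rw [sub_self, mul_zero]
    refine Finset.sum_eq_zero fun j hj => ?_
    rw [if_neg (by simpa using hj), mul_zero]
  | succ M hM ih =>
    rw [Finset.sum_range_succ, ih, if_pos hM]
    ring

/-- `E` contains a system of `N` vectors `xᵢ` and functionals `fₖ` in the unit balls with
`fₖ(xᵢ) = θ` for `k ≤ i` and `fₖ(xᵢ) = 0` for `i < k`. -/
def HasJamesSystem (E : Type*) [NormedAddCommGroup E] [NormedSpace ℝ E] (θ : ℝ) (N : ℕ) : Prop :=
  ∃ (x : ℕ → E) (f : ℕ → StrongDual ℝ E), (∀ i < N, ‖x i‖ ≤ 1) ∧ (∀ i < N, ‖f i‖ ≤ 1) ∧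
    ∀ i < N, ∀ k < N, f k (x i) = if k ≤ i then θ else 0

theorem HasJamesSystem.exists_diamond_embedding {E : Type*} [NormedAddCommGroup E]
    [NormedSpace ℝ E] {θ : ℝ} (hθ : 0 < θ) {n : ℕ} (h : HasJamesSystem E θ (2 ^ n)) :
    ∃ F : DiamondV n → E, ∀ u v, θ / 4 * diamondDist n u v ≤ ‖F u - F v‖ ∧
      ‖F u - F v‖ ≤ diamondDist n u v := by
  obtain ⟨x, f, hx, hf, hfx⟩ := h
  let T : DiamondV n → ℕ → ℝ := fun w k => (diamondTail n w k : ℝ)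
  let F : DiamondV n → E := fun w => ∑ j ∈ Finset.range (2 ^ n), (T w j - T w (j + 1)) • x j
  have hF : ∀ w, ∀ k < 2 ^ n, f k (F w) = θ * T w k := by
    intro w k hk
    have hz : T w (2 ^ n) = 0 := by simp [T, diamondTail_eq_zero w le_rfl]
    have := sum_range_sub_mul_ite (T w) θ hk.le
    rw [hz, sub_zero] at this
    rw [← this, map_sum]
    refine Finset.sum_congr rfl fun j hj => ?_
    rw [map_smul, hfx j (Finset.mem_range.1 hj) k hk, smul_eq_mul]
  have hedge : ∀ u v i, i < 2 ^ n → DiamondEdge n u v i → ‖F v - F u‖ ≤ 1 := by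
    intro u v i hi he
    have : F v - F u = x i := by
      simp only [F]
      rw [← Finset.sum_sub_distrib, Finset.sum_eq_single i]
      · rw [← sub_smul]
        simp only [T, he.tail_eq]
        push_cast
        rw [if_pos le_rfl, if_neg (by omega)]
        ring_nf
        rw [one_smul]
      · intro j _ hj
        rw [← sub_smul]
        simp only [T, he.tail_eq]
        push_cast
        rcases lt_or_gt_of_ne hj with h | h
        · rw [if_pos h.le, if_pos (by omega)]
          ring_nf
          rw [zero_smul]
        · rw [if_neg (by omega), if_neg (by omega)]
          ring_nf
          rw [zero_smul]
      · intro h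
        exact absurd (Finset.mem_range.2 hi) h
    rw [this]
    exact hx i hi
  refine ⟨F, fun u v => ⟨?_, ?_⟩⟩
  · obtain ⟨k, hk⟩ := exists_dist_le_diamondTail u v
    have hk' : diamondDist n u v ≤ 4 * |T v k - T u k| := by
      simp only [diamondDist, T]
      exact_mod_cast hk
    rcases lt_or_ge k (2 ^ n) with hkn | hkn
    · have h1 : θ * |T v k - T u k| ≤ ‖F u - F v‖ := by
        calc θ * |T v k - T u k| = ‖f k (F u - F v)‖ := by
              rw [map_sub, hF u k hkn, hF v k hkn, ← mul_sub, Real.norm_eq_abs, abs_mul,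
                abs_of_pos hθ, abs_sub_comm]
          _ ≤ 1 * ‖F u - F v‖ := (f k).le_of_opNorm_le (hf k hkn) _
          _ = ‖F u - F v‖ := one_mul _
      nlinarith
    · have h0 : T v k - T u k = 0 := by
        simp [T, diamondTail_eq_zero u hkn, diamondTail_eq_zero v hkn]
      rw [h0, abs_zero, mul_zero] at hk'
      have := norm_nonneg (F u - F v)
      nlinarith
  · have := norm_sub_le_of_adj (diamondData_connected n) (f := F) (K := 1) (by
      intro u v huv
      obtain ⟨i, hi, he | he⟩ := exists_diamondEdge_of_adj huv
      · rw [norm_sub_rev]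
        exact hedge u v i hi he
      · exact hedge v u i hi he) u v
    simpa [diamondDist] using this

/-- Helly's theorem on simultaneous solutions of linear equations in a normed space. -/
theorem exists_norm_lt_and_apply_eq {E ι : Type*} [NormedAddCommGroup E] [NormedSpace ℝ E]
    [Fintype ι] (f : ι → StrongDual ℝ E) (c : ι → ℝ) {M R : ℝ} (hM : 0 ≤ M) (hMR : M < R)
    (h : ∀ a : ι → ℝ, |∑ i, a i * c i| ≤ M * ‖∑ i, a i • f i‖) :
    ∃ x, ‖x‖ < R ∧ ∀ i, f i x = c i := by
  classical
  obtain ⟨x₀, hx₀⟩ : ∃ x₀, ∀ i, f i x₀ = c i := by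
    let Φ : E →ₗ[ℝ] ι → ℝ := LinearMap.pi fun i => (f i : E →ₗ[ℝ] ℝ)
    by_contra hcon
    have hc : c ∉ LinearMap.range Φ := by
      rintro ⟨x, hx⟩
      exact hcon ⟨x, fun i => congrFun hx i⟩
    obtain ⟨g, hgc, hg⟩ := Submodule.exists_dual_map_eq_bot_of_notMem hc inferInstance
    have hsum : ∀ v : ι → ℝ, g v = ∑ i, g (Pi.single i 1) * v i := by
      intro v
      rw [LinearMap.pi_apply_eq_sum_univ g v]
      refine Finset.sum_congr rfl fun i _ => ?_
      rw [smul_eq_mul, mul_comm]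
      congr 2
      ext j
      simp [Pi.single_apply, eq_comm]
    have hzero : ∑ i, g (Pi.single i 1) • f i = 0 := by
      ext x
      have : g (Φ x) = 0 := by
        have : g (Φ x) ∈ (LinearMap.range Φ).map g := ⟨Φ x, ⟨x, rfl⟩, rfl⟩
        rwa [hg] at this
      rw [hsum] at this
      simpa [Φ] using this
    have := h fun i => g (Pi.single i 1)
    rw [hzero, norm_zero, mul_zero, ← hsum] at this
    exact hgc (abs_nonpos_iff.1 this)
  let K : Submodule ℝ E := ⨅ i, LinearMap.ker (f i : E →ₗ[ℝ] ℝ)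
  have hnorm : ‖(Submodule.Quotient.mk x₀ : E ⧸ K)‖ ≤ M := by
    obtain ⟨g, hg, hgx⟩ := exists_dual_vector'' ℝ (Submodule.Quotient.mk x₀ : E ⧸ K)
    let g' : StrongDual ℝ E := (g : (E ⧸ K) →ₗ[ℝ] ℝ).comp K.mkQ |>.mkContinuous 1 fun x => by
      calc ‖g (Submodule.Quotient.mk x)‖ ≤ 1 * ‖(Submodule.Quotient.mk x : E ⧸ K)‖ :=
            g.le_of_opNorm_le hg _
        _ ≤ 1 * ‖x‖ := by gcongr; exact Submodule.Quotient.norm_mk_le K x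
    have hg' : ‖g'‖ ≤ 1 := LinearMap.mkContinuous_norm_le _ zero_le_one _
    have hker : (⨅ i, LinearMap.ker (f i : E →ₗ[ℝ] ℝ)) ≤ LinearMap.ker (g' : E →ₗ[ℝ] ℝ) := by
      intro x hx
      have : (Submodule.Quotient.mk x : E ⧸ K) = 0 := (Submodule.Quotient.mk_eq_zero K).2 hx
      show g (Submodule.Quotient.mk x) = 0
      rw [this, map_zero]
    obtain ⟨a, ha⟩ := (Submodule.mem_span_range_iff_exists_fun ℝ).1
      (mem_span_of_iInf_ker_le_ker hker)
    have ha' : ∑ i, a i • f i = g' := by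
      ext x
      simpa using LinearMap.congr_fun ha x
    have hval : ∑ i, a i * c i = ‖(Submodule.Quotient.mk x₀ : E ⧸ K)‖ := by
      have h₁ : g' x₀ = ‖(Submodule.Quotient.mk x₀ : E ⧸ K)‖ := hgx
      rw [← h₁, ← ha']
      simp [hx₀]
    have := h a
    rw [hval, ha', abs_of_nonneg (norm_nonneg _)] at this
    nlinarith
  obtain ⟨x, hx, hxR⟩ := QuotientAddGroup.norm_lt_iff.1 (hnorm.trans_lt hMR)
  refine ⟨x, hxR, fun i => ?_⟩
  have hmem : x - x₀ ∈ K := (Submodule.Quotient.eq K).1 hx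
  have := (Submodule.mem_iInf _).1 hmem i
  rw [← hx₀ i, ← sub_eq_zero, ← map_sub]
  exact this

/-- A linear map with closed proper range stays at a positive distance from some direction. -/
theorem exists_mul_le_norm_smul_add {E F : Type*} [NormedAddCommGroup E] [NormedSpace ℝ E]
    [NormedAddCommGroup F] [NormedSpace ℝ F] (J : E →L[ℝ] F) (hJ : IsClosed (Set.range J))
    (hs : ¬ Function.Surjective J) :
    ∃ φ : F, ‖φ‖ ≤ 1 / 2 ∧ ∃ d > 0, ∀ (a : ℝ) (y : E), |a| * d ≤ ‖a • φ + J y‖ := by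
  obtain ⟨ψ, hψ⟩ : ∃ ψ, ∀ y, J y ≠ ψ := by simpa [Function.Surjective] using hs
  have hψ0 : 0 < ‖ψ‖ := norm_pos_iff.2 fun h => hψ 0 ((map_zero J).trans h.symm)
  have hφ : (1 / (2 * ‖ψ‖)) • ψ ∉ Set.range J := by
    rintro ⟨y, hy⟩
    refine hψ ((2 * ‖ψ‖) • y) ?_
    rw [map_smul, hy, smul_smul, mul_one_div_cancel (by positivity), one_smul]
  have hd := (hJ.notMem_iff_infDist_pos ⟨_, 0, rfl⟩).1 hφ
  refine ⟨(1 / (2 * ‖ψ‖)) • ψ, ?_, _, hd, fun a y => ?_⟩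
  · rw [norm_smul, Real.norm_of_nonneg (by positivity)]
    field_simp
    exact le_rfl
  · set φ := (1 / (2 * ‖ψ‖)) • ψ
    rcases eq_or_ne a 0 with rfl | ha
    · simp
    · have h₁ : Metric.infDist φ (Set.range J) ≤ ‖φ - J (-(a⁻¹ • y))‖ := by
        rw [← dist_eq_norm]
        exact Metric.infDist_le_dist_of_mem ⟨_, rfl⟩
      calc |a| * Metric.infDist φ (Set.range J) ≤ |a| * ‖φ - J (-(a⁻¹ • y))‖ := by gcongr
        _ = ‖a • (φ - J (-(a⁻¹ • y)))‖ := by rw [norm_smul, Real.norm_eq_abs]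
        _ = ‖a • φ + J y‖ := by
          rw [map_neg, sub_neg_eq_add, smul_add, map_smul, smul_inv_smul₀ ha]

theorem HasJamesSystem.of_not_isReflexiveBanach {Y : Type} [NormedAddCommGroup Y]
    [NormedSpace ℝ Y] [CompleteSpace Y] (hY : ¬ IsReflexiveBanach Y) :
    ∃ θ > 0, ∀ N, HasJamesSystem Y θ N := by
  let J := NormedSpace.inclusionInDoubleDual ℝ Y
  have hs : ¬ Function.Surjective J := hY
  have hJ : IsClosed (Set.range J) :=
    (NormedSpace.inclusionInDoubleDualLi (E := Y) ℝ).isometry.isUniformInducing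
      |>.isComplete_range.isClosed
  obtain ⟨φ, hφn, d, hd, hdist⟩ :=
    exists_mul_le_norm_smul_add (F := StrongDual ℝ (StrongDual ℝ Y)) J hJ hs
  refine ⟨d / 2, by positivity, fun N => ?_⟩
  suffices hN : ∃ (x : ℕ → Y) (f : ℕ → StrongDual ℝ Y), (∀ i < N, ‖x i‖ ≤ 1) ∧
      (∀ i < N, ‖f i‖ ≤ 1) ∧ (∀ i < N, φ (f i) = d / 2) ∧
      ∀ i < N, ∀ k < N, f k (x i) = if k ≤ i then d / 2 else 0 by
    obtain ⟨x, f, hx, hf, -, hfx⟩ := hN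
    exact ⟨x, f, hx, hf, hfx⟩
  induction N with
  | zero => exact ⟨0, 0, by simp, by simp, by simp, by simp⟩
  | succ N ih =>
    obtain ⟨x, f, hx, hf, hφf, hfx⟩ := ih
    obtain ⟨g, hg, hgv⟩ := exists_norm_lt_and_apply_eq
      (fun i : Option (Fin N) => i.elim φ fun i => J (x i)) (fun i => i.elim (d / 2) fun _ => 0)
      (M := 1 / 2) (R := 1) (by norm_num) (by norm_num) (by
        intro a
        have := hdist (a none) (∑ i, a (some i) • x i)
        simp only [Fintype.sum_option, Option.elim_none, Option.elim_some, mul_zero,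
          Finset.sum_const_zero, add_zero]
        rw [map_sum] at this
        simp only [map_smul] at this
        rw [abs_mul, abs_of_pos (half_pos hd)]
        linarith)
    have hgφ : φ g = d / 2 := hgv none
    have hgx : ∀ i < N, g (x i) = 0 := fun i hi => hgv (some ⟨i, hi⟩)
    let f' := Function.update f N g
    have hf'N : f' N = g := Function.update_self ..
    have hf'_ne : ∀ i < N, f' i = f i := fun i hi => Function.update_of_ne hi.ne _ _
    have hf' : ∀ i < N + 1, ‖f' i‖ ≤ 1 := by
      intro i hi
      rcases Nat.lt_succ_iff_lt_or_eq.1 hi with hi | rfl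
      · rw [hf'_ne i hi]; exact hf i hi
      · rw [hf'N]; exact hg.le
    have hφf' : ∀ i < N + 1, φ (f' i) = d / 2 := by
      intro i hi
      rcases Nat.lt_succ_iff_lt_or_eq.1 hi with hi | rfl
      · rw [hf'_ne i hi]; exact hφf i hi
      · rw [hf'N]; exact hgφ
    obtain ⟨z, hz, hzv⟩ := exists_norm_lt_and_apply_eq (fun i : Fin (N + 1) => f' i)
      (fun _ => d / 2) (M := 1 / 2) (R := 1) (by norm_num) (by norm_num) (by
        intro a
        have h₁ : ∑ i, a i * (d / 2) = φ (∑ i : Fin (N + 1), a i • f' i) := by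
          rw [map_sum]
          exact Finset.sum_congr rfl fun i _ => by rw [map_smul, hφf' i i.2, smul_eq_mul]
        rw [h₁]
        exact φ.le_of_opNorm_le hφn _)
    have hzv' : ∀ k < N + 1, f' k z = d / 2 := fun k hk => hzv ⟨k, hk⟩
    let x' := Function.update x N z
    have hx'N : x' N = z := Function.update_self ..
    have hx'_ne : ∀ i < N, x' i = x i := fun i hi => Function.update_of_ne hi.ne _ _
    refine ⟨x', f', fun i hi => ?_, hf', hφf', fun i hi k hk => ?_⟩
    · rcases Nat.lt_succ_iff_lt_or_eq.1 hi with hi | rfl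
      · rw [hx'_ne i hi]; exact hx i hi
      · rw [hx'N]; exact hz.le
    · rcases Nat.lt_succ_iff_lt_or_eq.1 hi with hi | rfl
      · rw [hx'_ne i hi]
        rcases Nat.lt_succ_iff_lt_or_eq.1 hk with hk | rfl
        · rw [hf'_ne k hk]; exact hfx i hi k hk
        · rw [hf'N, hgx i hi, if_neg (by omega)]
      · rw [hx'N, hzv' k hk, if_pos (by omega)]

/-- Finite representability transfers uniform bilipschitz embeddings of finite sets. -/
theorem FinitelyRepresentable.exists_embedding {X Y : Type} [NormedAddCommGroup X]
    [NormedSpace ℝ X] [NormedAddCommGroup Y] [NormedSpace ℝ Y] (h : FinitelyRepresentable Y X)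
    {ι : Type*} [Finite ι] (F : ι → Y) :
    ∃ r : ℝ, 0 < r ∧ ∃ F' : ι → X, ∀ u v,
      r * ‖F u - F v‖ ≤ ‖F' u - F' v‖ ∧ ‖F' u - F' v‖ ≤ r * 2 * ‖F u - F v‖ := by
  let S : Submodule ℝ Y := Submodule.span ℝ (Set.range F)
  have hS : FiniteDimensional ℝ S := FiniteDimensional.span_of_finite ℝ (Set.finite_range F)
  obtain ⟨G, -, T, hT⟩ := h 1 one_pos S hS
  let F₀ : ι → S := fun u => ⟨F u, Submodule.subset_span ⟨u, rfl⟩⟩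
  have hF₀ : ∀ u v, ‖F u - F v‖ = ‖F₀ u - F₀ v‖ := fun u v => rfl
  have hup : ∀ s : S, ‖T s‖ ≤ ‖(T : S →L[ℝ] G)‖ * ‖s‖ := (T : S →L[ℝ] G).le_opNorm
  have hlo : ∀ s : S, ‖s‖ ≤ ‖(T.symm : G →L[ℝ] S)‖ * ‖T s‖ := fun s => by
    simpa using (T.symm : G →L[ℝ] S).le_opNorm (T s)
  rcases (norm_nonneg (T.symm : G →L[ℝ] S)).eq_or_lt with h0 | hpos
  · have hz : ∀ s : S, ‖s‖ = 0 := fun s =>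
      le_antisymm (by simpa [← h0] using hlo s) (norm_nonneg _)
    exact ⟨1, one_pos, fun _ => 0, fun u v => by simp [hF₀, hz]⟩
  · refine ⟨‖(T.symm : G →L[ℝ] S)‖⁻¹, inv_pos.2 hpos, fun u => T (F₀ u), fun u v => ?_⟩
    have hsub : ‖(T (F₀ u) : X) - T (F₀ v)‖ = ‖T (F₀ u - F₀ v)‖ := by
      rw [map_sub]; rfl
    rw [hF₀, hsub]
    constructor
    · rw [inv_mul_le_iff₀ hpos]
      exact hlo _
    · refine (hup _).trans ?_
      gcongr
      rw [inv_mul_eq_div, le_div_iff₀ hpos]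
      linarith

/-- `p` is the root of a dyadic tree of height `N` in the ball of radius `C` in which every vertex
is the midpoint of its children, which are at distance at least `2`. -/
def HasSeparatedTree {E : Type*} [NormedAddCommGroup E] [NormedSpace ℝ E] (C : ℝ) (N : ℕ)
    (p : E) : Prop :=
  ∃ x : List Bool → E, x [] = p ∧ (∀ l, ‖x l‖ ≤ C) ∧ ∀ l, l.length < N →
    x l = (1 / 2 : ℝ) • (x (l ++ [true]) + x (l ++ [false])) ∧
      2 ≤ ‖x (l ++ [true]) - x (l ++ [false])‖

section SeparatedTree

variable {E : Type*} [NormedAddCommGroup E] [NormedSpace ℝ E] {C : ℝ}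

theorem HasSeparatedTree.zero {p : E} (hp : ‖p‖ ≤ C) : HasSeparatedTree C 0 p :=
  ⟨fun _ => p, rfl, fun _ => hp, fun _ hl => absurd hl (Nat.not_lt_zero _)⟩

theorem HasSeparatedTree.succ {N : ℕ} {p q₁ q₂ : E} (hp : ‖p‖ ≤ C) (h₁ : HasSeparatedTree C N q₁)
    (h₂ : HasSeparatedTree C N q₂) (hmid : p = (1 / 2 : ℝ) • (q₁ + q₂)) (hsep : 2 ≤ ‖q₁ - q₂‖) :
    HasSeparatedTree C (N + 1) p := by
  obtain ⟨x₁, rfl, hx₁, ht₁⟩ := h₁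
  obtain ⟨x₂, rfl, hx₂, ht₂⟩ := h₂
  refine ⟨fun l => match l with
    | [] => p
    | true :: l => x₁ l
    | false :: l => x₂ l, rfl, fun l => ?_, fun l hl => ?_⟩
  · match l with
    | [] => exact hp
    | true :: l => exact hx₁ l
    | false :: l => exact hx₂ l
  · match l with
    | [] => exact ⟨hmid, hsep⟩
    | true :: l => exact ht₁ l (by simpa using hl)
    | false :: l => exact ht₂ l (by simpa using hl)

theorem norm_smul_sub_le_of_isCoarseEdge {n : ℕ} {r : ℝ} (hr : 0 < r) {f : DiamondV n → E}
    (hf : ∀ u v, r * diamondDist n u v ≤ ‖f u - f v‖ ∧ ‖f u - f v‖ ≤ r * C * diamondDist n u v)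
    (hC : 0 ≤ C) {j : ℕ} {u v : DiamondV n} (h : IsCoarseEdge n j u v) :
    ‖(r * 2 ^ j)⁻¹ • (f v - f u)‖ ≤ C := by
  rw [norm_smul, Real.norm_of_nonneg (by positivity), inv_mul_eq_div, div_le_iff₀ (by positivity),
    norm_sub_rev]
  calc ‖f u - f v‖ ≤ r * C * diamondDist n u v := (hf u v).2
    _ ≤ r * C * 2 ^ j := by
      unfold diamondDist
      gcongr
      exact_mod_cast h.dist_le
    _ = C * (r * 2 ^ j) := by ring

theorem HasSeparatedTree.of_isCoarseEdge {n : ℕ} {r : ℝ} (hr : 0 < r) {f : DiamondV n → E}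
    (hf : ∀ u v, r * diamondDist n u v ≤ ‖f u - f v‖ ∧ ‖f u - f v‖ ≤ r * C * diamondDist n u v)
    (hC : 0 ≤ C) {j : ℕ} {u v : DiamondV n} (h : IsCoarseEdge n j u v) :
    HasSeparatedTree C j ((r * 2 ^ j)⁻¹ • (f v - f u)) := by
  induction j generalizing u v with
  | zero => exact .zero (norm_smul_sub_le_of_isCoarseEdge hr hf hC h)
  | succ j ih =>
    obtain ⟨a, b, hua, hav, hub, hbv, hab⟩ := h.exists_quadrilateral
    have key : ∀ c, IsCoarseEdge n j u c → IsCoarseEdge n j c v →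
        r * 2 ^ (j + 1) ≤ ‖(2 : ℝ) • f c - f u - f v‖ →
        HasSeparatedTree C (j + 1) ((r * 2 ^ (j + 1))⁻¹ • (f v - f u)) := by
      intro c huc hcv hc
      refine .succ (norm_smul_sub_le_of_isCoarseEdge hr hf hC h) (ih huc) (ih hcv) ?_ ?_
      · rw [← smul_add, smul_smul]
        congr 1
        · rw [pow_succ]; field_simp
        · abel
      · rw [← smul_sub, norm_smul, Real.norm_of_nonneg (by positivity),
          show f c - f u - (f v - f c) = (2 : ℝ) • f c - f u - f v by rw [two_smul]; abel,
          inv_mul_eq_div, le_div_iff₀ (by positivity)]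
        rw [pow_succ] at hc
        linarith
    have hd : r * 2 ^ (j + 1) ≤ ‖f a - f b‖ := by
      refine le_trans ?_ (hf a b).1
      unfold diamondDist
      gcongr
      exact_mod_cast hab
    by_cases hca : r * 2 ^ (j + 1) ≤ ‖(2 : ℝ) • f a - f u - f v‖
    · exact key a hua hav hca
    · refine key b hub hbv ?_
      have h₁ : (2 : ℝ) • (f a - f b) =
          ((2 : ℝ) • f a - f u - f v) - ((2 : ℝ) • f b - f u - f v) := by
        rw [smul_sub]; abel
      have h₂ := norm_sub_le ((2 : ℝ) • f a - f u - f v) ((2 : ℝ) • f b - f u - f v)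
      rw [← h₁, norm_smul, Real.norm_ofNat] at h₂
      linarith

end SeparatedTree

theorem exists_hasSeparatedTree_of_diamond_embedding {E : Type*} [NormedAddCommGroup E]
    [NormedSpace ℝ E] {C r : ℝ} (hC : 0 ≤ C) (hr : 0 < r) {n : ℕ} {f : DiamondV n → E}
    (hf : ∀ u v, r * diamondDist n u v ≤ ‖f u - f v‖ ∧ ‖f u - f v‖ ≤ r * C * diamondDist n u v) :
    ∃ p : E, HasSeparatedTree C n p := by
  obtain ⟨u, v, h⟩ := exists_isCoarseEdge_self n
  exact ⟨_, .of_isCoarseEdge hr hf hC h⟩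

instance finite_diamondV (n : ℕ) : Finite (DiamondV n) := by
  induction n with
  | zero => exact inferInstanceAs (Finite Bool)
  | succ n ih =>
    have : Finite (DiamondData n).1 := ih
    exact inferInstanceAs (Finite ((DiamondData n).1 ⊕
      {p : (DiamondData n).1 × (DiamondData n).1 // (DiamondData n).2.Adj p.1 p.2}))

theorem exists_diamond_embedding_of_not_superReflexive {X : Type} [NormedAddCommGroup X]
    [NormedSpace ℝ X] (hX : ¬ SuperReflexive X) :
    ∃ C : ℝ, 1 ≤ C ∧ ∀ n : ℕ, ∃ r : ℝ, 0 < r ∧ ∃ f : DiamondV n → X, ∀ u v : DiamondV n,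
      r * diamondDist n u v ≤ ‖f u - f v‖ ∧ ‖f u - f v‖ ≤ r * C * diamondDist n u v := by
  unfold SuperReflexive at hX
  push Not at hX
  obtain ⟨Y, _, _, _, hYX, hY⟩ := hX
  obtain ⟨θ, hθ, hJ⟩ := HasJamesSystem.of_not_isReflexiveBanach hY
  refine ⟨max 1 (8 / θ), le_max_left _ _, fun n => ?_⟩
  obtain ⟨F, hF⟩ := (hJ (2 ^ n)).exists_diamond_embedding hθ
  obtain ⟨r, hr, F', hF'⟩ := hYX.exists_embedding F
  refine ⟨r * θ / 4, by positivity, F', fun u v => ⟨?_, ?_⟩⟩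
  · refine le_trans ?_ (hF' u v).1
    calc r * θ / 4 * diamondDist n u v = r * (θ / 4 * diamondDist n u v) := by ring
      _ ≤ r * ‖F u - F v‖ := by gcongr; exact (hF u v).1
  · have hd : 0 ≤ diamondDist n u v := Nat.cast_nonneg _
    calc ‖F' u - F' v‖ ≤ r * 2 * ‖F u - F v‖ := (hF' u v).2
      _ ≤ r * 2 * diamondDist n u v := by gcongr; exact (hF u v).2
      _ = r * θ / 4 * (8 / θ) * diamondDist n u v := by field_simp; ring
      _ ≤ r * θ / 4 * max 1 (8 / θ) * diamondDist n u v := by gcongr; exact le_max_right _ _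

section Dentability

variable {E : Type} [NormedAddCommGroup E] [NormedSpace ℝ E] {S : Set E} {C : ℝ}

theorem bddAbove_dual_image (hSC : ∀ s ∈ S, ‖s‖ ≤ C) (e : StrongDual ℝ E) :
    BddAbove (e '' S) := by
  refine ⟨‖e‖ * C, ?_⟩
  rintro _ ⟨s, hs, rfl⟩
  exact (le_abs_self _).trans ((e.le_opNorm s).trans (by gcongr; exact hSC s hs))

/-- In a reflexive space every functional attains its supremum over a bounded set `S` at a point
of the weakly closed convex hull of `S`. -/
theorem IsReflexiveBanach.exists_apply_eq_sSup (hE : IsReflexiveBanach E) (hS : S.Nonempty)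
    (hSC : ∀ s ∈ S, ‖s‖ ≤ C) (e : StrongDual ℝ E) :
    ∃ z : E, (∀ g : StrongDual ℝ E, g z ≤ sSup (g '' S)) ∧ e z = sSup (e '' S) := by
  have hex : ∀ n : ℕ, ∃ s ∈ S, sSup (e '' S) - 1 / ((n : ℝ) + 1) < e s := by
    intro n
    obtain ⟨_, ⟨s, hs, rfl⟩, h⟩ := exists_lt_of_lt_csSup (hS.image e)
      (sub_lt_self (sSup (e '' S)) (Nat.one_div_pos_of_nat (n := n)))
    exact ⟨s, hs, h⟩
  choose s hsS hs using hex
  let J : E → WeakDual ℝ (StrongDual ℝ E) := fun z =>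
    StrongDual.toWeakDual (NormedSpace.inclusionInDoubleDual ℝ E z)
  let U : Ultrafilter ℕ := Filter.hyperfilter ℕ
  have hmem : ∀ n, J (s n) ∈ WeakDual.toStrongDual ⁻¹'
      Metric.closedBall (0 : StrongDual ℝ (StrongDual ℝ E)) C := by
    intro n
    exact (dist_zero_right (E := StrongDual ℝ (StrongDual ℝ E)) _).trans_le
      ((NormedSpace.double_dual_bound ℝ E (s n)).trans (hSC _ (hsS n)))
  obtain ⟨κ, -, hκ⟩ := (WeakDual.isCompact_closedBall
    (0 : StrongDual ℝ (StrongDual ℝ E)) C).ultrafilter_le_nhds' (U.map fun n => J (s n))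
    (Filter.mem_map.2 (Filter.univ_mem' hmem))
  obtain ⟨z, hz⟩ := hE (WeakDual.toStrongDual κ)
  have hlim : ∀ g : StrongDual ℝ E, Filter.Tendsto (fun n => g (s n)) U (nhds (g z)) := by
    intro g
    have h₁ : Filter.Tendsto (fun n => J (s n)) U (nhds κ) := hκ
    have h₂ := ((WeakDual.eval_continuous g).tendsto κ).comp h₁
    have h₃ : κ g = g z := (DFunLike.congr_fun hz g).symm
    rw [h₃] at h₂
    exact h₂
  refine ⟨z, fun g => le_of_tendsto' (hlim g) fun n =>
    le_csSup (bddAbove_dual_image hSC g) ⟨_, hsS n, rfl⟩, le_antisymm ?_ ?_⟩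
  · exact le_of_tendsto' (hlim e) fun n => le_csSup (bddAbove_dual_image hSC e) ⟨_, hsS n, rfl⟩
  · have h₁ : Filter.Tendsto (fun n : ℕ => sSup (e '' S) - 1 / ((n : ℝ) + 1)) U
        (nhds (sSup (e '' S) - 0)) :=
      (tendsto_const_nhds.sub tendsto_one_div_add_atTop_nhds_zero_nat).mono_left
        Nat.hyperfilter_le_atTop
    rw [sub_zero] at h₁
    exact le_of_tendsto_of_tendsto' h₁ (hlim e) fun n => (hs n).le

theorem mem_closure_span_of_forall_apply_le {z : E} (hS : S.Nonempty)
    (hz : ∀ g : StrongDual ℝ E, g z ≤ sSup (g '' S)) :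
    z ∈ closure (Submodule.span ℝ S : Set E) := by
  have hsub : convexHull ℝ S ⊆ Submodule.span ℝ S :=
    convexHull_min Submodule.subset_span (Submodule.span ℝ S).convex
  refine closure_mono hsub ?_
  by_contra hcon
  obtain ⟨f, u, hfz, hf⟩ := geometric_hahn_banach_point_closed (convex_convexHull ℝ S).closure
    isClosed_closure hcon
  have h₁ : sSup ((-f) '' S) ≤ -u := by
    refine csSup_le (hS.image _) ?_
    rintro _ ⟨s, hs, rfl⟩
    have := hf s (subset_closure (subset_convexHull ℝ S hs))
    rw [neg_apply]
    linarith
  have h₂ := hz (-f)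
  rw [neg_apply] at h₂
  linarith

/-- Nonempty countable bounded subsets of a reflexive space have nonempty slices of small
diameter. -/
theorem IsReflexiveBanach.exists_small_slice (hE : IsReflexiveBanach E) (hS : S.Nonempty)
    (hScount : S.Countable) (hSC : ∀ s ∈ S, ‖s‖ ≤ C) {ε : ℝ} (hε : 0 < ε) :
    ∃ (e : StrongDual ℝ E) (c : ℝ) (q : E), (∃ s ∈ S, c < e s) ∧
      ∀ s ∈ S, c < e s → ‖s - q‖ ≤ 2 * ε := by
  have hC : 0 ≤ C := (norm_nonneg _).trans (hSC _ hS.some_mem)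
  let σ : StrongDual ℝ E → ℝ := fun e => sSup (e '' S)
  have hσ : ∀ e, ∀ s ∈ S, e s ≤ σ e := fun e s hs =>
    le_csSup (bddAbove_dual_image hSC e) ⟨s, hs, rfl⟩
  have hσ_sub : ∀ e e', σ e ≤ σ e' + ‖e - e'‖ * C := by
    intro e e'
    refine csSup_le (hS.image _) ?_
    rintro _ ⟨s, hs, rfl⟩
    have h₁ : (e - e') s ≤ ‖e - e'‖ * C := (le_abs_self _).trans
      (((e - e').le_opNorm s).trans (by gcongr; exact hSC s hs))
    have h₂ := hσ e' s hs
    rw [sub_apply] at h₁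
    linarith
  obtain ⟨D, hD, hDK⟩ := ((hScount.isSeparable.span (R := ℝ)).closure :
    TopologicalSpace.IsSeparable (closure (Submodule.span ℝ S : Set E)))
  have : Countable D := hD
  let A : D → Set (StrongDual ℝ E) := fun q =>
    {e | ∀ η > 0, ∃ z : E, (∀ g : StrongDual ℝ E, g z ≤ σ g) ∧ ‖z - q‖ ≤ ε ∧ σ e - η < e z}
  have hA_closed : ∀ q, IsClosed (A q) := by
    intro q
    refine isClosed_of_closure_subset fun e he η hη => ?_
    have hM : 0 < C + (‖(q : E)‖ + ε) := by positivity
    obtain ⟨e', he', hee'⟩ := Metric.mem_closure_iff.1 he (η / 2 / (C + (‖(q : E)‖ + ε)))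
      (by positivity)
    rw [dist_eq_norm, lt_div_iff₀ hM, mul_add] at hee'
    obtain ⟨z, hz, hzq, hez⟩ := he' (η / 2) (half_pos hη)
    refine ⟨z, hz, hzq, ?_⟩
    have hzn : ‖z‖ ≤ ‖(q : E)‖ + ε := by
      have := norm_le_norm_add_norm_sub (q : E) z
      rw [norm_sub_rev] at this
      linarith
    have h₁ : -(e - e') z ≤ ‖e - e'‖ * (‖(q : E)‖ + ε) := (neg_le_abs _).trans
      (((e - e').le_opNorm z).trans (by gcongr))
    have h₂ := hσ_sub e e'
    rw [sub_apply] at h₁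
    linarith
  have hA_cover : ⋃ q, A q = Set.univ := by
    refine Set.eq_univ_of_forall fun e => ?_
    obtain ⟨z, hz, hez⟩ := hE.exists_apply_eq_sSup hS hSC e
    obtain ⟨q, hq, hzq⟩ := Metric.mem_closure_iff.1
      (hDK (mem_closure_span_of_forall_apply_le hS hz)) ε hε
    rw [dist_eq_norm] at hzq
    refine Set.mem_iUnion.2 ⟨⟨q, hq⟩, fun η hη => ⟨z, hz, hzq.le, ?_⟩⟩
    rw [hez]
    exact sub_lt_self _ hη
  obtain ⟨q, e, he⟩ := nonempty_interior_of_iUnion_of_closed hA_closed hA_cover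
  obtain ⟨ρ, hρ, hball⟩ := Metric.mem_nhds_iff.1 (mem_interior_iff_mem_nhds.1 he)
  set r := ρ / 2
  have hr : 0 < r := half_pos hρ
  refine ⟨e, σ e - ε * r, q, ?_, fun s hs hes => ?_⟩
  · obtain ⟨_, ⟨s, hs, rfl⟩, h⟩ := exists_lt_of_lt_csSup (hS.image e)
      (sub_lt_self (σ e) (mul_pos hε hr))
    exact ⟨s, hs, h⟩
  · obtain ⟨g, hg, hgs⟩ := exists_dual_vector'' ℝ (s - q)
    have hmem : e + r • g ∈ A q := by
      refine hball ?_
      rw [Metric.mem_ball, dist_eq_norm, add_sub_cancel_left, norm_smul, Real.norm_of_nonneg hr.le]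
      have : r * ‖g‖ ≤ r * 1 := by gcongr
      have : r < ρ := half_lt_self hρ
      linarith
    obtain ⟨z, hz, hzq, hez⟩ := hmem (e s - (σ e - ε * r)) (sub_pos.2 hes)
    have h₁ := hσ (e + r • g) s hs
    have h₂ := hz e
    have h₃ : g (z - q) ≤ 1 * ε := (le_abs_self _).trans
      ((g.le_opNorm _).trans (by gcongr))
    have hgs' : g s - g q = ‖s - q‖ := by rw [← map_sub]; exact hgs
    simp only [add_apply, smul_apply, smul_eq_mul] at h₁ hez
    rw [map_sub] at h₃
    have h₄ : r * (g s - g z) ≤ r * ε := by linarith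
    have h₅ := le_of_mul_le_mul_left h₄ hr
    linarith

/-- A reflexive space contains no bounded infinite dyadic tree with separated siblings. -/
theorem IsReflexiveBanach.not_separated_tree (hE : IsReflexiveBanach E) {x : List Bool → E}
    (hx : ∀ l, ‖x l‖ ≤ C)
    (hmid : ∀ l, x l = (1 / 2 : ℝ) • (x (l ++ [true]) + x (l ++ [false])))
    (hsep : ∀ l, 2 ≤ ‖x (l ++ [true]) - x (l ++ [false])‖) : False := by
  obtain ⟨e, c, q, ⟨_, ⟨l, rfl⟩, hl⟩, hq⟩ := hE.exists_small_slice (Set.range_nonempty x)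
    (Set.countable_range x) (Set.forall_mem_range.2 hx) (ε := 1 / 8) (by norm_num)
  have hchild : ∀ b, c < e (x (l ++ [b])) → ‖x l - x (l ++ [b])‖ ≤ 1 / 2 := by
    intro b hb
    have h₁ := hq _ ⟨_, rfl⟩ hl
    have h₂ := hq _ ⟨_, rfl⟩ hb
    have h₃ := norm_sub_le_norm_sub_add_norm_sub (x l) q (x (l ++ [b]))
    rw [norm_sub_rev q] at h₃
    linarith
  have he : e (x l) = 1 / 2 * (e (x (l ++ [true])) + e (x (l ++ [false]))) := by
    rw [hmid l, map_smul, map_add, smul_eq_mul]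
  have hs := hsep l
  rcases le_total (e (x (l ++ [true]))) (e (x (l ++ [false]))) with h | h
  · have h₁ := hchild false (by linarith)
    have h₂ : x l - x (l ++ [false]) = (1 / 2 : ℝ) • (x (l ++ [true]) - x (l ++ [false])) := by
      rw [hmid l]; module
    rw [h₂, norm_smul, Real.norm_of_nonneg (by norm_num)] at h₁
    linarith
  · have h₁ := hchild true (by linarith)
    have h₂ : x l - x (l ++ [true]) = -((1 / 2 : ℝ) • (x (l ++ [true]) - x (l ++ [false]))) := by
      rw [hmid l]; module
    rw [h₂, norm_neg, norm_smul, Real.norm_of_nonneg (by norm_num)] at h₁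
    linarith

end Dentability

section Ultrapower

open Filter Topology BoundedContinuousFunction

variable {X : Type} [NormedAddCommGroup X] [NormedSpace ℝ X]

/-- The bounded sequences whose norms tend to zero along the hyperfilter. -/
def hyperNull (X : Type) [NormedAddCommGroup X] [NormedSpace ℝ X] : Submodule ℝ (ℕ →ᵇ X) where
  carrier := {x | Tendsto (fun n => x n) (hyperfilter ℕ) (𝓝 0)}
  add_mem' hx hy := by simpa using Tendsto.add hx hy
  zero_mem' := tendsto_const_nhds
  smul_mem' c x hx := by simpa using Tendsto.const_smul hx c

theorem mem_hyperNull {x : ℕ →ᵇ X} :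
    x ∈ hyperNull X ↔ Tendsto (fun n => x n) (hyperfilter ℕ) (𝓝 0) :=
  Iff.rfl

instance isClosed_hyperNull : IsClosed (hyperNull X : Set (ℕ →ᵇ X)) := by
  refine isClosed_of_closure_subset fun x hx => ?_
  refine Metric.tendsto_nhds.2 fun ε hε => ?_
  obtain ⟨y, hy, hxy⟩ := Metric.mem_closure_iff.1 hx (ε / 2) (half_pos hε)
  filter_upwards [Metric.tendsto_nhds.1 (mem_hyperNull.1 hy) (ε / 2) (half_pos hε)] with n hn
  have h₁ := dist_coe_le_dist (f := x) (g := y) n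
  have h₂ := dist_triangle (x n) (y n) 0
  linarith

/-- The Banach space ultrapower of `X` along the hyperfilter on `ℕ`. -/
abbrev HyperPower (X : Type) [NormedAddCommGroup X] [NormedSpace ℝ X] : Type :=
  (ℕ →ᵇ X) ⧸ hyperNull X

theorem tendsto_norm_hyperPower_mk (x : ℕ →ᵇ X) :
    Tendsto (fun n => ‖x n‖) (hyperfilter ℕ) (𝓝 ‖(hyperNull X).mkQ x‖) := by
  obtain ⟨L, -, hL⟩ := (isCompact_closedBall (0 : ℝ) ‖x‖).ultrafilter_le_nhds'
    ((hyperfilter ℕ).map fun n => ‖x n‖) (mem_map.2 (univ_mem' fun n => by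
      simpa using x.norm_coe_le_norm n))
  have hL' : Tendsto (fun n => ‖x n‖) (hyperfilter ℕ) (𝓝 L) := hL
  suffices h : ‖(hyperNull X).mkQ x‖ = L by rwa [h]
  refine le_antisymm (le_of_forall_pos_le_add fun ε hε => ?_)
    (le_of_forall_pos_le_add fun ε hε => ?_)
  · have hL0 : 0 ≤ L := ge_of_tendsto' hL' fun n => norm_nonneg _
    classical
    let y : ℕ →ᵇ X := ofNormedAddCommGroupDiscrete
      (fun n => if ‖x n‖ < L + ε then x n else 0) (L + ε) fun n => by
        split_ifs with h
        · exact h.le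
        · rw [norm_zero]; positivity
    have hxy : x - y ∈ hyperNull X := by
      refine mem_hyperNull.2 (tendsto_const_nhds.congr' ?_)
      filter_upwards [hL'.eventually (eventually_lt_nhds (lt_add_of_pos_right L hε))] with n hn
      simp [y, hn]
    have heq : (hyperNull X).mkQ x = (hyperNull X).mkQ y :=
      (Submodule.Quotient.eq (hyperNull X)).2 hxy
    rw [heq]
    refine (Submodule.Quotient.norm_mk_le (hyperNull X) y).trans ?_
    exact norm_ofNormedAddCommGroup_le _ (by positivity) _
  · obtain ⟨y, hy, hyn⟩ := Submodule.Quotient.norm_mk_lt ((hyperNull X).mkQ x) hε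
    have hyx : y - x ∈ hyperNull X := (Submodule.Quotient.eq (hyperNull X)).1 hy
    have h₁ : Tendsto (fun n => ‖y‖ + ‖(y - x) n‖) (hyperfilter ℕ) (𝓝 (‖y‖ + 0)) :=
      tendsto_const_nhds.add (by simpa using (mem_hyperNull.1 hyx).norm)
    rw [add_zero] at h₁
    refine (le_of_tendsto_of_tendsto' hL' h₁ fun n => ?_).trans hyn.le
    have h₂ := norm_sub_norm_le (x n) (y n)
    have h₃ := y.norm_coe_le_norm n
    rw [BoundedContinuousFunction.sub_apply, norm_sub_rev]
    linarith

theorem exists_linearMap_norm_near {F : Type*} [NormedAddCommGroup F] [NormedSpace ℝ F]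
    [FiniteDimensional ℝ F] (s : F →ₗ[ℝ] ℕ →ᵇ X) (hs : ∀ z, ‖(hyperNull X).mkQ (s z)‖ = ‖z‖)
    {δ : ℝ} (hδ : 0 < δ) :
    ∃ T : F →ₗ[ℝ] X, ∀ z, (1 - δ) * ‖z‖ ≤ ‖T z‖ ∧ ‖T z‖ ≤ (1 + δ) * ‖z‖ := by
  let M := ‖LinearMap.toContinuousLinearMap s‖
  have hM : ∀ n z, ‖s z n‖ ≤ M * ‖z‖ := fun n z =>
    ((s z).norm_coe_le_norm n).trans ((LinearMap.toContinuousLinearMap s).le_opNorm z)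
  have key : ∃ n, ∀ z : F, ‖z‖ = 1 → |‖s z n‖ - 1| < δ := by
    by_contra! hcon
    choose z hz hzδ using hcon
    have := FiniteDimensional.proper_real F
    obtain ⟨w, hw, hzw⟩ := (isCompact_sphere (0 : F) 1).ultrafilter_le_nhds'
      ((hyperfilter ℕ).map z) (mem_map.2 (univ_mem' fun n => by simpa using hz n))
    have hzw : Tendsto z (hyperfilter ℕ) (𝓝 w) := hzw
    have hw1 : ‖w‖ = 1 := by simpa using hw
    have h₁ := tendsto_norm_hyperPower_mk (s w)
    rw [hs, hw1] at h₁
    have h₂ : Tendsto (fun n => M * ‖z n - w‖) (hyperfilter ℕ) (𝓝 0) := by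
      simpa using ((tendsto_sub_nhds_zero_iff.2 hzw).norm).const_mul M
    have h₃ : Tendsto (fun n => |‖s w n‖ - 1|) (hyperfilter ℕ) (𝓝 0) := by
      simpa using (h₁.sub_const 1).abs
    have h₄ := h₂.add h₃
    rw [add_zero] at h₄
    refine absurd (ge_of_tendsto' h₄ fun n => ?_) (not_le.2 hδ)
    have h₅ : |‖s (z n) n‖ - ‖s w n‖| ≤ M * ‖z n - w‖ := by
      refine (abs_norm_sub_norm_le _ _).trans ?_
      have := hM n (z n - w)
      rwa [map_sub] at this
    refine (hzδ n).trans ?_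
    have := abs_sub_le ‖s (z n) n‖ ‖s w n‖ 1
    linarith
  obtain ⟨n, hn⟩ := key
  refine ⟨{ toFun := fun z => s z n, map_add' := fun a b => by simp,
            map_smul' := fun c a => by simp }, fun z => ?_⟩
  rcases eq_or_ne z 0 with rfl | hz
  · simp
  · have hz0 : 0 < ‖z‖ := norm_pos_iff.2 hz
    have h := hn (‖z‖⁻¹ • z) (by rw [norm_smul, norm_inv, norm_norm, inv_mul_cancel₀ hz0.ne'])
    rw [map_smul, coe_smul, norm_smul, norm_inv, norm_norm, inv_mul_eq_div, abs_sub_lt_iff,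
      sub_lt_iff_lt_add, div_lt_iff₀ hz0, sub_lt_comm, lt_div_iff₀ hz0] at h
    constructor
    · exact h.2.le
    · rw [add_comm]; exact h.1.le

theorem finitelyRepresentable_hyperPower : FinitelyRepresentable (HyperPower X) X := by
  intro ε hε F hF
  obtain ⟨s, hs⟩ := Module.projective_lifting_property (hyperNull X).mkQ F.subtype
    (hyperNull X).mkQ_surjective
  have hs' : ∀ z : F, (hyperNull X).mkQ (s z) = z := fun z => LinearMap.congr_fun hs z
  set δ := ε / (2 + ε) with hδ_def
  have hδ : 0 < δ := by positivity
  have h1δ : 0 < 1 - δ := by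
    rw [sub_pos, hδ_def, div_lt_one (by positivity)]; linarith
  obtain ⟨T, hT⟩ := exists_linearMap_norm_near s (fun z => by rw [hs']; rfl) hδ
  have hinj : Function.Injective T := by
    refine (injective_iff_map_eq_zero T).2 fun z hz => ?_
    have := (hT z).1
    rw [hz, norm_zero] at this
    exact norm_le_zero_iff.1 (nonpos_of_mul_nonpos_right this h1δ)
  let e : F ≃L[ℝ] LinearMap.range T := (LinearEquiv.ofInjective T hinj).toContinuousLinearEquiv
  have he : ∀ z, ‖e z‖ = ‖T z‖ := fun z => rfl
  refine ⟨LinearMap.range T, inferInstance, e, ?_⟩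
  have h₁ : ‖(e : F →L[ℝ] LinearMap.range T)‖ ≤ 1 + δ :=
    ContinuousLinearMap.opNorm_le_bound _ (by positivity) fun z => (he z).trans_le (hT z).2
  have h₂ : ‖(e.symm : LinearMap.range T →L[ℝ] F)‖ ≤ (1 - δ)⁻¹ := by
    refine ContinuousLinearMap.opNorm_le_bound _ (by positivity) fun y => ?_
    have := (hT (e.symm y)).1
    rw [← he, e.apply_symm_apply] at this
    rw [inv_mul_eq_div, le_div_iff₀ h1δ, mul_comm]
    exact this
  calc _ ≤ (1 + δ) * (1 - δ)⁻¹ := by gcongr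
    _ = 1 + ε := by
      rw [← div_eq_mul_inv, div_eq_iff h1δ.ne', hδ_def]
      field_simp
      ring

theorem not_superReflexive_of_hasSeparatedTree [CompleteSpace X] {C : ℝ}
    (h : ∀ N, ∃ p : X, HasSeparatedTree C N p) : ¬ SuperReflexive X := by
  intro hX
  choose p x _ hxC hx using h
  let w : List Bool → ℕ →ᵇ X := fun l =>
    ofNormedAddCommGroupDiscrete (fun n => x n l) C fun n => hxC n l
  have hev : ∀ l : List Bool, ∀ᶠ n in (hyperfilter ℕ : Filter ℕ), l.length < n := fun l =>
    Nat.hyperfilter_le_atTop (eventually_gt_atTop l.length)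
  refine (hX (HyperPower X) finitelyRepresentable_hyperPower).not_separated_tree (C := C)
    (x := fun l => (hyperNull X).mkQ (w l)) (fun l => ?_) (fun l => ?_) (fun l => ?_)
  · exact le_of_tendsto' (tendsto_norm_hyperPower_mk (w l)) fun n => hxC n l
  · rw [← map_add, ← map_smul]
    refine (Submodule.Quotient.eq (hyperNull X)).2 (mem_hyperNull.2
      (tendsto_const_nhds.congr' ?_))
    filter_upwards [hev l] with n hn
    exact (sub_eq_zero.2 (hx n l hn).1).symm
  · rw [← map_sub]
    refine ge_of_tendsto (tendsto_norm_hyperPower_mk _) ?_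
    filter_upwards [hev l] with n hn
    exact (hx n l hn).2

end Ultrapower

/-- Johnson–Schechtman: a Banach space is nonsuperreflexive iff the diamond graphs embed
into it with uniformly bounded distortions. -/
theorem johnson_schechtman_diamond_characterization
    (X : Type) [NormedAddCommGroup X] [NormedSpace ℝ X] [CompleteSpace X] :
    ¬ SuperReflexive X ↔
      ∃ C : ℝ, 1 ≤ C ∧ ∀ n : ℕ, ∃ r : ℝ, 0 < r ∧ ∃ f : DiamondV n → X,
        ∀ u v : DiamondV n,
          r * diamondDist n u v ≤ ‖f u - f v‖ ∧ ‖f u - f v‖ ≤ r * C * diamondDist n u v := by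
  refine ⟨exists_diamond_embedding_of_not_superReflexive, ?_⟩
  rintro ⟨C, hC, h⟩
  refine not_superReflexive_of_hasSeparatedTree (C := C) fun n => ?_
  obtain ⟨r, hr, f, hf⟩ := h n
  exact exists_hasSeparatedTree_of_diamond_embedding (zero_le_one.trans hC) hr hf
end
end

section
/- A Banach space X is not superreflexive if and only if there exists a constant 1 ≤ C < ∞ such that for every n ∈ ℕ the unweighted Laakso graph L_n (with its shortest path metric) admits a bilipschitz embedding into X with distortion at most C. -/
noncomputable section

/-- Auxiliary relation for the Laakso construction.  Each undirected edge `uv` of the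
previous graph gives the two ordered pairs `(u,v)` and `(v,u)`; the pair `(p, false)`
is the new vertex `t` adjacent to the first endpoint of `p`, and `(p, true)` is the new
vertex `a`, adjacent to the `t`-vertices of `p` and of the reversed pair.  This replaces
the edge `uv` by a copy of the Laakso graph `L₁` with vertices
`u, t(u,v), a(u,v), a(v,u), t(v,u), v`. -/
def laaksoRel {V : Type} (A : V → V → Prop) :
    (V ⊕ ({p : V × V // A p.1 p.2} × Bool)) → (V ⊕ ({p : V × V // A p.1 p.2} × Bool)) → Prop
  | Sum.inl u, Sum.inr (p, b) => b = false ∧ u = p.1.1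
  | Sum.inr (p, b), Sum.inr (q, c) =>
      b = false ∧ c = true ∧ (p.1 = q.1 ∨ (p.1.1 = q.1.2 ∧ p.1.2 = q.1.1))
  | _, _ => False

/-- The Laakso graphs: `L₀` is a single edge; `Lₙ₊₁` is obtained from `Lₙ` by replacing
each edge `uv` by a copy of the six-vertex Laakso graph `L₁` (vertices `u,t,a,b,s,v` and
edges `ut, ta, tb, as, bs, sv`), identifying `u` and `v` with the two degree-one
vertices. -/
def LaaksoData : ℕ → (V : Type) × SimpleGraph V
  | 0 => ⟨Bool, SimpleGraph.fromRel fun a b => a ≠ b⟩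
  | n + 1 =>
    ⟨(LaaksoData n).1 ⊕
        ({p : (LaaksoData n).1 × (LaaksoData n).1 // (LaaksoData n).2.Adj p.1 p.2} × Bool),
      SimpleGraph.fromRel (laaksoRel (LaaksoData n).2.Adj)⟩

/-- The vertex set of the Laakso graph `Lₙ`. -/
def LaaksoV (n : ℕ) : Type := (LaaksoData n).1

/-- The shortest path distance on the unweighted Laakso graph `Lₙ`. -/
def laaksoDist (n : ℕ) (x y : LaaksoV n) : ℝ :=
  ((LaaksoData n).2.dist x y : ℝ)

section Auxiliary

open Filter Topology

/-- Bounded sequences in `X` that converge to zero along the ultrafilter `U`. -/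
def ultraNull (X : Type) [NormedAddCommGroup X] [NormedSpace ℝ X] (U : Ultrafilter ℕ) :
    Submodule ℝ (BoundedContinuousFunction ℕ X) where
  carrier := {x | Tendsto (fun n => x n) U (𝓝 0)}
  add_mem' {a b} ha hb := by simpa using Tendsto.add ha hb
  zero_mem' := by simp
  smul_mem' c x hx := by simpa using Tendsto.const_smul hx c

section Ultraproduct

variable {X : Type} [NormedAddCommGroup X] [NormedSpace ℝ X] (U : Ultrafilter ℕ)

instance isClosed_ultraNull : IsClosed (ultraNull X U : Set (BoundedContinuousFunction ℕ X)) := by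
  rw [← isSeqClosed_iff_isClosed]
  intro x y hx hxy
  change Tendsto (fun n => y n) U (𝓝 0)
  rw [Metric.tendsto_nhds]
  intro ε hε
  rw [Metric.tendsto_atTop] at hxy
  obtain ⟨N, hN⟩ := hxy (ε / 2) (half_pos hε)
  have h1 := hN N le_rfl
  have h2 : Tendsto (fun n => x N n) U (𝓝 0) := hx N
  rw [Metric.tendsto_nhds] at h2
  filter_upwards [h2 (ε / 2) (half_pos hε)] with n hn
  have h3 := BoundedContinuousFunction.dist_coe_le_dist (f := x N) (g := y) n
  have h4 := dist_triangle (y n) (x N n) 0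
  rw [dist_comm (y n) (x N n)] at h4
  linarith

/-- The ultrapower of a normed space along an ultrafilter on `ℕ`. -/
abbrev UltraPower (X : Type) [NormedAddCommGroup X] [NormedSpace ℝ X] (U : Ultrafilter ℕ) : Type :=
  BoundedContinuousFunction ℕ X ⧸ ultraNull X U

lemma ultraPower_norm_le (x : BoundedContinuousFunction ℕ X) {c : ℝ} (hc : 0 ≤ c)
    (h : ∀ᶠ n in (U : Filter ℕ), ‖x n‖ ≤ c) : ‖(ultraNull X U).mkQ x‖ ≤ c := by
  classical
  let y : BoundedContinuousFunction ℕ X :=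
    BoundedContinuousFunction.ofNormedAddCommGroupDiscrete
      (fun n => if ‖x n‖ ≤ c then x n else 0) c (fun n => by split_ifs with h <;> simp [h, hc])
  have hy : (ultraNull X U).mkQ x = (ultraNull X U).mkQ y := by
    rw [Submodule.mkQ_apply, Submodule.mkQ_apply, Submodule.Quotient.eq]
    change Tendsto (fun n => (x - y) n) U (𝓝 0)
    refine tendsto_const_nhds.congr' ?_
    filter_upwards [h] with n hn
    simp [y, hn]
  rw [hy]
  refine (Submodule.Quotient.norm_mk_le _ _).trans ?_
  rw [BoundedContinuousFunction.norm_le hc]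
  intro n
  by_cases hn : ‖x n‖ ≤ c <;> simp [y, hn, hc]

lemma le_ultraPower_norm (x : BoundedContinuousFunction ℕ X) {c : ℝ}
    (h : ∀ᶠ n in (U : Filter ℕ), c ≤ ‖x n‖) : c ≤ ‖(ultraNull X U).mkQ x‖ := by
  refine le_of_forall_pos_lt_add fun ε hε => ?_
  obtain ⟨y, hy, hyn⟩ := Submodule.Quotient.norm_mk_lt ((ultraNull X U).mkQ x) (half_pos hε)
  rw [Submodule.mkQ_apply, Submodule.Quotient.eq] at hy
  have hy' : Tendsto (fun n => (y - x) n) U (𝓝 0) := hy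
  rw [Metric.tendsto_nhds] at hy'
  obtain ⟨n, h1, h2⟩ := (h.and (hy' (ε / 2) (half_pos hε))).exists
  have h3 := y.norm_coe_le_norm n
  have h4 : ‖x n‖ ≤ ‖y n‖ + ‖(y - x) n‖ := by
    have := norm_sub_le (y n) ((y - x) n)
    simpa using this
  rw [dist_zero_right] at h2
  linarith

/-- Every ultrapower of `X` is finitely representable in `X`. -/
lemma finitelyRepresentable_ultraPower : FinitelyRepresentable (UltraPower X U) X := by
  intro ε hε F hF
  obtain ⟨g, hg⟩ := (ultraNull X U).mkQ.exists_rightInverse_of_surjective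
    (LinearMap.range_eq_top.2 (Submodule.mkQ_surjective _))
  have hg' : ∀ z, (ultraNull X U).mkQ (g z) = z := fun z => LinearMap.congr_fun hg z
  let gF : F →L[ℝ] BoundedContinuousFunction ℕ X := LinearMap.toContinuousLinearMap (g ∘ₗ F.subtype)
  let T : ℕ → F →L[ℝ] X := fun n => (BoundedContinuousFunction.evalCLM ℝ n).comp gF
  have hT : ∀ n (z : F), T n z = g z n := fun n z => rfl
  have hTb : ∀ n (z : F), ‖T n z‖ ≤ ‖gF‖ * ‖z‖ := fun n z =>
    ((gF z).norm_coe_le_norm n).trans (gF.le_opNorm z)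
  set η : ℝ := ε / (2 + ε) with hη
  have hη0 : 0 < η := by positivity
  have hη1 : η < 1 := by rw [hη, div_lt_one (by positivity)]; linarith
  have hprod : (1 + η) * (1 - η)⁻¹ = 1 + ε := by
    have : 1 - η ≠ 0 := by linarith
    rw [← div_eq_mul_inv, div_eq_iff this, hη]
    field_simp
    ring
  have hcpt : IsCompact (Metric.sphere (0 : F) 1) := isCompact_sphere _ _
  have hK : 0 < ‖gF‖ + 1 := by positivity
  obtain ⟨t, -, htf, hcov⟩ := hcpt.finite_cover_balls (e := η / 2 / (‖gF‖ + 1)) (by positivity)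
  have hev : ∀ᶠ n in (U : Filter ℕ), ∀ z ∈ t, |‖T n z‖ - ‖z‖| ≤ η / 2 := by
    rw [Filter.eventually_all_finite htf]
    intro z _
    have h1 : ∀ᶠ n in (U : Filter ℕ), ‖T n z‖ ≤ ‖z‖ + η / 2 := by
      by_contra hcon
      rw [← Ultrafilter.eventually_not] at hcon
      have := le_ultraPower_norm U (g z) (c := ‖z‖ + η / 2)
        (hcon.mono fun n hn => by rw [← hT]; exact (not_le.1 hn).le)
      rw [hg'] at this
      rw [Submodule.coe_norm] at this
      linarith
    have h2 : ∀ᶠ n in (U : Filter ℕ), ‖z‖ - η / 2 ≤ ‖T n z‖ := by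
      by_contra hcon
      rw [← Ultrafilter.eventually_not] at hcon
      have h0 : 0 ≤ ‖z‖ - η / 2 := by
        obtain ⟨n, hn⟩ := hcon.exists
        exact (norm_nonneg _).trans (not_le.1 hn).le
      have := ultraPower_norm_le U (g z) (c := ‖z‖ - η / 2) h0
        (hcon.mono fun n hn => by rw [← hT]; exact (not_le.1 hn).le)
      rw [hg', Submodule.coe_norm] at this
      linarith
    filter_upwards [h1, h2] with n h1 h2
    rw [abs_le]
    constructor <;> linarith
  obtain ⟨n, hn⟩ := hev.exists
  have hsph : ∀ z : F, ‖z‖ = 1 → |‖T n z‖ - 1| ≤ η := by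
    intro z hz
    have hz' : z ∈ Metric.sphere (0 : F) 1 := by simp [hz]
    obtain ⟨w, hw, hzw⟩ := Set.mem_iUnion₂.1 (hcov hz')
    rw [Metric.mem_ball, dist_eq_norm] at hzw
    have h1 := hn w hw
    have h3 := hTb n (z - w)
    have h4 : (‖gF‖ + 1) * ‖z - w‖ ≤ η / 2 := by
      rw [lt_div_iff₀ hK] at hzw
      linarith [mul_comm (‖gF‖ + 1) ‖z - w‖]
    have h5 := abs_norm_sub_norm_le (T n z) (T n w)
    have h6 := abs_norm_sub_norm_le z w
    rw [map_sub] at h3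
    rw [hz] at h6
    rw [abs_le] at *
    constructor <;> linarith
  have hbd : ∀ z : F, (1 - η) * ‖z‖ ≤ ‖T n z‖ ∧ ‖T n z‖ ≤ (1 + η) * ‖z‖ := by
    intro z
    rcases eq_or_ne z 0 with rfl | hz
    · simp
    have hz0 : 0 < ‖z‖ := norm_pos_iff.2 hz
    have h1 := hsph (‖z‖⁻¹ • z) (by rw [norm_smul, norm_inv, norm_norm, inv_mul_cancel₀ hz0.ne'])
    rw [map_smul, norm_smul, norm_inv, norm_norm, abs_le] at h1
    have h2 : ‖T n z‖ = ‖z‖ * (‖z‖⁻¹ * ‖T n z‖) := by field_simp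
    constructor <;> rw [h2] <;> nlinarith
  have hinj : Function.Injective (T n : F →ₗ[ℝ] X) := by
    rw [← LinearMap.ker_eq_bot, LinearMap.ker_eq_bot']
    intro z hz
    have h1 := (hbd z).1
    have h2 : T n z = 0 := hz
    rw [h2, norm_zero] at h1
    have : ‖z‖ ≤ 0 := by nlinarith [norm_nonneg z]
    exact norm_le_zero_iff.1 this
  let e := LinearEquiv.ofInjective (T n : F →ₗ[ℝ] X) hinj
  have he : ∀ z, ((e z : _) : X) = T n z := fun z => rfl
  refine ⟨LinearMap.range (T n : F →ₗ[ℝ] X), inferInstance, e.toContinuousLinearEquiv, ?_⟩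
  rw [← hprod]
  refine mul_le_mul ?_ ?_ (ContinuousLinearMap.opNorm_nonneg _) (by positivity)
  · refine ContinuousLinearMap.opNorm_le_bound _ (by positivity) fun z => ?_
    exact (hbd z).2
  · refine ContinuousLinearMap.opNorm_le_bound _ (inv_nonneg.2 (by linarith)) fun w => ?_
    obtain ⟨z, rfl⟩ := e.surjective w
    have h1 : (e.toContinuousLinearEquiv.symm : _ →L[ℝ] F) (e z) = z := e.symm_apply_apply z
    rw [h1, inv_mul_eq_div, le_div_iff₀ (by linarith), mul_comm]
    exact (hbd z).1

end Ultraproduct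

/-- The initial convex hulls of the sequence `x` stay `δ`-away from the convex hulls of the
corresponding tails, for the first `N` cut points. -/
def SeparatedUpTo {X : Type} [NormedAddCommGroup X] [NormedSpace ℝ X] (δ : ℝ) (N : ℕ)
    (x : ℕ → X) : Prop :=
  ∀ k < N, ∀ a ∈ convexHull ℝ (x '' Set.Iic k), ∀ b ∈ convexHull ℝ (x '' Set.Ioi k), δ ≤ ‖a - b‖

/-- `X` contains, for some `C` and `δ > 0`, arbitrarily long `δ`-separated sequences bounded
by `C`. -/
def HasSeparatedSequences (X : Type) [NormedAddCommGroup X] [NormedSpace ℝ X] : Prop :=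
  ∃ C δ : ℝ, 0 < δ ∧ ∀ N : ℕ, ∃ x : ℕ → X, (∀ i, ‖x i‖ ≤ C) ∧ SeparatedUpTo δ N x

lemma exists_weak_limit {Z : Type} [NormedAddCommGroup Z] [NormedSpace ℝ Z]
    (hZ : IsReflexiveBanach Z) (U : Ultrafilter ℕ) {z : ℕ → Z} {C : ℝ} (hz : ∀ i, ‖z i‖ ≤ C) :
    ∃ w : Z, ∀ φ : StrongDual ℝ Z, Tendsto (fun i => φ (z i)) U (𝓝 (φ w)) := by
  have hbd : ∀ (φ : StrongDual ℝ Z) i, ‖φ (z i)‖ ≤ C * ‖φ‖ := fun φ i =>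
    (φ.le_opNorm _).trans (by rw [mul_comm]; gcongr; exact hz i)
  have hlim : ∀ φ : StrongDual ℝ Z, ∃ l ∈ Metric.closedBall (0 : ℝ) (C * ‖φ‖),
      Tendsto (fun i => φ (z i)) U (𝓝 l) := by
    intro φ
    refine (isCompact_closedBall (0 : ℝ) (C * ‖φ‖)).ultrafilter_le_nhds (U.map fun i => φ (z i)) ?_
    rw [le_principal_iff]
    exact Filter.mem_map.2 (Filter.univ_mem' fun i => by simpa using hbd φ i)
  choose l hlb hl using hlim
  let Φ : StrongDual ℝ (StrongDual ℝ Z) := LinearMap.mkContinuous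
    { toFun := l
      map_add' := fun φ ψ => tendsto_nhds_unique (hl (φ + ψ)) ((hl φ).add (hl ψ))
      map_smul' := fun c φ => tendsto_nhds_unique (hl (c • φ)) ((hl φ).const_smul c) }
    C (fun φ => by simpa using hlb φ)
  obtain ⟨w, hw⟩ := hZ Φ
  refine ⟨w, fun φ => ?_⟩
  have h1 : φ w = l φ := by
    rw [← NormedSpace.dual_def ℝ, hw]
    rfl
  rw [h1]
  exact hl φ

lemma convexHull_range_eq_iUnion_Iic {Z : Type} [AddCommGroup Z] [Module ℝ Z] (z : ℕ → Z) {w : Z}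
    (hw : w ∈ convexHull ℝ (Set.range z)) : ∃ m, w ∈ convexHull ℝ (z '' Set.Iic m) := by
  have hmono : Monotone fun m => convexHull ℝ (z '' Set.Iic m) := fun m n hmn =>
    convexHull_mono (Set.image_mono (Set.Iic_subset_Iic.2 hmn))
  refine Set.mem_iUnion.1 (convexHull_min ?_ (hmono.directed_le.convex_iUnion
    fun m => convex_convexHull ℝ _) hw)
  rintro _ ⟨i, rfl⟩
  exact Set.mem_iUnion.2 ⟨i, subset_convexHull ℝ _ ⟨i, Set.mem_Iic.2 le_rfl, rfl⟩⟩

lemma not_isReflexiveBanach_of_separated {Z : Type} [NormedAddCommGroup Z] [NormedSpace ℝ Z]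
    {z : ℕ → Z} {C δ : ℝ} (hδ : 0 < δ) (hz : ∀ i, ‖z i‖ ≤ C) (hsep : ∀ N, SeparatedUpTo δ N z) :
    ¬ IsReflexiveBanach Z := by
  intro hZ
  obtain ⟨w, hw⟩ := exists_weak_limit hZ (hyperfilter ℕ) hz
  have hcl : ∀ k, w ∈ closure (convexHull ℝ (z '' Set.Ioi k)) := by
    intro k
    by_contra hk
    obtain ⟨f, u, hf, hu⟩ := geometric_hahn_banach_closed_point
      (convex_convexHull ℝ (z '' Set.Ioi k)).closure isClosed_closure hk
    have h1 : ∀ᶠ i in (hyperfilter ℕ : Filter ℕ), f (z i) ≤ u :=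
      Eventually.mono (Nat.hyperfilter_le_atTop (eventually_gt_atTop k)) fun i hi =>
        (hf _ (subset_closure (subset_convexHull ℝ _ ⟨i, hi, rfl⟩))).le
    exact absurd (le_of_tendsto (hw f) h1) (not_le.2 hu)
  obtain ⟨a, ha, haw⟩ := Metric.mem_closure_iff.1 (hcl 0) (δ / 2) (half_pos hδ)
  obtain ⟨m, hm⟩ := convexHull_range_eq_iUnion_Iic z
    (convexHull_mono (Set.image_subset_range z _) ha)
  obtain ⟨b, hb, hbw⟩ := Metric.mem_closure_iff.1 (hcl m) (δ / 2) (half_pos hδ)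
  have h1 := hsep (m + 1) m (Nat.lt_succ_self m) a hm b hb
  rw [← dist_eq_norm] at h1
  have h2 := dist_triangle_left a b w
  linarith

lemma not_superReflexive_of_hasSeparatedSequences {X : Type} [NormedAddCommGroup X]
    [NormedSpace ℝ X] [CompleteSpace X] (h : HasSeparatedSequences X) : ¬ SuperReflexive X := by
  obtain ⟨C, δ, hδ, h⟩ := h
  choose x hx hsep using h
  let U : Ultrafilter ℕ := hyperfilter ℕ
  let y : ℕ → BoundedContinuousFunction ℕ X := fun i =>
    BoundedContinuousFunction.ofNormedAddCommGroupDiscrete (fun n => x n i) C fun n => hx n i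
  let L : (ℕ →₀ ℝ) →ₗ[ℝ] BoundedContinuousFunction ℕ X := Finsupp.linearCombination ℝ y
  have hLn : ∀ n (α : ℕ →₀ ℝ), L α n = Finsupp.linearCombination ℝ (x n) α := by
    intro n α
    change BoundedContinuousFunction.evalCLM ℝ n (L α) = _
    simp only [L, Finsupp.linearCombination_apply, Finsupp.sum, map_sum, map_smul]
    rfl
  have himg : ∀ {E : Type} [AddCommGroup E] [Module ℝ E] (v : ℕ → E) (s : Set ℕ),
      convexHull ℝ (v '' s) = Finsupp.linearCombination ℝ v ''
        convexHull ℝ ((fun i => Finsupp.single i (1 : ℝ)) '' s) := by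
    intro E _ _ v s
    rw [LinearMap.image_convexHull, Set.image_image]
    simp
  intro hX
  refine not_isReflexiveBanach_of_separated (Z := UltraPower X U)
    (z := fun i => (ultraNull X U).mkQ (y i)) (C := C) hδ ?_ ?_
    (hX _ (finitelyRepresentable_ultraPower U))
  · intro i
    exact ultraPower_norm_le U (y i) ((norm_nonneg _).trans (hx 0 0))
      (Eventually.of_forall fun n => hx n i)
  · intro N k _ a ha b hb
    have hmk : Finsupp.linearCombination ℝ (fun i => (ultraNull X U).mkQ (y i)) =
        (ultraNull X U).mkQ ∘ₗ L := by
      ext i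
      simp [L]
    rw [himg, hmk] at ha hb
    obtain ⟨α, hα, rfl⟩ := ha
    obtain ⟨β, hβ, rfl⟩ := hb
    rw [LinearMap.comp_apply, LinearMap.comp_apply, ← map_sub, ← map_sub]
    refine le_ultraPower_norm U _ (Eventually.mono (Nat.hyperfilter_le_atTop (eventually_gt_atTop k))
      fun n hn => ?_)
    rw [hLn, map_sub]
    refine hsep n k hn _ ?_ _ ?_
    · rw [himg]
      exact ⟨α, hα, rfl⟩
    · rw [himg]
      exact ⟨β, hβ, rfl⟩

/-- Roots of bushes of depth `n` in `A`: a root of depth `n + 1` is the average of two quadruples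
of roots of depth `n` which share their outer members and whose second members are at distance at
least one. -/
def bushRoots {X : Type} [NormedAddCommGroup X] [NormedSpace ℝ X] (A : Set X) : ℕ → Set X
  | 0 => A
  | n + 1 => {x | x ∈ A ∧ ∃ y₁ ∈ bushRoots A n, ∃ y₂ ∈ bushRoots A n, ∃ y₃ ∈ bushRoots A n,
      ∃ y₄ ∈ bushRoots A n, ∃ z₂ ∈ bushRoots A n, ∃ z₃ ∈ bushRoots A n,
      (4 : ℝ) • x = y₁ + y₂ + y₃ + y₄ ∧ (4 : ℝ) • x = y₁ + z₂ + z₃ + y₄ ∧ 1 ≤ ‖y₂ - z₂‖}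

section Bush

variable {X : Type} [NormedAddCommGroup X] [NormedSpace ℝ X]

lemma bushRoots_subset (A : Set X) (n : ℕ) : bushRoots A n ⊆ A := by
  cases n with
  | zero => exact subset_rfl
  | succ n => exact fun x hx => hx.1

lemma bushRoots_succ_subset (A : Set X) (n : ℕ) : bushRoots A (n + 1) ⊆ bushRoots A n := by
  induction n with
  | zero => exact fun x hx => hx.1
  | succ n ih =>
    rintro x ⟨hx, y₁, h₁, y₂, h₂, y₃, h₃, y₄, h₄, z₂, k₂, z₃, k₃, h⟩
    exact ⟨hx, y₁, ih h₁, y₂, ih h₂, y₃, ih h₃, y₄, ih h₄, z₂, ih k₂, z₃, ih k₃, h⟩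

lemma bushRoots_antitone (A : Set X) : Antitone (bushRoots A) :=
  antitone_nat_of_succ_le (bushRoots_succ_subset A)

lemma bushRoots_mono {A B : Set X} (hAB : A ⊆ B) (n : ℕ) : bushRoots A n ⊆ bushRoots B n := by
  induction n with
  | zero => exact hAB
  | succ n ih =>
    rintro x ⟨hx, y₁, h₁, y₂, h₂, y₃, h₃, y₄, h₄, z₂, k₂, z₃, k₃, h⟩
    exact ⟨hAB hx, y₁, ih h₁, y₂, ih h₂, y₃, ih h₃, y₄, ih h₄, z₂, ih k₂, z₃, ih k₃, h⟩

/-- A bush whose root nearly maximizes a functional lies entirely in a slice. -/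
lemma mem_bushRoots_slice (A : Set X) (g : StrongDual ℝ X) (m : ℕ) {M : ℝ}
    (hM : ∀ a ∈ bushRoots A m, g a ≤ M) (L : ℕ) :
    ∀ (x : X) (ζ : ℝ), 0 ≤ ζ → x ∈ bushRoots A (m + L) → M - ζ ≤ g x →
      x ∈ bushRoots (A ∩ {a | M - 4 ^ L * ζ ≤ g a}) L := by
  induction L with
  | zero =>
    intro x ζ _ hx hgx
    exact ⟨bushRoots_subset A _ hx, by simpa using hgx⟩
  | succ L ih =>
    rintro x ζ hζ ⟨hx, y₁, h₁, y₂, h₂, y₃, h₃, y₄, h₄, z₂, k₂, z₃, k₃, hy, hz, hyz⟩ hgx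
    have hle : ∀ y ∈ bushRoots A (m + L), g y ≤ M := fun y hy =>
      hM y (bushRoots_antitone A (Nat.le_add_right m L) hy)
    have hgy := congrArg g hy
    have hgz := congrArg g hz
    simp only [map_smul, map_add, smul_eq_mul] at hgy hgz
    have hpow : (1 : ℝ) ≤ 4 ^ (L + 1) := one_le_pow₀ (by norm_num)
    have e : (4 : ℝ) ^ (L + 1) * ζ = 4 ^ L * (4 * ζ) := by ring
    have b₁ := hle _ h₁
    have b₂ := hle _ h₂
    have b₃ := hle _ h₃
    have b₄ := hle _ h₄
    have c₂ := hle _ k₂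
    have c₃ := hle _ k₃
    refine ⟨⟨hx, ?_⟩, ?_⟩
    · change M - 4 ^ (L + 1) * ζ ≤ g x
      nlinarith
    · rw [e]
      have h4 : 0 ≤ 4 * ζ := by linarith
      exact ⟨y₁, ih _ _ h4 h₁ (by linarith), y₂, ih _ _ h4 h₂ (by linarith),
        y₃, ih _ _ h4 h₃ (by linarith), y₄, ih _ _ h4 h₄ (by linarith),
        z₂, ih _ _ h4 k₂ (by linarith), z₃, ih _ _ h4 k₃ (by linarith), hy, hz, hyz⟩

/-- A sufficiently deep bush contains a bush of prescribed depth on which a given functional does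
not go below its value at the root of the large bush, up to a prescribed error. -/
lemma exists_bushRoots_slice (C : ℝ) {τ : ℝ} (hτ : 0 < τ) (L : ℕ) :
    ∃ N, ∀ A : Set X, (∀ a ∈ A, ‖a‖ ≤ C) → ∀ g : StrongDual ℝ X, ‖g‖ ≤ 1 →
      ∀ x ∈ bushRoots A N, (bushRoots (A ∩ {a | g x - τ ≤ g a}) L).Nonempty := by
  set η : ℝ := τ / 4 ^ L with hη
  have hη0 : 0 < η := by positivity
  have key : ∀ A : Set X, ∀ g : StrongDual ℝ X, (∀ a ∈ A, g a ≤ C) → ∀ j : ℕ,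
      ∀ x ∈ bushRoots A (j * L), C - j * η < g x →
      (bushRoots (A ∩ {a | g x - τ ≤ g a}) L).Nonempty := by
    intro A g hg j
    induction j with
    | zero =>
      intro x hx hgx
      have := hg x (bushRoots_subset A _ hx)
      simp at hgx
      linarith
    | succ j ih =>
      intro x hx hgx
      push_cast at hgx
      by_cases hcase : ∃ x' ∈ bushRoots A (j * L), g x + η ≤ g x'
      · obtain ⟨x', hx', hgx'⟩ := hcase
        refine (ih x' hx' (by linarith)).mono (bushRoots_mono ?_ L)
        rintro a ⟨ha, hga⟩
        exact ⟨ha, by simp only [Set.mem_ofPred_eq] at hga ⊢; linarith⟩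
      · push Not at hcase
        rw [Nat.add_mul, one_mul] at hx
        refine ⟨x, bushRoots_mono ?_ L (mem_bushRoots_slice A g (j * L) (M := g x + η)
          (fun a ha => (hcase a ha).le) L x η hη0.le hx (by linarith))⟩
        rintro a ⟨ha, hga⟩
        have e : 4 ^ L * η = τ := by rw [hη]; field_simp
        refine ⟨ha, ?_⟩
        simp only [Set.mem_ofPred_eq, e] at hga ⊢
        linarith
  obtain ⟨j, hj⟩ := exists_nat_gt (2 * C / η)
  rw [div_lt_iff₀ hη0] at hj
  refine ⟨j * L, fun A hA g hg x hx => ?_⟩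
  have hgA : ∀ a ∈ A, |g a| ≤ C := fun a ha =>
    (g.le_of_opNorm_le hg a).trans (by simpa using hA a ha)
  refine key A g (fun a ha => (abs_le.1 (hgA a ha)).2) j x hx ?_
  have := (abs_le.1 (hgA x (bushRoots_subset A _ hx))).1
  linarith

lemma exists_bushRoots_avoiding_point (C : ℝ) (L : ℕ) :
    ∃ N, ∀ A : Set X, (∀ a ∈ A, ‖a‖ ≤ C) → ∀ z : X, (bushRoots A N).Nonempty →
      ∃ A' ⊆ A, (bushRoots A' L).Nonempty ∧ ∀ a ∈ A', 1 / 4 ≤ ‖a - z‖ := by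
  obtain ⟨N, hN⟩ := exists_bushRoots_slice (X := X) C (τ := 1 / 4) (by norm_num) L
  refine ⟨N + 1, fun A hA z ⟨x, hx⟩ => ?_⟩
  obtain ⟨v, hv, hvz⟩ : ∃ v ∈ bushRoots A N, 1 / 2 ≤ ‖v - z‖ := by
    obtain ⟨-, -, -, y, hy, -, -, -, -, w, hw, -, -, -, -, hyw⟩ := hx
    by_contra! hcon
    have h1 := hcon y hy
    have h2 := hcon w hw
    have h3 := norm_sub_le (y - z) (w - z)
    rw [sub_sub_sub_cancel_right] at h3
    linarith
  obtain ⟨g, hg, hgv⟩ := exists_dual_vector'' ℝ (v - z)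
  refine ⟨_, Set.inter_subset_left, hN A hA g hg v hv, ?_⟩
  rintro a ⟨-, ha⟩
  simp only [Set.mem_ofPred_eq] at ha
  have h1 := (le_abs_self _).trans (g.le_of_opNorm_le hg (a - z))
  simp only [map_sub, RCLike.ofReal_real_eq_id, id_eq] at h1 hgv
  linarith

lemma exists_bushRoots_avoiding_finset (C : ℝ) {ι : Type} (W : Finset ι) :
    ∀ L, ∃ N, ∀ A : Set X, (∀ a ∈ A, ‖a‖ ≤ C) → ∀ z : ι → X, (bushRoots A N).Nonempty →
      ∃ A' ⊆ A, (bushRoots A' L).Nonempty ∧ ∀ w ∈ W, ∀ a ∈ A', 1 / 4 ≤ ‖a - z w‖ := by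
  classical
  induction W using Finset.induction_on with
  | empty => exact fun L => ⟨L, fun A _ z hA => ⟨A, subset_rfl, hA, by simp⟩⟩
  | insert w W _ ih =>
    intro L
    obtain ⟨N₁, h₁⟩ := ih L
    obtain ⟨N, h⟩ := exists_bushRoots_avoiding_point (X := X) C N₁
    refine ⟨N, fun A hA z hne => ?_⟩
    obtain ⟨A₁, hA₁, hne₁, hz₁⟩ := h A hA (z w) hne
    obtain ⟨A₂, hA₂, hne₂, hz₂⟩ := h₁ A₁ (fun a ha => hA a (hA₁ ha)) z hne₁
    refine ⟨A₂, hA₂.trans hA₁, hne₂, fun v hv a ha => ?_⟩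
    rcases Finset.mem_insert.1 hv with rfl | hv
    · exact hz₁ a (hA₂ ha)
    · exact hz₂ v hv a ha

/-- Quantitative Hahn–Banach separation of a point from a convex set. -/
lemma exists_dual_separating {S : Set X} (hS : Convex ℝ S) {u : X} {d : ℝ}
    (hd : 0 < d) (hu : ∀ a ∈ S, d ≤ ‖u - a‖) :
    ∃ g : StrongDual ℝ X, ‖g‖ ≤ 1 ∧ ∀ a ∈ S, g a + d ≤ g u := by
  have hdisj : Disjoint (Metric.ball u d) S := by
    rw [Set.disjoint_left]
    intro a ha haS
    rw [Metric.mem_ball, dist_comm, dist_eq_norm] at ha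
    linarith [hu a haS]
  obtain ⟨f, c, hf, hc⟩ := geometric_hahn_banach_open (convex_ball u d) Metric.isOpen_ball hS hdisj
  obtain ⟨m, hm⟩ : ∃ m, m = c - f u := ⟨_, rfl⟩
  have hm0 : 0 < m := by have := hf u (Metric.mem_ball_self hd); linarith
  have hpos : ∀ v, 0 < f v → d * f v ≤ m * ‖v‖ := by
    intro v hv
    by_contra! hcon
    have hmem : u + (m / f v) • v ∈ Metric.ball u d := by
      rw [mem_ball_iff_norm, add_sub_cancel_left, norm_smul, Real.norm_of_nonneg (by positivity),
        div_mul_eq_mul_div, div_lt_iff₀ hv]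
      exact hcon
    have := hf _ hmem
    rw [map_add, map_smul, smul_eq_mul, div_mul_cancel₀ _ hv.ne'] at this
    linarith
  have hbound : ∀ v, d * |f v| ≤ m * ‖v‖ := by
    intro v
    rcases lt_trichotomy (f v) 0 with h | h | h
    · have := hpos (-v) (by rw [map_neg]; linarith)
      rwa [map_neg, norm_neg, ← abs_of_neg h] at this
    · rw [h, abs_zero, mul_zero]
      positivity
    · rw [abs_of_pos h]
      exact hpos v h
  refine ⟨-((d / m) • f), ?_, fun a ha => ?_⟩
  · refine ContinuousLinearMap.opNorm_le_bound _ zero_le_one fun v => ?_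
    have : ‖(-((d / m) • f)) v‖ = d * |f v| / m := by
      simp [abs_of_pos hd, abs_of_pos hm0]
      ring
    rw [this, div_le_iff₀ hm0, one_mul, mul_comm ‖v‖]
    exact hbound v
  · have h1 := hc a ha
    have h2 : d / m * (f a - f u) ≥ d / m * m := by
      have : 0 < d / m := by positivity
      gcongr
      linarith
    rw [div_mul_cancel₀ _ hm0.ne'] at h2
    simp only [neg_apply, smul_apply, smul_eq_mul]
    linarith

/-- The convex hulls of all `K + 1`-tuples in a ball have nets given by a common finite set of
convex weights. -/
lemma exists_finset_weights_net {C : ℝ} (hC : 0 < C) (K : ℕ) {ε : ℝ} (hε : 0 < ε) :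
    ∃ W : Finset (Fin (K + 1) → ℝ), ∀ y : ℕ → X, (∀ i ≤ K, ‖y i‖ ≤ C) →
      ∀ a ∈ convexHull ℝ (y '' Set.Iic K), ∃ w ∈ W, ‖a - ∑ i, w i • y i‖ ≤ ε := by
  have hK : (0 : ℝ) < (K + 1 : ℝ) := by positivity
  obtain ⟨t, -, htf, hcov⟩ := (isCompact_stdSimplex ℝ (Fin (K + 1))).finite_cover_balls
    (e := ε / (C * (K + 1))) (by positivity)
  refine ⟨htf.toFinset, fun y hy a ha => ?_⟩
  have himg : y '' Set.Iic K = Set.range fun i : Fin (K + 1) => y i := by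
    ext v
    constructor
    · rintro ⟨i, hi, rfl⟩
      exact ⟨⟨i, Nat.lt_succ_of_le hi⟩, rfl⟩
    · rintro ⟨i, rfl⟩
      exact ⟨i, Nat.le_of_lt_succ i.2, rfl⟩
  have hcomb : ∃ w ∈ stdSimplex ℝ (Fin (K + 1)), a = ∑ i, w i • y i := by
    rw [himg] at ha
    have hr : (Set.range fun i : Fin (K + 1) => y i) =
        Fintype.linearCombination ℝ (fun i : Fin (K + 1) => y i) ''
          Set.range fun i : Fin (K + 1) => (Pi.single i 1 : Fin (K + 1) → ℝ) := by
      rw [← Set.range_comp]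
      congr 1
      ext i
      simp [Fintype.linearCombination_apply_single]
    rw [hr, ← LinearMap.image_convexHull, convexHull_rangle_single_eq_stdSimplex] at ha
    obtain ⟨w, hw, rfl⟩ := ha
    exact ⟨w, hw, Fintype.linearCombination_apply ..⟩
  obtain ⟨w, hw, rfl⟩ := hcomb
  obtain ⟨w', hw', hww'⟩ := Set.mem_iUnion₂.1 (hcov hw)
  refine ⟨w', htf.mem_toFinset.2 hw', ?_⟩
  rw [← Finset.sum_sub_distrib]
  refine (norm_sum_le _ _).trans ?_
  have hterm : ∀ i ∈ (Finset.univ : Finset (Fin (K + 1))),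
      ‖w i • y i - w' i • y i‖ ≤ ε / (K + 1) := by
    intro i _
    rw [← sub_smul, norm_smul]
    have h1 : ‖w i - w' i‖ ≤ ε / (C * (K + 1)) := by
      rw [← dist_eq_norm]
      exact (dist_le_pi_dist w w' i).trans (Metric.mem_ball.1 hww').le
    have h2 := hy i (Nat.le_of_lt_succ i.2)
    calc ‖w i - w' i‖ * ‖y i‖ ≤ ε / (C * (K + 1)) * C := by gcongr
      _ = ε / (K + 1) := by field_simp
  refine (Finset.sum_le_card_nsmul _ _ _ hterm).trans (le_of_eq ?_)
  simp
  field_simp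

lemma exists_bushRoots_separated {C : ℝ} (hC : 0 < C) (K L : ℕ) :
    ∃ N, ∀ A : Set X, (∀ a ∈ A, ‖a‖ ≤ C) → ∀ y : ℕ → X, (∀ i ≤ K, ‖y i‖ ≤ C) →
      (bushRoots A N).Nonempty → ∃ A' ⊆ A, (bushRoots A' L).Nonempty ∧
        ∀ a ∈ convexHull ℝ (y '' Set.Iic K), ∀ b ∈ convexHull ℝ A', 1 / 16 ≤ ‖a - b‖ := by
  obtain ⟨W, hW⟩ := exists_finset_weights_net (X := X) hC K (ε := 1 / 8) (by norm_num)
  obtain ⟨L₁, hL₁⟩ := exists_bushRoots_slice (X := X) C (τ := 1 / 16) (by norm_num) L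
  obtain ⟨N, hN⟩ := exists_bushRoots_avoiding_finset (X := X) C W L₁
  refine ⟨N, fun A hA y hy hne => ?_⟩
  obtain ⟨A₁, hA₁, ⟨u, hu⟩, hav⟩ := hN A hA (fun w => ∑ i, w i • y i) hne
  have hdist : ∀ a ∈ convexHull ℝ (y '' Set.Iic K), 1 / 8 ≤ ‖u - a‖ := by
    intro a ha
    obtain ⟨w, hw, haw⟩ := hW y hy a ha
    have h1 := hav w hw u (bushRoots_subset _ _ hu)
    have h2 := norm_sub_le_norm_sub_add_norm_sub u a (∑ i, w i • y i)
    linarith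
  obtain ⟨g, hg, hgu⟩ := exists_dual_separating (convex_convexHull ℝ (y '' Set.Iic K))
    (by norm_num) hdist
  refine ⟨_, Set.inter_subset_left.trans hA₁, hL₁ A₁ (fun a ha => hA a (hA₁ ha)) g hg u hu, ?_⟩
  intro a ha b hb
  have hb' : g u - 1 / 16 ≤ g b :=
    convexHull_min (fun v hv => hv.2) (convex_halfSpace_ge g.toLinearMap.isLinear _) hb
  have h1 := hgu a ha
  have h2 := (le_abs_self _).trans (g.le_of_opNorm_le hg (b - a))
  rw [map_sub, one_mul, norm_sub_rev] at h2
  linarith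

lemma hasSeparatedSequences_of_bushRoots {C : ℝ}
    (h : ∀ N, (bushRoots (Metric.closedBall (0 : X) C) N).Nonempty) :
    HasSeparatedSequences X := by
  have hC : 0 < C := by
    obtain ⟨x, -, -, -, y, hy, -, -, -, -, w, hw, -, -, -, -, hyw⟩ := h 1
    have h1 : ‖y‖ ≤ C := by simpa using bushRoots_subset _ _ hy
    have h2 : ‖w‖ ≤ C := by simpa using bushRoots_subset _ _ hw
    linarith [norm_sub_le y w]
  have key : ∀ N K : ℕ, ∃ L, ∀ A : Set X, (∀ a ∈ A, ‖a‖ ≤ C) → ∀ p : ℕ → X,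
      (∀ i < K, ‖p i‖ ≤ C) → (bushRoots A L).Nonempty →
      ∃ x : ℕ → X, (∀ i < K, x i = p i) ∧ (∀ i ≥ K, x i ∈ A) ∧ ∀ k, K ≤ k → k < K + N →
        ∀ a ∈ convexHull ℝ (x '' Set.Iic k), ∀ b ∈ convexHull ℝ (x '' Set.Ioi k),
          1 / 16 ≤ ‖a - b‖ := by
    intro N
    induction N with
    | zero =>
      refine fun K => ⟨0, fun A _ p _ ⟨v, hv⟩ => ⟨fun i => if i < K then p i else v, ?_, ?_, ?_⟩⟩
      · exact fun i hi => if_pos hi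
      · exact fun i hi => by simpa [not_lt.2 hi] using bushRoots_subset _ _ hv
      · intros; omega
    | succ N ih =>
      intro K
      obtain ⟨L₁, hL₁⟩ := ih (K + 1)
      obtain ⟨L, hL⟩ := exists_bushRoots_separated (X := X) hC K L₁
      refine ⟨L, fun A hA p hp ⟨v, hv⟩ => ?_⟩
      have hvA := bushRoots_subset _ _ hv
      let q : ℕ → X := fun i => if i < K then p i else v
      have hq : ∀ i, i < K + 1 → ‖q i‖ ≤ C := by
        intro i _
        by_cases hi : i < K
        · simpa [q, hi] using hp i hi
        · simpa [q, hi] using hA v hvA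
      obtain ⟨A', hA', hne, hsep⟩ := hL A hA q (fun i hi => hq i (Nat.lt_succ_of_le hi)) ⟨v, hv⟩
      obtain ⟨x, hxq, hxA, hx⟩ := hL₁ A' (fun a ha => hA a (hA' ha)) q hq hne
      refine ⟨x, fun i hi => ?_, fun i hi => ?_, fun k hk hkN => ?_⟩
      · rw [hxq i (by omega)]
        exact if_pos hi
      · rcases hi.lt_or_eq with hi | rfl
        · exact hA' (hxA i hi)
        · rw [hxq K (by omega)]
          simpa [q] using hvA
      · rcases hk.lt_or_eq with hk | rfl
        · exact hx k hk (by omega)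
        · intro a ha b hb
          refine hsep a ?_ b (convexHull_mono ?_ hb)
          · have e : x '' Set.Iic K = q '' Set.Iic K :=
              Set.image_congr fun i hi => hxq i (Nat.lt_succ_of_le hi)
            rwa [e] at ha
          · rintro _ ⟨i, hi, rfl⟩
            exact hxA i hi
  refine ⟨C, 1 / 16, by norm_num, fun N => ?_⟩
  obtain ⟨L, hL⟩ := key N 0
  obtain ⟨x, -, hxA, hx⟩ := hL (Metric.closedBall 0 C) (fun a ha => by simpa using ha) 0
    (by simp) (h L)
  exact ⟨x, fun i => by simpa using hxA i (Nat.zero_le i),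
    fun k hk => hx k (Nat.zero_le k) (by omega)⟩

end Bush

section LaaksoGraph

variable {V : Type} {G : SimpleGraph V}

/-- A map which is Lipschitz along the edges of a connected graph is Lipschitz. -/
lemma SimpleGraph.Connected.norm_sub_le_mul_dist {E : Type} [SeminormedAddCommGroup E]
    (hG : G.Connected) {f : V → E} {K : ℝ} (hf : ∀ u v, G.Adj u v → ‖f u - f v‖ ≤ K) (u v : V) :
    ‖f u - f v‖ ≤ K * G.dist u v := by
  obtain ⟨p, hp⟩ := hG.exists_walk_length_eq_dist u v
  rw [← hp]
  clear hp
  induction p with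
  | nil => simp
  | @cons u v w h p ih =>
    have := norm_sub_le_norm_sub_add_norm_sub (f u) (f v) (f w)
    have := hf u v h
    rw [SimpleGraph.Walk.length_cons]
    push_cast
    linarith

/-- The replacement of each edge of a graph by a copy of the Laakso graph `L₁`. -/
def laaksoStep (G : SimpleGraph V) :
    SimpleGraph (V ⊕ ({p : V × V // G.Adj p.1 p.2} × Bool)) :=
  SimpleGraph.fromRel (laaksoRel G.Adj)

/-- The new vertex adjacent to the first endpoint of an edge. -/
def outerVertex {u v : V} (h : G.Adj u v) : V ⊕ ({p : V × V // G.Adj p.1 p.2} × Bool) :=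
  Sum.inr (⟨(u, v), h⟩, false)

/-- One of the two new vertices in the middle of an edge. -/
def middleVertex {u v : V} (h : G.Adj u v) : V ⊕ ({p : V × V // G.Adj p.1 p.2} × Bool) :=
  Sum.inr (⟨(u, v), h⟩, true)

lemma laaksoStep_adj_inl {u v : V} (h : G.Adj u v) :
    (laaksoStep G).Adj (Sum.inl u) (outerVertex h) := by
  rw [laaksoStep, SimpleGraph.fromRel_adj]
  exact ⟨by simp [outerVertex], Or.inl ⟨rfl, rfl⟩⟩

lemma laaksoStep_adj_middle {u v : V} (h : G.Adj u v) :
    (laaksoStep G).Adj (outerVertex h) (middleVertex h) := by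
  rw [laaksoStep, SimpleGraph.fromRel_adj]
  exact ⟨by simp [outerVertex, middleVertex], Or.inl ⟨rfl, rfl, Or.inl rfl⟩⟩

lemma laaksoStep_adj_middle_symm {u v : V} (h : G.Adj u v) :
    (laaksoStep G).Adj (outerVertex h) (middleVertex h.symm) := by
  rw [laaksoStep, SimpleGraph.fromRel_adj]
  exact ⟨by simp [outerVertex, middleVertex], Or.inl ⟨rfl, rfl, Or.inr ⟨rfl, rfl⟩⟩⟩

/-- Every edge of `laaksoStep G` is of one of three kinds, up to symmetry. -/
lemma laaksoStep_adj_induction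
    {P : V ⊕ ({p : V × V // G.Adj p.1 p.2} × Bool) → V ⊕ ({p : V × V // G.Adj p.1 p.2} × Bool) →
      Prop}
    (hP : ∀ x y, P x y → P y x)
    (h₁ : ∀ u v (h : G.Adj u v), P (Sum.inl u) (outerVertex h))
    (h₂ : ∀ u v (h : G.Adj u v), P (outerVertex h) (middleVertex h))
    (h₃ : ∀ u v (h : G.Adj u v), P (outerVertex h) (middleVertex h.symm)) :
    ∀ x y, (laaksoStep G).Adj x y → P x y := by
  have key : ∀ x y, laaksoRel G.Adj x y → P x y := by
    rintro (u | ⟨⟨⟨u, v⟩, h⟩, b⟩) (w | ⟨⟨⟨w, z⟩, k⟩, c⟩) hr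
    · exact hr.elim
    · obtain ⟨rfl, rfl⟩ := hr
      exact h₁ _ _ k
    · exact hr.elim
    · obtain ⟨rfl, rfl, hr⟩ := hr
      rcases hr with hr | ⟨hr, hr'⟩
      · obtain ⟨rfl, rfl⟩ := Prod.mk.inj hr
        exact h₂ _ _ h
      · dsimp only at hr hr'
        subst hr hr'
        exact h₃ _ _ h
  intro x y hxy
  rw [laaksoStep, SimpleGraph.fromRel_adj] at hxy
  exact hxy.2.elim (key x y) fun h => hP _ _ (key y x h)

lemma laaksoStep_reachable_inl {u v : V} (h : G.Reachable u v) :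
    (laaksoStep G).Reachable (Sum.inl u) (Sum.inl v) := by
  obtain ⟨p⟩ := h
  induction p with
  | nil => rfl
  | cons h p ih =>
    refine SimpleGraph.Reachable.trans ?_ ih
    exact (laaksoStep_adj_inl h).reachable.trans <|
      (laaksoStep_adj_middle h).reachable.trans <|
      (laaksoStep_adj_middle_symm h.symm).reachable.symm.trans
      (laaksoStep_adj_inl h.symm).reachable.symm

lemma laaksoStep_connected (hG : G.Connected) : (laaksoStep G).Connected := by
  have key : ∀ x, ∃ u, (laaksoStep G).Reachable (Sum.inl u) x := by
    rintro (u | ⟨⟨⟨u, v⟩, h⟩, _ | _⟩)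
    · exact ⟨u, by rfl⟩
    · exact ⟨u, (laaksoStep_adj_inl h).reachable⟩
    · exact ⟨u, (laaksoStep_adj_inl h).reachable.trans (laaksoStep_adj_middle h).reachable⟩
  have : Nonempty (V ⊕ ({p : V × V // G.Adj p.1 p.2} × Bool)) := hG.nonempty.map Sum.inl
  refine ⟨fun x y => ?_⟩
  obtain ⟨u, hu⟩ := key x
  obtain ⟨v, hv⟩ := key y
  exact hu.symm.trans ((laaksoStep_reachable_inl (hG.preconnected u v)).trans hv)

lemma laaksoStep_dist_inl_le (hG : G.Connected) (u v : V) :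
    (laaksoStep G).dist (Sum.inl u) (Sum.inl v) ≤ 4 * G.dist u v := by
  obtain ⟨p, hp⟩ := hG.exists_walk_length_eq_dist u v
  rw [← hp]
  clear hp
  induction p with
  | nil => simp
  | @cons u v w h p ih =>
    have hc := laaksoStep_connected hG
    have d₁ := SimpleGraph.dist_eq_one_iff_adj.2 (laaksoStep_adj_inl h)
    have d₂ := SimpleGraph.dist_eq_one_iff_adj.2 (laaksoStep_adj_middle h)
    have d₃ := SimpleGraph.dist_eq_one_iff_adj.2 (laaksoStep_adj_middle_symm h.symm).symm
    have d₄ := SimpleGraph.dist_eq_one_iff_adj.2 (laaksoStep_adj_inl h.symm).symm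
    have t₁ := hc.dist_triangle (u := Sum.inl u) (v := outerVertex h) (w := Sum.inl w)
    have t₂ := hc.dist_triangle (u := outerVertex h) (v := middleVertex h) (w := Sum.inl w)
    have t₃ := hc.dist_triangle (u := middleVertex h) (v := outerVertex h.symm) (w := Sum.inl w)
    have t₄ := hc.dist_triangle (u := outerVertex h.symm) (v := Sum.inl v) (w := Sum.inl w)
    rw [SimpleGraph.Walk.length_cons]
    omega

lemma le_laaksoStep_dist_inl (hG : G.Connected) (u v : V) :
    4 * G.dist u v ≤ (laaksoStep G).dist (Sum.inl u) (Sum.inl v) := by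
  let d : V → ℝ := fun w => G.dist u w
  let φ : V ⊕ ({p : V × V // G.Adj p.1 p.2} × Bool) → ℝ
    | Sum.inl w => 4 * d w
    | Sum.inr (p, false) => 3 * d p.1.1 + d p.1.2
    | Sum.inr (p, true) => 2 * d p.1.1 + 2 * d p.1.2
  have hd : ∀ w z, G.Adj w z → |d w - d z| ≤ 1 := by
    intro w z h
    have h₀ := SimpleGraph.dist_eq_one_iff_adj.2 h
    have h₁ := hG.dist_triangle (u := u) (v := w) (w := z)
    have h₂ := hG.dist_triangle (u := u) (v := z) (w := w)
    rw [SimpleGraph.dist_comm (u := z)] at h₂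
    rw [h₀] at h₁ h₂
    rw [abs_le]
    have h₁' : (G.dist u z : ℝ) ≤ G.dist u w + 1 := by exact_mod_cast h₁
    have h₂' : (G.dist u w : ℝ) ≤ G.dist u z + 1 := by exact_mod_cast h₂
    constructor <;> simp only [d] <;> linarith
  have hφ : ∀ x y, (laaksoStep G).Adj x y → ‖φ x - φ y‖ ≤ 1 := by
    refine laaksoStep_adj_induction (fun x y h => by rwa [norm_sub_rev]) ?_ ?_ ?_ <;>
    · intro w z h
      have := abs_le.1 (hd w z h)
      simp only [φ, outerVertex, middleVertex, Real.norm_eq_abs, abs_le]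
      constructor <;> linarith
  have h := (laaksoStep_connected hG).norm_sub_le_mul_dist hφ (Sum.inl u) (Sum.inl v)
  simp only [φ, d, SimpleGraph.dist_self, Nat.cast_zero, mul_zero, zero_sub, norm_neg, one_mul,
    Real.norm_eq_abs] at h
  have h' := (le_abs_self _).trans h
  exact_mod_cast h'

end LaaksoGraph

section LaaksoBush

variable {X : Type} [NormedAddCommGroup X] [NormedSpace ℝ X]

lemma laaksoData_zero_adj (a b : Bool) : (LaaksoData 0).2.Adj a b ↔ a ≠ b := by
  change (SimpleGraph.fromRel fun a b : Bool => a ≠ b).Adj a b ↔ _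
  rw [SimpleGraph.fromRel_adj]
  tauto

lemma laaksoData_connected (n : ℕ) : (LaaksoData n).2.Connected := by
  induction n with
  | zero =>
    have : Nonempty (LaaksoData 0).1 := ⟨(true : Bool)⟩
    refine ⟨fun a b => ?_⟩
    by_cases h : a = b
    · rw [h]
    · exact SimpleGraph.Adj.reachable ((laaksoData_zero_adj a b).2 h)
  | succ n ih => exact laaksoStep_connected ih

/-- The slopes of the original edges lie one level higher in the bush than those of the edges of
the refined graph. -/
lemma slope_mem_bushRoots_succ {V : Type} {G : SimpleGraph V} (hG : G.Connected) {A : Set X}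
    (hA : Convex ℝ A) {k : ℕ} {r : ℝ} (hr : 0 < r)
    {f : V ⊕ ({p : V × V // G.Adj p.1 p.2} × Bool) → X}
    (hf : ∀ x y, r * (laaksoStep G).dist x y ≤ ‖f x - f y‖)
    (hs : ∀ x y, (laaksoStep G).Adj x y → r⁻¹ • (f y - f x) ∈ bushRoots A k) {u v : V}
    (h : G.Adj u v) :
    (4 * r)⁻¹ • (f (Sum.inl v) - f (Sum.inl u)) ∈ bushRoots A (k + 1) := by
  have h₁ := hs _ _ (laaksoStep_adj_inl h)
  have h₂ := hs _ _ (laaksoStep_adj_middle h)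
  have h₃ := hs _ _ (laaksoStep_adj_middle_symm h.symm).symm
  have h₄ := hs _ _ (laaksoStep_adj_inl h.symm).symm
  have k₂ := hs _ _ (laaksoStep_adj_middle_symm h)
  have k₃ := hs _ _ (laaksoStep_adj_middle h.symm).symm
  have e : (4 : ℝ) • ((4 * r)⁻¹ • (f (Sum.inl v) - f (Sum.inl u))) =
      r⁻¹ • (f (Sum.inl v) - f (Sum.inl u)) := by
    rw [smul_smul, mul_inv, mul_inv_cancel_left₀ four_ne_zero]
  have e₁ : (4 : ℝ) • ((4 * r)⁻¹ • (f (Sum.inl v) - f (Sum.inl u))) =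
      r⁻¹ • (f (outerVertex h) - f (Sum.inl u)) +
      r⁻¹ • (f (middleVertex h) - f (outerVertex h)) +
      r⁻¹ • (f (outerVertex h.symm) - f (middleVertex h)) +
      r⁻¹ • (f (Sum.inl v) - f (outerVertex h.symm)) := by
    rw [e, ← smul_add, ← smul_add, ← smul_add]
    congr 1
    abel
  have e₂ : (4 : ℝ) • ((4 * r)⁻¹ • (f (Sum.inl v) - f (Sum.inl u))) =
      r⁻¹ • (f (outerVertex h) - f (Sum.inl u)) +
      r⁻¹ • (f (middleVertex h.symm) - f (outerVertex h)) +
      r⁻¹ • (f (outerVertex h.symm) - f (middleVertex h.symm)) +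
      r⁻¹ • (f (Sum.inl v) - f (outerVertex h.symm)) := by
    rw [e, ← smul_add, ← smul_add, ← smul_add]
    congr 1
    abel
  refine ⟨?_, _, h₁, _, h₂, _, h₃, _, h₄, _, k₂, _, k₃, e₁, e₂, ?_⟩
  · have m₁ := bushRoots_subset _ _ h₁
    have m₂ := bushRoots_subset _ _ h₂
    have m₃ := bushRoots_subset _ _ h₃
    have m₄ := bushRoots_subset _ _ h₄
    have half : (0 : ℝ) ≤ 1 / 2 := by norm_num
    have hsum : (1 / 2 : ℝ) + 1 / 2 = 1 := by norm_num
    convert hA (hA m₁ m₂ half half hsum) (hA m₃ m₄ half half hsum) half half hsum using 1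
    rw [← smul_right_injective X (four_ne_zero (α := ℝ)) |>.eq_iff]
    rw [e₁]
    module
  · rw [← smul_sub, sub_sub_sub_cancel_right, norm_smul, norm_inv, Real.norm_of_nonneg hr.le,
      le_inv_mul_iff₀ hr]
    refine le_trans ?_ (hf _ _)
    gcongr
    have hne : middleVertex h ≠ middleVertex h.symm := by
      intro heq
      simp only [middleVertex, Sum.inr.injEq, Prod.mk.injEq, Subtype.mk.injEq] at heq
      exact h.ne heq.1.1
    exact_mod_cast (laaksoStep_connected hG).pos_dist_of_ne hne

lemma bushRoots_nonempty_of_laakso {A : Set X} (hA : Convex ℝ A) (n : ℕ) :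
    ∀ (k : ℕ) (r : ℝ) (f : (LaaksoData n).1 → X), 0 < r →
      (∀ x y, r * (LaaksoData n).2.dist x y ≤ ‖f x - f y‖) →
      (∀ x y, (LaaksoData n).2.Adj x y → r⁻¹ • (f y - f x) ∈ bushRoots A k) →
      (bushRoots A (k + n)).Nonempty := by
  induction n with
  | zero =>
    intro k r f _ _ hs
    exact ⟨_, hs (false : Bool) (true : Bool) ((laaksoData_zero_adj _ _).2 (by simp))⟩
  | succ n ih =>
    intro k r f hr hf hs
    have hG := laaksoData_connected n
    have := ih (k + 1) (4 * r) (fun u => f (Sum.inl u)) (by positivity) (fun u v => ?_)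
      (fun u v h => slope_mem_bushRoots_succ hG hA hr hf hs h)
    · rwa [add_assoc, add_comm 1] at this
    · refine le_trans ?_ (hf _ _)
      have h : (4 * (LaaksoData n).2.dist u v : ℝ) ≤
          (LaaksoData (n + 1)).2.dist (Sum.inl u) (Sum.inl v) := by
        exact_mod_cast le_laaksoStep_dist_inl hG u v
      nlinarith

lemma not_superReflexive_of_laakso [CompleteSpace X] {C : ℝ}
    (h : ∀ n : ℕ, ∃ r : ℝ, 0 < r ∧ ∃ f : LaaksoV n → X, ∀ u v : LaaksoV n,
      r * laaksoDist n u v ≤ ‖f u - f v‖ ∧ ‖f u - f v‖ ≤ r * C * laaksoDist n u v) :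
    ¬ SuperReflexive X := by
  refine not_superReflexive_of_hasSeparatedSequences
    (hasSeparatedSequences_of_bushRoots (C := C) fun N => ?_)
  obtain ⟨r, hr, f, hf⟩ := h N
  have := bushRoots_nonempty_of_laakso (convex_closedBall (0 : X) C) N 0 r f hr
    (fun x y => (hf x y).1) fun x y hxy => ?_
  · rwa [zero_add] at this
  · change _ ∈ Metric.closedBall (0 : X) C
    have h₁ := (hf y x).2
    change _ ≤ r * C * ((LaaksoData N).2.dist y x : ℝ) at h₁
    rw [SimpleGraph.dist_eq_one_iff_adj.2 hxy.symm, Nat.cast_one, mul_one] at h₁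
    rw [mem_closedBall_zero_iff, norm_smul, norm_inv, Real.norm_of_nonneg hr.le,
      inv_mul_le_iff₀ hr]
    exact h₁

end LaaksoBush

section Helly

/-- Helly's theorem on the solution of finitely many linear equations under a norm bound. -/
lemma exists_norm_le_apply_eq {V ι : Type} [NormedAddCommGroup V] [NormedSpace ℝ V]
    [CompleteSpace V] [Fintype ι] (F : ι → StrongDual ℝ V) (α : ι → ℝ) {M M' : ℝ} (hM : 0 ≤ M)
    (hMM' : M < M') (h : ∀ c : ι → ℝ, |∑ i, c i * α i| ≤ M * ‖∑ i, c i • F i‖) :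
    ∃ v, ‖v‖ ≤ M' ∧ ∀ i, F i v = α i := by
  classical
  let Λ : V →L[ℝ] (ι → ℝ) := ContinuousLinearMap.pi F
  have hmem : α ∈ closure (Λ '' Metric.closedBall 0 M) := by
    by_contra hα
    obtain ⟨f, u, hf, hu⟩ := geometric_hahn_banach_closed_point
      ((convex_closedBall (0 : V) M).linear_image Λ.toLinearMap).closure isClosed_closure hα
    let c : ι → ℝ := fun i => f (Pi.single i 1)
    have hfc : ∀ w : ι → ℝ, f w = ∑ i, c i * w i := by
      intro w
      have e : w = ∑ i, w i • (Pi.single i 1 : ι → ℝ) := by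
        ext j
        simp [Finset.sum_apply, Pi.single_apply]
      conv_lhs => rw [e]
      rw [map_sum]
      exact Finset.sum_congr rfl fun i _ => by rw [map_smul, smul_eq_mul, mul_comm]
    have hball : ∀ v : V, ‖v‖ ≤ M → (∑ i, c i • F i) v < u := by
      intro v hv
      have := hf (Λ v) (subset_closure ⟨v, by simpa using hv, rfl⟩)
      rw [hfc] at this
      simpa [Λ] using this
    have hnorm : M * ‖∑ i, c i • F i‖ ≤ u := by
      have hu0 : 0 < u := by simpa using hball 0 (by simpa using hM)
      rcases hM.eq_or_lt with rfl | hM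
      · simpa using hu0.le
      · rw [← le_inv_mul_iff₀ hM]
        refine ContinuousLinearMap.opNorm_le_of_unit_norm (by positivity) fun v hv => ?_
        rw [le_inv_mul_iff₀ hM, Real.norm_eq_abs, ← abs_of_pos hM, ← abs_mul, abs_le]
        have hnv : ‖M • v‖ ≤ M := by rw [norm_smul, hv, mul_one, Real.norm_of_nonneg hM.le]
        have h₁ := hball (M • v) hnv
        have h₂ := hball (-(M • v)) (by rwa [norm_neg])
        rw [map_neg] at h₂
        rw [map_smul, smul_eq_mul] at h₁ h₂
        constructor <;> linarith
    rw [hfc] at hu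
    linarith [(le_abs_self _).trans (h c)]
  have hrange : α ∈ Λ.range := by
    have hcl : IsClosed (Λ.range : Set (ι → ℝ)) := Submodule.closed_of_finiteDimensional _
    refine hcl.closure_subset_iff.2 ?_ hmem
    rintro _ ⟨v, -, rfl⟩
    exact ⟨v, rfl⟩
  have hsurj : Function.Surjective Λ.rangeRestrict := LinearMap.surjective_rangeRestrict _
  obtain ⟨B, hB, hpre⟩ := Λ.rangeRestrict.exists_preimage_norm_le hsurj
  obtain ⟨_, ⟨v, hv, rfl⟩, hdist⟩ := Metric.mem_closure_iff.1 hmem ((M' - M) / B)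
    (div_pos (sub_pos.2 hMM') hB)
  obtain ⟨w, hw, hwB⟩ := hpre (⟨α, hrange⟩ - Λ.rangeRestrict v)
  have hw' : Λ w = α - Λ v := congrArg Subtype.val hw
  refine ⟨v + w, ?_, fun i => ?_⟩
  · have h₁ : ‖v‖ ≤ M := by simpa using hv
    have h₂ : ‖(⟨α, hrange⟩ : Λ.range) - Λ.rangeRestrict v‖ ≤ (M' - M) / B := by
      rw [dist_eq_norm] at hdist
      exact hdist.le
    have h₃ : B * ‖(⟨α, hrange⟩ : Λ.range) - Λ.rangeRestrict v‖ ≤ M' - M := by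
      rwa [le_div_iff₀' hB] at h₂
    linarith [norm_add_le v w]
  · have := congrFun (show Λ (v + w) = α by rw [map_add, hw', add_sub_cancel]) i
    simpa [Λ] using this

end Helly

section Summing

/-- `X` contains arbitrarily long finite sequences, uniformly bounded, on whose spans the tail
summation functionals are uniformly bounded. -/
def HasSummingSequences (X : Type) [NormedAddCommGroup X] [NormedSpace ℝ X] : Prop :=
  ∃ K : ℝ, 0 < K ∧ ∀ N : ℕ, ∃ y : ℕ → X, (∀ i < N, ‖y i‖ ≤ K) ∧
    ∀ (a : ℕ → ℝ), ∀ k ≤ N,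
      |∑ i ∈ Finset.Ico k N, a i| ≤ K * ‖∑ i ∈ Finset.range N, a i • y i‖

/-- The distance to a linear subspace of a dual space controls coefficients. -/
lemma abs_le_inv_mul_norm_smul_add {Z W : Type} [AddCommGroup Z] [Module ℝ Z]
    [NormedAddCommGroup W] [NormedSpace ℝ W] (J : Z →ₗ[ℝ] StrongDual ℝ W) {w : StrongDual ℝ W}
    {d : ℝ} (hd : 0 < d)
    (h : ∀ z, d ≤ ‖w - J z‖) (t : ℝ) (z : Z) : |t| ≤ d⁻¹ * ‖t • w + J z‖ := by
  rcases eq_or_ne t 0 with rfl | ht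
  · simp only [abs_zero]
    positivity
  · have e : t • w + J z = t • (w - J (-(t⁻¹ • z))) := by
      rw [map_neg, map_smul, sub_neg_eq_add, smul_add, smul_smul, mul_inv_cancel₀ ht, one_smul]
    rw [e, norm_smul, Real.norm_eq_abs, le_inv_mul_iff₀ hd, mul_comm]
    gcongr
    exact h _
lemma exists_pos_forall_le_norm_sub {W : Type} [NormedAddCommGroup W] [NormedSpace ℝ W]
    {S : Set (StrongDual ℝ W)} (hS : IsClosed S) (hne : S.Nonempty) {w : StrongDual ℝ W}
    (hw : w ∉ S) : ∃ d : ℝ, 0 < d ∧ ∀ z ∈ S, d ≤ ‖w - z‖ := by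
  refine ⟨Metric.infDist w S, (hS.notMem_iff_infDist_pos hne).1 hw, fun z hz => ?_⟩
  exact (Metric.infDist_le_dist_of_mem hz).trans_eq (dist_eq_norm _ _)

lemma exists_abs_le_mul_norm_smul_add_inclusionInDoubleDual {Z : Type} [NormedAddCommGroup Z]
    [NormedSpace ℝ Z] [CompleteSpace Z] (hZ : ¬ IsReflexiveBanach Z) :
    ∃ Φ : StrongDual ℝ (StrongDual ℝ Z), ∃ M : ℝ, 0 < M ∧ ∀ (t : ℝ) (z : Z),
      |t| ≤ M * ‖t • Φ + NormedSpace.inclusionInDoubleDual ℝ Z z‖ := by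
  simp only [IsReflexiveBanach, Function.Surjective, not_forall] at hZ
  obtain ⟨Φ, hΦ⟩ := hZ
  have hcl : IsClosed (Set.range (NormedSpace.inclusionInDoubleDual ℝ Z)) :=
    (NormedSpace.inclusionInDoubleDualLi ℝ
      (E := Z)).isometry.isUniformInducing.isComplete_range.isClosed
  obtain ⟨d, hd, h⟩ := exists_pos_forall_le_norm_sub hcl (Set.range_nonempty _) hΦ
  exact ⟨Φ, d⁻¹, inv_pos.2 hd, abs_le_inv_mul_norm_smul_add
    (NormedSpace.inclusionInDoubleDual ℝ Z).toLinearMap hd fun z => h _ (Set.mem_range_self z)⟩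

/-- In a nonreflexive Banach space there are arbitrarily long bounded triangular systems. -/
lemma exists_triangular_system {Z : Type} [NormedAddCommGroup Z] [NormedSpace ℝ Z]
    [CompleteSpace Z] (hZ : ¬ IsReflexiveBanach Z) :
    ∃ K : ℝ, 0 < K ∧ ∀ N : ℕ, ∃ (x : ℕ → Z) (f : ℕ → StrongDual ℝ Z),
      (∀ i < N, ‖x i‖ ≤ K) ∧ (∀ i < N, ‖f i‖ ≤ K) ∧
      ∀ i < N, ∀ j < N, f i (x j) = if i ≤ j then 1 else 0 := by
  obtain ⟨Φ, M, hM, hdist⟩ := exists_abs_le_mul_norm_smul_add_inclusionInDoubleDual hZ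
  obtain ⟨K, hK⟩ : ∃ K, K = max M ‖Φ‖ + 1 := ⟨_, rfl⟩
  have hK₁ : M < K := by linarith [le_max_left M ‖Φ‖]
  have hK₂ : ‖Φ‖ < K := by linarith [le_max_right M ‖Φ‖]
  refine ⟨K, hM.trans hK₁, fun N => ?_⟩
  suffices h : ∃ (x : ℕ → Z) (f : ℕ → StrongDual ℝ Z),
      (∀ i < N, ‖x i‖ ≤ K) ∧ (∀ i < N, ‖f i‖ ≤ K) ∧ (∀ i < N, Φ (f i) = 1) ∧
      ∀ i < N, ∀ j < N, f i (x j) = if i ≤ j then 1 else 0 by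
    obtain ⟨x, f, hx, hf, -, hxf⟩ := h
    exact ⟨x, f, hx, hf, hxf⟩
  induction N with
  | zero => exact ⟨0, 0, by simp, by simp, by simp, by simp⟩
  | succ N ih =>
    obtain ⟨x, f, hx, hf, hΦf, hxf⟩ := ih
    obtain ⟨g, hg, hgx⟩ := exists_norm_le_apply_eq
      (fun o : Option (Fin N) => o.elim Φ fun j => NormedSpace.inclusionInDoubleDual ℝ Z (x j))
      (fun o => o.elim 1 fun _ => 0) hM.le hK₁ (fun c => by
        have := hdist (c none) (∑ j : Fin N, c (some j) • x j)
        simpa [Fintype.sum_option, map_sum, map_smul] using this)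
    have hΦg : Φ g = 1 := hgx none
    have hgx' : ∀ j < N, g (x j) = 0 := fun j hj => hgx (some ⟨j, hj⟩)
    have hΦf' : ∀ i : Fin (N + 1), Φ (if (i : ℕ) < N then f i else g) = 1 := by
      intro i
      split_ifs with hi
      · exact hΦf i hi
      · exact hΦg
    obtain ⟨z, hz, hfz⟩ := exists_norm_le_apply_eq
      (fun i : Fin (N + 1) => if (i : ℕ) < N then f i else g) (fun _ => 1) (norm_nonneg Φ) hK₂
      (fun c => by
        have := Φ.le_opNorm (∑ i : Fin (N + 1), c i • (if (i : ℕ) < N then f i else g))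
        simp only [map_sum, map_smul, hΦf', Real.norm_eq_abs, smul_eq_mul] at this
        exact this)
    have hfz' : ∀ i < N, f i z = 1 := by
      intro i hi
      simpa [hi] using hfz ⟨i, hi.trans (Nat.lt_succ_self N)⟩
    have hgz : g z = 1 := by simpa using hfz ⟨N, Nat.lt_succ_self N⟩
    refine ⟨fun i => if i < N then x i else z, fun i => if i < N then f i else g, ?_, ?_, ?_, ?_⟩
    · intro i _
      dsimp only
      split_ifs with hi
      exacts [hx i hi, hz]
    · intro i _
      dsimp only
      split_ifs with hi
      exacts [hf i hi, hg]
    · intro i _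
      dsimp only
      split_ifs with hi
      exacts [hΦf i hi, hΦg]
    · intro i hi j hj
      by_cases hiN : i < N <;> by_cases hjN : j < N
      · simpa [hiN, hjN] using hxf i hiN j hjN
      · have : i ≤ j := by omega
        simpa [hiN, hjN, this] using hfz' i hiN
      · have : ¬ i ≤ j := by omega
        simpa [hiN, hjN, this] using hgx' j hjN
      · have : i ≤ j := by omega
        simpa [hiN, hjN, this] using hgz

variable {X : Type} [NormedAddCommGroup X] [NormedSpace ℝ X]

lemma hasSummingSequences_of_not_superReflexive (h : ¬ SuperReflexive X) :
    HasSummingSequences X := by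
  simp only [SuperReflexive, not_forall] at h
  obtain ⟨Z, _, _, _, hfr, hZ⟩ := h
  obtain ⟨K, hK, hsys⟩ := exists_triangular_system hZ
  refine ⟨2 * K, by positivity, fun N => ?_⟩
  obtain ⟨x, f, hx, hf, hxf⟩ := hsys N
  let F : Submodule ℝ Z := Submodule.span ℝ (x '' Set.Iio N)
  have hF : FiniteDimensional ℝ F := FiniteDimensional.span_of_finite ℝ
    ((Set.finite_Iio N).image x)
  obtain ⟨G, -, T, hT⟩ := hfr 1 one_pos F hF
  have hxF : ∀ i < N, x i ∈ F := fun i hi => Submodule.subset_span ⟨i, hi, rfl⟩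
  let x' : ℕ → F := fun i => if hi : i < N then ⟨x i, hxF i hi⟩ else 0
  have hx' : ∀ i < N, (x' i : Z) = x i := fun i hi => by simp [x', hi]
  obtain ⟨s, hs⟩ : ∃ s, s = ‖(T.symm : G →L[ℝ] F)‖ := ⟨_, rfl⟩
  have hs0 : 0 ≤ s := hs ▸ (T.symm : G →L[ℝ] F).opNorm_nonneg
  rw [← hs] at hT
  refine ⟨fun i => s • (T (x' i) : X), fun i hi => ?_, fun a k hk => ?_⟩
  · have h₁ : ‖(T (x' i) : X)‖ ≤ ‖(T : F →L[ℝ] G)‖ * ‖x' i‖ :=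
      (T : F →L[ℝ] G).le_opNorm (x' i)
    have h₂ : ‖x' i‖ ≤ K := by
      have hx'' := hx i hi
      rw [← hx' i hi] at hx''
      exact hx''
    rw [norm_smul, Real.norm_of_nonneg hs0]
    calc s * ‖(T (x' i) : X)‖ ≤ s * (‖(T : F →L[ℝ] G)‖ * K) := by
          refine mul_le_mul_of_nonneg_left (h₁.trans ?_) hs0
          gcongr
      _ = (‖(T : F →L[ℝ] G)‖ * s) * K := by ring
      _ ≤ 2 * K := by
          gcongr
          linarith
  · have hsum : ‖∑ i ∈ Finset.range N, a i • x i‖ ≤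
        ‖∑ i ∈ Finset.range N, a i • s • (T (x' i) : X)‖ := by
      have e₁ : ∑ i ∈ Finset.range N, a i • x i =
          ((∑ i ∈ Finset.range N, a i • x' i : F) : Z) := by
        push_cast
        exact Finset.sum_congr rfl fun i hi => by rw [hx' i (Finset.mem_range.1 hi)]
      have e₂ : ∑ i ∈ Finset.range N, a i • s • (T (x' i) : X) =
          s • ((T (∑ i ∈ Finset.range N, a i • x' i) : G) : X) := by
        rw [map_sum]
        push_cast
        rw [Finset.smul_sum]
        exact Finset.sum_congr rfl fun i _ => by
          rw [map_smul, Submodule.coe_smul, smul_comm]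
      rw [e₁, e₂, norm_smul, Real.norm_of_nonneg hs0]
      have := (T.symm : G →L[ℝ] F).le_opNorm (T (∑ i ∈ Finset.range N, a i • x' i))
      rw [← hs] at this
      simpa using this
    rcases hk.eq_or_lt with rfl | hk
    · rw [Finset.Ico_self, Finset.sum_empty, abs_zero]
      positivity
    · have e : f k (∑ i ∈ Finset.range N, a i • x i) = ∑ i ∈ Finset.Ico k N, a i := by
        rw [map_sum, Finset.range_eq_Ico, ← Finset.sum_Ico_consecutive _ (Nat.zero_le k) hk.le,
          Finset.sum_eq_zero, zero_add]
        · refine Finset.sum_congr rfl fun i hi => ?_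
          rw [Finset.mem_Ico] at hi
          rw [map_smul, hxf k hk i hi.2, if_pos hi.1, smul_eq_mul, mul_one]
        · intro i hi
          rw [Finset.mem_Ico] at hi
          rw [map_smul, hxf k hk i (by omega), if_neg (by omega), smul_zero]
      rw [← e, ← Real.norm_eq_abs]
      calc _ ≤ K * ‖∑ i ∈ Finset.range N, a i • x i‖ := (f k).le_of_opNorm_le (hf k hk) _
        _ ≤ 2 * K * ‖∑ i ∈ Finset.range N, a i • s • (T (x' i) : X)‖ := by
          nlinarith [norm_nonneg (∑ i ∈ Finset.range N, a i • x i)]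

end Summing

section Coding

variable {V : Type}

/-- Partial sums of integer codes of vertices. -/
def codeSum (F : V → ℕ → ℤ) (p : V) (k : ℕ) : ℤ := ∑ i ∈ Finset.range k, F p i

/-- An edge along which the code increases by one in the coordinate `i`. -/
def Ascends (G : SimpleGraph V) (F : V → ℕ → ℤ) (i : ℕ) (u v : V) : Prop :=
  G.Adj u v ∧ ∀ m, F v m = F u m + if m = i then 1 else 0

/-- The distance from `p` to `q` is at most the increase of the code. -/
def Precedes (G : SimpleGraph V) (F : V → ℕ → ℤ) (N : ℕ) (p q : V) : Prop :=
  (G.dist p q : ℤ) ≤ codeSum F q N - codeSum F p N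

/-- The vertex `p` lies on a monotone path of length `2 * l` from `t` to `s` whose code increases
first in the `l` coordinates after `k` and then in the next `l` coordinates. -/
structure OnFirstSide (G : SimpleGraph V) (F : V → ℕ → ℤ) (N : ℕ) (t s : V) (k l : ℕ) (p : V) :
    Prop where
  left : Precedes G F N t p
  right : Precedes G F N p s
  length : codeSum F s N - codeSum F t N = 2 * l
  code : codeSum F p (k + l) - codeSum F p k - (codeSum F t (k + l) - codeSum F t k) =
    min (codeSum F p N - codeSum F t N) l
  code' : codeSum F p (k + 2 * l) - codeSum F p (k + l) -
    (codeSum F t (k + 2 * l) - codeSum F t (k + l)) = max (codeSum F p N - codeSum F t N - l) 0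

/-- The vertex `p` lies on a monotone path of length `2 * l` from `t` to `s` whose code increases
in the `l` coordinates after `k` only after increasing in the next `l` coordinates. -/
structure OnSecondSide (G : SimpleGraph V) (F : V → ℕ → ℤ) (N : ℕ) (t s : V) (k l : ℕ) (p : V) :
    Prop where
  left : Precedes G F N t p
  right : Precedes G F N p s
  length : codeSum F s N - codeSum F t N = 2 * l
  code : codeSum F p (k + l) - codeSum F p k - (codeSum F t (k + l) - codeSum F t k) =
    max (codeSum F p N - codeSum F t N - l) 0
  code' : codeSum F p (k + 2 * l) - codeSum F p (k + l) -
    (codeSum F t (k + 2 * l) - codeSum F t (k + l)) = min (codeSum F p N - codeSum F t N) l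

/-- Two edges lie on the two sides of a diamond. -/
def OppositeEdges (G : SimpleGraph V) (F : V → ℕ → ℤ) (N : ℕ) (u₀ u₁ w₀ w₁ : V) : Prop :=
  ∃ (t s : V) (k l : ℕ), k + 2 * l ≤ N ∧
    OnFirstSide G F N t s k l u₀ ∧ OnFirstSide G F N t s k l u₁ ∧
    OnSecondSide G F N t s k l w₀ ∧ OnSecondSide G F N t s k l w₁

/-- An integer coding of the vertices of a graph in which any two ascending edges are equal,
comparable, or on opposite sides of a diamond. -/
structure IsCoding (G : SimpleGraph V) (N : ℕ) (F : V → ℕ → ℤ) : Prop where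
  connected : G.Connected
  exists_adj : ∀ v, ∃ w, G.Adj v w
  ascends : ∀ u v, G.Adj u v → ∃ i < N, Ascends G F i u v ∨ Ascends G F i v u
  edges : ∀ i < N, ∀ j < N, ∀ u₀ u₁ w₀ w₁, Ascends G F i u₀ u₁ → Ascends G F j w₀ w₁ →
    (u₀ = w₀ ∧ u₁ = w₁) ∨ Precedes G F N u₁ w₀ ∨ Precedes G F N w₁ u₀ ∨
      OppositeEdges G F N u₀ u₁ w₀ w₁ ∨ OppositeEdges G F N w₀ w₁ u₀ u₁

section Basic

variable {G : SimpleGraph V} {F : V → ℕ → ℤ} {N : ℕ}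

lemma Precedes.refl (p : V) : Precedes G F N p p := by
  simp [Precedes]

lemma Precedes.trans (hG : G.Connected) {p q s : V} (h : Precedes G F N p q)
    (h' : Precedes G F N q s) : Precedes G F N p s := by
  have := hG.dist_triangle (u := p) (v := q) (w := s)
  unfold Precedes at *
  omega

lemma Ascends.codeSum_eq {i : ℕ} {u v : V} (h : Ascends G F i u v) (k : ℕ) :
    codeSum F v k = codeSum F u k + if i < k then 1 else 0 := by
  simp only [codeSum, h.2, Finset.sum_add_distrib, Finset.sum_ite_eq', Finset.mem_range]

lemma Ascends.precedes {i : ℕ} (hi : i < N) {u v : V} (h : Ascends G F i u v) :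
    Precedes G F N u v := by
  rw [Precedes, h.codeSum_eq, if_pos hi, SimpleGraph.dist_eq_one_iff_adj.2 h.1]
  simp

lemma Ascends.not_ascends {i j : ℕ} {u v : V} (h : Ascends G F i u v) : ¬ Ascends G F j v u := by
  intro h'
  have h₁ := h.2 i
  have h₂ := h'.2 i
  split_ifs at h₁ h₂ <;> omega

end Basic

section Step

variable {G : SimpleGraph V} {F : V → ℕ → ℤ} {N : ℕ}

/-- The coding of the vertices of `laaksoStep G` induced by a coding of the vertices of `G`: each
coordinate is replaced by four coordinates. -/
def stepCode (G : SimpleGraph V) (F : V → ℕ → ℤ) :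
    V ⊕ ({p : V × V // G.Adj p.1 p.2} × Bool) → ℕ → ℤ
  | Sum.inl u, m => F u (m / 4)
  | Sum.inr (p, b), m =>
    if m % 4 = 0 then max (F p.1.1 (m / 4)) (F p.1.2 (m / 4))
    else if m % 4 = 3 then min (F p.1.1 (m / 4)) (F p.1.2 (m / 4))
    else if m % 4 = 1 ∧ b = true then F p.1.2 (m / 4)
    else F p.1.1 (m / 4)

/-- The edges of the copy of `L₁` replacing an edge, directed from its first endpoint to its second
endpoint. The number `r` is the position, among the four new coordinates, of the coordinate in which
the code of `stepCode` increases. -/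
inductive StepEdge {u v : V} (h : G.Adj u v) : ℕ →
    V ⊕ ({p : V × V // G.Adj p.1 p.2} × Bool) → V ⊕ ({p : V × V // G.Adj p.1 p.2} × Bool) → Prop
  | first : StepEdge h 0 (Sum.inl u) (outerVertex h)
  | second : StepEdge h 1 (outerVertex h) (middleVertex h)
  | second' : StepEdge h 2 (outerVertex h) (middleVertex h.symm)
  | third : StepEdge h 2 (middleVertex h) (outerVertex h.symm)
  | third' : StepEdge h 1 (middleVertex h.symm) (outerVertex h.symm)
  | fourth : StepEdge h 3 (outerVertex h.symm) (Sum.inl v)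

lemma sum_range_four_mul (g : ℕ → ℤ) (k : ℕ) : ∑ m ∈ Finset.range (4 * k), g m =
    ∑ i ∈ Finset.range k, (g (4 * i) + g (4 * i + 1) + g (4 * i + 2) + g (4 * i + 3)) := by
  induction k with
  | zero => simp
  | succ k ih =>
    rw [mul_add, mul_one, Finset.sum_range_succ, Finset.sum_range_succ, Finset.sum_range_succ,
      Finset.sum_range_succ, Finset.sum_range_succ, ih]
    ring

lemma four_mul_add_div_mod (i : ℕ) : 4 * i / 4 = i ∧ (4 * i + 1) / 4 = i ∧ (4 * i + 2) / 4 = i ∧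
    (4 * i + 3) / 4 = i ∧ 4 * i % 4 = 0 ∧ (4 * i + 1) % 4 = 1 ∧ (4 * i + 2) % 4 = 2 ∧
    (4 * i + 3) % 4 = 3 := by
  omega

lemma codeSum_stepCode_inl (u : V) (k : ℕ) :
    codeSum (stepCode G F) (Sum.inl u) (4 * k) = 4 * codeSum F u k := by
  rw [codeSum, sum_range_four_mul, codeSum, Finset.mul_sum]
  refine Finset.sum_congr rfl fun i _ => ?_
  obtain ⟨h₀, h₁, h₂, h₃, -⟩ := four_mul_add_div_mod i
  simp only [stepCode, h₀, h₁, h₂, h₃]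
  ring

lemma codeSum_stepCode_outerVertex {u v : V} (h : G.Adj u v) (k : ℕ) :
    codeSum (stepCode G F) (outerVertex h) (4 * k) = 3 * codeSum F u k + codeSum F v k := by
  rw [codeSum, sum_range_four_mul, codeSum, codeSum, Finset.mul_sum, ← Finset.sum_add_distrib]
  refine Finset.sum_congr rfl fun i _ => ?_
  obtain ⟨h₀, h₁, h₂, h₃, k₀, k₁, k₂, k₃⟩ := four_mul_add_div_mod i
  simp only [stepCode, outerVertex, h₀, h₁, h₂, h₃, k₀, k₁, k₂, k₃]
  have := max_add_min (F u i) (F v i)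
  simp
  linarith

lemma codeSum_stepCode_middleVertex {u v : V} (h : G.Adj u v) (k : ℕ) :
    codeSum (stepCode G F) (middleVertex h) (4 * k) =
      2 * codeSum F u k + 2 * codeSum F v k := by
  rw [codeSum, sum_range_four_mul, codeSum, codeSum, Finset.mul_sum, Finset.mul_sum,
    ← Finset.sum_add_distrib]
  refine Finset.sum_congr rfl fun i _ => ?_
  obtain ⟨h₀, h₁, h₂, h₃, k₀, k₁, k₂, k₃⟩ := four_mul_add_div_mod i
  simp only [stepCode, middleVertex, h₀, h₁, h₂, h₃, k₀, k₁, k₂, k₃]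
  have := max_add_min (F u i) (F v i)
  simp
  linarith

lemma StepEdge.adj {u v : V} {h : G.Adj u v} {r : ℕ}
    {x y : V ⊕ ({p : V × V // G.Adj p.1 p.2} × Bool)} (hxy : StepEdge h r x y) :
    (laaksoStep G).Adj x y := by
  cases hxy with
  | first => exact laaksoStep_adj_inl h
  | second => exact laaksoStep_adj_middle h
  | second' => exact laaksoStep_adj_middle_symm h
  | third => exact (laaksoStep_adj_middle_symm h.symm).symm
  | third' => exact (laaksoStep_adj_middle h.symm).symm
  | fourth => exact (laaksoStep_adj_inl h.symm).symm

lemma StepEdge.lt_four {u v : V} {h : G.Adj u v} {r : ℕ}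
    {x y : V ⊕ ({p : V × V // G.Adj p.1 p.2} × Bool)} (hxy : StepEdge h r x y) : r < 4 := by
  cases hxy <;> norm_num

lemma exists_stepEdge (hF : IsCoding G N F) : ∀ x y, (laaksoStep G).Adj x y →
    ∃ i < N, ∃ (u v : V) (h : Ascends G F i u v) (r : ℕ),
      StepEdge h.1 r x y ∨ StepEdge h.1 r y x := by
  refine laaksoStep_adj_induction ?_ ?_ ?_ ?_
  · rintro x y ⟨i, hi, u, v, h, r, hxy⟩
    exact ⟨i, hi, u, v, h, r, hxy.symm⟩
  · intro u v h
    obtain ⟨i, hi, hasc | hasc⟩ := hF.ascends u v h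
    · exact ⟨i, hi, u, v, hasc, _, Or.inl .first⟩
    · exact ⟨i, hi, v, u, hasc, _, Or.inr .fourth⟩
  · intro u v h
    obtain ⟨i, hi, hasc | hasc⟩ := hF.ascends u v h
    · exact ⟨i, hi, u, v, hasc, _, Or.inl .second⟩
    · exact ⟨i, hi, v, u, hasc, _, Or.inr .third'⟩
  · intro u v h
    obtain ⟨i, hi, hasc | hasc⟩ := hF.ascends u v h
    · exact ⟨i, hi, u, v, hasc, _, Or.inl .second'⟩
    · exact ⟨i, hi, v, u, hasc, _, Or.inr .third⟩

lemma stepCode_apply_of_div_ne {i : ℕ} {u v : V} (h : Ascends G F i u v) {m : ℕ} (hm : m / 4 ≠ i) :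
    stepCode G F (Sum.inl u) m = F u (m / 4) ∧ stepCode G F (Sum.inl v) m = F u (m / 4) ∧
    stepCode G F (outerVertex h.1) m = F u (m / 4) ∧
    stepCode G F (outerVertex h.1.symm) m = F u (m / 4) ∧
    stepCode G F (middleVertex h.1) m = F u (m / 4) ∧
    stepCode G F (middleVertex h.1.symm) m = F u (m / 4) := by
  have hv : F v (m / 4) = F u (m / 4) := by rw [h.2, if_neg hm, add_zero]
  simp [stepCode, outerVertex, middleVertex, hv]

lemma StepEdge.ascends {i : ℕ} {u v : V} (h : Ascends G F i u v) {r : ℕ}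
    {x y : V ⊕ ({p : V × V // G.Adj p.1 p.2} × Bool)} (hxy : StepEdge h.1 r x y) :
    Ascends (laaksoStep G) (stepCode G F) (4 * i + r) x y := by
  obtain ⟨h₀, h₁, h₂, h₃, k₀, k₁, k₂, k₃⟩ := four_mul_add_div_mod i
  have hadj := hxy.adj
  have hr := hxy.lt_four
  have hv : F v i = F u i + 1 := by simp [h.2]
  suffices hm : ∀ r' < 4, stepCode G F y (4 * i + r') =
      stepCode G F x (4 * i + r') + if 4 * i + r' = 4 * i + r then 1 else 0 by
    refine ⟨hadj, fun m => ?_⟩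
    by_cases hi : m / 4 = i
    · have := hm (m % 4) (Nat.mod_lt _ (by norm_num))
      rwa [show 4 * i + m % 4 = m by omega] at this
    · have hne : m ≠ 4 * i + r := by omega
      obtain ⟨e₁, e₂, e₃, e₄, e₅, e₆⟩ := stepCode_apply_of_div_ne h hi
      clear hr
      cases hxy <;> simp_all
  intro r' hr'
  cases hxy <;> interval_cases r' <;> simp [stepCode, outerVertex, middleVertex, *]

end Step

end Coding

section Coding

variable {V : Type} {G : SimpleGraph V} {F : V → ℕ → ℤ} {N : ℕ}

/-- The vertex `x` of `laaksoStep G` lies on a monotone path replacing the edge `uv`. -/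
structure OnReplacedEdge (G : SimpleGraph V) (F : V → ℕ → ℤ) (N : ℕ) (u v : V)
    (x : V ⊕ ({p : V × V // G.Adj p.1 p.2} × Bool)) : Prop where
  left : Precedes (laaksoStep G) (stepCode G F) (4 * N) (Sum.inl u) x
  right : Precedes (laaksoStep G) (stepCode G F) (4 * N) x (Sum.inl v)
  code : ∃ j : ℤ, 0 ≤ j ∧ j ≤ 4 ∧ ∀ k, codeSum (stepCode G F) x (4 * k) =
    (4 - j) * codeSum F u k + j * codeSum F v k

lemma StepEdge.precedes {i : ℕ} (hi : i < N) {u v : V} (h : Ascends G F i u v) {r : ℕ}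
    {x y : V ⊕ ({p : V × V // G.Adj p.1 p.2} × Bool)} (hxy : StepEdge h.1 r x y) :
    Precedes (laaksoStep G) (stepCode G F) (4 * N) x y :=
  (hxy.ascends h).precedes (by have := hxy.lt_four; omega)

lemma StepEdge.onReplacedEdge (hG : G.Connected) {i : ℕ} (hi : i < N) {u v : V}
    (h : Ascends G F i u v) {r : ℕ} {x y : V ⊕ ({p : V × V // G.Adj p.1 p.2} × Bool)}
    (hxy : StepEdge h.1 r x y) : OnReplacedEdge G F N u v x ∧ OnReplacedEdge G F N u v y := by
  have hc := laaksoStep_connected hG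
  have e₁ := StepEdge.precedes hi h .first
  have e₂ := StepEdge.precedes hi h .second
  have e₃ := StepEdge.precedes hi h .second'
  have e₄ := StepEdge.precedes hi h .third
  have e₅ := StepEdge.precedes hi h .third'
  have e₆ := StepEdge.precedes hi h .fourth
  have hl : OnReplacedEdge G F N u v (Sum.inl u) :=
    ⟨.refl _, e₁.trans hc (e₂.trans hc (e₄.trans hc e₆)), 0, by norm_num, by norm_num, fun k => by
      rw [codeSum_stepCode_inl]; ring⟩
  have hr : OnReplacedEdge G F N u v (Sum.inl v) :=
    ⟨e₁.trans hc (e₂.trans hc (e₄.trans hc e₆)), .refl _, 4, by norm_num, by norm_num, fun k => by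
      rw [codeSum_stepCode_inl]; ring⟩
  have ho : OnReplacedEdge G F N u v (outerVertex h.1) :=
    ⟨e₁, e₂.trans hc (e₄.trans hc e₆), 1, by norm_num, by norm_num, fun k => by
      rw [codeSum_stepCode_outerVertex]; ring⟩
  have ho' : OnReplacedEdge G F N u v (outerVertex h.1.symm) :=
    ⟨e₁.trans hc (e₂.trans hc e₄), e₆, 3, by norm_num, by norm_num, fun k => by
      rw [codeSum_stepCode_outerVertex]; ring⟩
  have hm : OnReplacedEdge G F N u v (middleVertex h.1) :=
    ⟨e₁.trans hc e₂, e₄.trans hc e₆, 2, by norm_num, by norm_num, fun k => by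
      rw [codeSum_stepCode_middleVertex]; ring⟩
  have hm' : OnReplacedEdge G F N u v (middleVertex h.1.symm) :=
    ⟨e₁.trans hc e₃, e₅.trans hc e₆, 2, by norm_num, by norm_num, fun k => by
      rw [codeSum_stepCode_middleVertex]; ring⟩
  cases hxy <;> exact ⟨‹_›, ‹_›⟩

lemma Precedes.step (hG : G.Connected) {p q : V} (h : Precedes G F N p q) :
    Precedes (laaksoStep G) (stepCode G F) (4 * N) (Sum.inl p) (Sum.inl q) := by
  have := laaksoStep_dist_inl_le hG p q
  unfold Precedes at *
  rw [codeSum_stepCode_inl, codeSum_stepCode_inl]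
  omega

lemma OnFirstSide.step (hG : G.Connected) {i : ℕ} (hi : i < N) {t s u v : V} {k l : ℕ}
    (h : Ascends G F i u v) (hu : OnFirstSide G F N t s k l u) (hv : OnFirstSide G F N t s k l v)
    {x : V ⊕ ({p : V × V // G.Adj p.1 p.2} × Bool)} (hx : OnReplacedEdge G F N u v x) :
    OnFirstSide (laaksoStep G) (stepCode G F) (4 * N) (Sum.inl t) (Sum.inl s) (4 * k) (4 * l) x := by
  have hc := laaksoStep_connected hG
  obtain ⟨j, hj, hj', hcode⟩ := hx.code
  have u₁ := hu.code
  have u₂ := hu.code'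
  have v₁ := hv.code
  have v₂ := hv.code'
  have hl := hu.length
  have hN : codeSum F v N = codeSum F u N + 1 := by rw [h.codeSum_eq, if_pos hi]
  refine ⟨(hu.left.step hG).trans hc hx.left, hx.right.trans hc (hv.right.step hG), ?_, ?_, ?_⟩ <;>
  simp only [← mul_add, mul_left_comm 2 4, hcode, codeSum_stepCode_inl] <;>
  interval_cases j <;> push_cast <;> omega

lemma OnSecondSide.step (hG : G.Connected) {i : ℕ} (hi : i < N) {t s u v : V} {k l : ℕ}
    (h : Ascends G F i u v) (hu : OnSecondSide G F N t s k l u) (hv : OnSecondSide G F N t s k l v)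
    {x : V ⊕ ({p : V × V // G.Adj p.1 p.2} × Bool)} (hx : OnReplacedEdge G F N u v x) :
    OnSecondSide (laaksoStep G) (stepCode G F) (4 * N) (Sum.inl t) (Sum.inl s) (4 * k) (4 * l)
      x := by
  have hc := laaksoStep_connected hG
  obtain ⟨j, hj, hj', hcode⟩ := hx.code
  have u₁ := hu.code
  have u₂ := hu.code'
  have v₁ := hv.code
  have v₂ := hv.code'
  have hl := hu.length
  have hN : codeSum F v N = codeSum F u N + 1 := by rw [h.codeSum_eq, if_pos hi]
  refine ⟨(hu.left.step hG).trans hc hx.left, hx.right.trans hc (hv.right.step hG), ?_, ?_, ?_⟩ <;>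
  simp only [← mul_add, mul_left_comm 2 4, hcode, codeSum_stepCode_inl] <;>
  interval_cases j <;> push_cast <;> omega

lemma OppositeEdges.step (hG : G.Connected) {i j : ℕ} (hi : i < N) (hj : j < N) {u v u' v' : V}
    (h : Ascends G F i u v) (h' : Ascends G F j u' v') (huv : OppositeEdges G F N u v u' v')
    {x y x' y' : V ⊕ ({p : V × V // G.Adj p.1 p.2} × Bool)}
    (hx : OnReplacedEdge G F N u v x) (hy : OnReplacedEdge G F N u v y)
    (hx' : OnReplacedEdge G F N u' v' x') (hy' : OnReplacedEdge G F N u' v' y') :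
    OppositeEdges (laaksoStep G) (stepCode G F) (4 * N) x y x' y' := by
  obtain ⟨t, s, k, l, hkl, hu, hv, hu', hv'⟩ := huv
  exact ⟨_, _, 4 * k, 4 * l, by omega, hu.step hG hi h hv hx, hu.step hG hi h hv hy,
    hu'.step hG hj h' hv' hx', hu'.step hG hj h' hv' hy'⟩

lemma onSide_laaksoStep (hG : G.Connected) {i : ℕ} (hi : i < N) {u v : V} (h : Ascends G F i u v) :
    (∀ x ∈ ({outerVertex h.1, middleVertex h.1, outerVertex h.1.symm} : Set _),
      OnFirstSide (laaksoStep G) (stepCode G F) (4 * N) (outerVertex h.1)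
        (outerVertex h.1.symm) (4 * i + 1) 1 x) ∧
    ∀ x ∈ ({outerVertex h.1, middleVertex h.1.symm, outerVertex h.1.symm} : Set _),
      OnSecondSide (laaksoStep G) (stepCode G F) (4 * N) (outerVertex h.1)
        (outerVertex h.1.symm) (4 * i + 1) 1 x := by
  have e₂ := StepEdge.precedes hi h .second
  have e₃ := StepEdge.precedes hi h .second'
  have e₄ := StepEdge.precedes hi h .third
  have e₅ := StepEdge.precedes hi h .third'
  have e₇ := e₂.trans (laaksoStep_connected hG) e₄
  have refl := Precedes.refl (G := laaksoStep G) (F := stepCode G F) (N := 4 * N)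
  have a₂ := (StepEdge.ascends h .second).codeSum_eq
  have a₃ := (StepEdge.ascends h .second').codeSum_eq
  have a₄ := (StepEdge.ascends h .third).codeSum_eq
  have lt₁ : 4 * i + 1 < 4 * N := by omega
  have lt₂ : 4 * i + 2 < 4 * N := by omega
  have f₁ : OnFirstSide (laaksoStep G) (stepCode G F) (4 * N) (outerVertex h.1)
      (outerVertex h.1.symm) (4 * i + 1) 1 (outerVertex h.1) := by
    refine ⟨refl _, e₇, ?_, ?_, ?_⟩ <;> simp [a₄, a₂, lt₁, lt₂, add_assoc]
  have f₂ : OnFirstSide (laaksoStep G) (stepCode G F) (4 * N) (outerVertex h.1)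
      (outerVertex h.1.symm) (4 * i + 1) 1 (middleVertex h.1) := by
    refine ⟨e₂, e₄, f₁.length, ?_, ?_⟩ <;> simp [a₂, lt₁]
  have f₃ : OnFirstSide (laaksoStep G) (stepCode G F) (4 * N) (outerVertex h.1)
      (outerVertex h.1.symm) (4 * i + 1) 1 (outerVertex h.1.symm) := by
    refine ⟨e₇, refl _, f₁.length, ?_, ?_⟩ <;> simp [a₄, a₂, lt₁, lt₂, add_assoc]; omega
  have g₁ : OnSecondSide (laaksoStep G) (stepCode G F) (4 * N) (outerVertex h.1)
      (outerVertex h.1.symm) (4 * i + 1) 1 (outerVertex h.1) := by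
    refine ⟨refl _, e₇, f₁.length, ?_, ?_⟩ <;> simp
  have g₂ : OnSecondSide (laaksoStep G) (stepCode G F) (4 * N) (outerVertex h.1)
      (outerVertex h.1.symm) (4 * i + 1) 1 (middleVertex h.1.symm) := by
    refine ⟨e₃, e₅, f₁.length, ?_, ?_⟩ <;> simp [a₃, lt₂]
  have g₃ : OnSecondSide (laaksoStep G) (stepCode G F) (4 * N) (outerVertex h.1)
      (outerVertex h.1.symm) (4 * i + 1) 1 (outerVertex h.1.symm) := by
    refine ⟨e₇, refl _, f₁.length, ?_, ?_⟩ <;> simp [a₄, a₂, lt₁, lt₂, add_assoc]; omega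
  constructor
  · rintro x (rfl | rfl | rfl) <;> assumption
  · rintro x (rfl | rfl | rfl) <;> assumption

lemma StepEdge.trichotomy (hG : G.Connected) {i : ℕ} (hi : i < N) {u v : V}
    (h : Ascends G F i u v) {r r' : ℕ} {x y x' y' : V ⊕ ({p : V × V // G.Adj p.1 p.2} × Bool)}
    (hxy : StepEdge h.1 r x y) (hxy' : StepEdge h.1 r' x' y') :
    (x = x' ∧ y = y') ∨ Precedes (laaksoStep G) (stepCode G F) (4 * N) y x' ∨
      Precedes (laaksoStep G) (stepCode G F) (4 * N) y' x ∨
      OppositeEdges (laaksoStep G) (stepCode G F) (4 * N) x y x' y' ∨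
      OppositeEdges (laaksoStep G) (stepCode G F) (4 * N) x' y' x y := by
  have e₂ := StepEdge.precedes hi h .second
  have e₃ := StepEdge.precedes hi h .second'
  have e₄ := StepEdge.precedes hi h .third
  have e₅ := StepEdge.precedes hi h .third'
  have e₇ := e₂.trans (laaksoStep_connected hG) e₄
  have refl := Precedes.refl (G := laaksoStep G) (F := stepCode G F) (N := 4 * N)
  obtain ⟨hf, hs⟩ := onSide_laaksoStep hG hi h
  have f₁ := hf _ (by simp : outerVertex h.1 ∈ _)
  have f₂ := hf _ (by simp : middleVertex h.1 ∈ _)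
  have f₃ := hf _ (by simp : outerVertex h.1.symm ∈ _)
  have g₁ := hs _ (by simp : outerVertex h.1 ∈ _)
  have g₂ := hs _ (by simp : middleVertex h.1.symm ∈ _)
  have g₃ := hs _ (by simp : outerVertex h.1.symm ∈ _)
  clear hf hs
  have hle : 4 * i + 1 + 2 * 1 ≤ 4 * N := by omega
  have o₁ : OppositeEdges (laaksoStep G) (stepCode G F) (4 * N) (outerVertex h.1)
      (middleVertex h.1) (outerVertex h.1) (middleVertex h.1.symm) :=
    ⟨_, _, _, _, hle, f₁, f₂, g₁, g₂⟩
  have o₂ : OppositeEdges (laaksoStep G) (stepCode G F) (4 * N) (outerVertex h.1)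
      (middleVertex h.1) (middleVertex h.1.symm) (outerVertex h.1.symm) :=
    ⟨_, _, _, _, hle, f₁, f₂, g₂, g₃⟩
  have o₃ : OppositeEdges (laaksoStep G) (stepCode G F) (4 * N) (middleVertex h.1)
      (outerVertex h.1.symm) (outerVertex h.1) (middleVertex h.1.symm) :=
    ⟨_, _, _, _, hle, f₂, f₃, g₁, g₂⟩
  have o₄ : OppositeEdges (laaksoStep G) (stepCode G F) (4 * N) (middleVertex h.1)
      (outerVertex h.1.symm) (middleVertex h.1.symm) (outerVertex h.1.symm) :=
    ⟨_, _, _, _, hle, f₂, f₃, g₂, g₃⟩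
  clear f₁ f₂ f₃ g₁ g₂ g₃
  cases hxy with
  | first =>
    cases hxy' with
    | first => exact Or.inl ⟨rfl, rfl⟩
    | second => exact Or.inr (Or.inl (refl _))
    | second' => exact Or.inr (Or.inl (refl _))
    | third => exact Or.inr (Or.inl e₂)
    | third' => exact Or.inr (Or.inl e₃)
    | fourth => exact Or.inr (Or.inl e₇)
  | second =>
    cases hxy' with
    | first => exact Or.inr (Or.inr (Or.inl (refl _)))
    | second => exact Or.inl ⟨rfl, rfl⟩
    | second' => exact Or.inr (Or.inr (Or.inr (Or.inl o₁)))
    | third => exact Or.inr (Or.inl (refl _))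
    | third' => exact Or.inr (Or.inr (Or.inr (Or.inl o₂)))
    | fourth => exact Or.inr (Or.inl e₄)
  | second' =>
    cases hxy' with
    | first => exact Or.inr (Or.inr (Or.inl (refl _)))
    | second => exact Or.inr (Or.inr (Or.inr (Or.inr o₁)))
    | second' => exact Or.inl ⟨rfl, rfl⟩
    | third => exact Or.inr (Or.inr (Or.inr (Or.inr o₃)))
    | third' => exact Or.inr (Or.inl (refl _))
    | fourth => exact Or.inr (Or.inl e₅)
  | third =>
    cases hxy' with
    | first => exact Or.inr (Or.inr (Or.inl e₂))
    | second => exact Or.inr (Or.inr (Or.inl (refl _)))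
    | second' => exact Or.inr (Or.inr (Or.inr (Or.inl o₃)))
    | third => exact Or.inl ⟨rfl, rfl⟩
    | third' => exact Or.inr (Or.inr (Or.inr (Or.inl o₄)))
    | fourth => exact Or.inr (Or.inl (refl _))
  | third' =>
    cases hxy' with
    | first => exact Or.inr (Or.inr (Or.inl e₃))
    | second => exact Or.inr (Or.inr (Or.inr (Or.inr o₂)))
    | second' => exact Or.inr (Or.inr (Or.inl (refl _)))
    | third => exact Or.inr (Or.inr (Or.inr (Or.inr o₄)))
    | third' => exact Or.inl ⟨rfl, rfl⟩
    | fourth => exact Or.inr (Or.inl (refl _))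
  | fourth =>
    cases hxy' with
    | first => exact Or.inr (Or.inr (Or.inl e₇))
    | second => exact Or.inr (Or.inr (Or.inl e₄))
    | second' => exact Or.inr (Or.inr (Or.inl e₅))
    | third => exact Or.inr (Or.inr (Or.inl (refl _)))
    | third' => exact Or.inr (Or.inr (Or.inl (refl _)))
    | fourth => exact Or.inl ⟨rfl, rfl⟩

lemma exists_stepEdge_of_ascends (hF : IsCoding G N F) {m : ℕ}
    {x y : V ⊕ ({p : V × V // G.Adj p.1 p.2} × Bool)}
    (hxy : Ascends (laaksoStep G) (stepCode G F) m x y) :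
    ∃ i < N, ∃ (u v : V) (h : Ascends G F i u v) (r : ℕ), StepEdge h.1 r x y := by
  obtain ⟨i, hi, u, v, h, r, hr | hr⟩ := exists_stepEdge hF x y hxy.1
  · exact ⟨i, hi, u, v, h, r, hr⟩
  · exact absurd (hr.ascends h) hxy.not_ascends

lemma IsCoding.step (hF : IsCoding G N F) :
    IsCoding (laaksoStep G) (4 * N) (stepCode G F) where
  connected := laaksoStep_connected hF.connected
  exists_adj := by
    rintro (u | ⟨⟨⟨u, v⟩, h⟩, _ | _⟩)
    · obtain ⟨v, h⟩ := hF.exists_adj u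
      exact ⟨_, laaksoStep_adj_inl h⟩
    · exact ⟨_, (laaksoStep_adj_inl h).symm⟩
    · exact ⟨_, (laaksoStep_adj_middle h).symm⟩
  ascends x y hxy := by
    obtain ⟨i, hi, u, v, h, r, hr⟩ := exists_stepEdge hF x y hxy
    refine ⟨4 * i + r, ?_, hr.imp (·.ascends h) (·.ascends h)⟩
    have : r < 4 := hr.elim (·.lt_four) (·.lt_four)
    omega
  edges _ _ _ _ x y x' y' hxy hxy' := by
    have hG := hF.connected
    have hc := laaksoStep_connected hG
    obtain ⟨i, hi, u, v, h, r, hr⟩ := exists_stepEdge_of_ascends hF hxy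
    obtain ⟨i', hi', u', v', h', r', hr'⟩ := exists_stepEdge_of_ascends hF hxy'
    obtain ⟨hx, hy⟩ := hr.onReplacedEdge hG hi h
    obtain ⟨hx', hy'⟩ := hr'.onReplacedEdge hG hi' h'
    obtain ⟨rfl, rfl⟩ | hp | hp | ho | ho := hF.edges i hi i' hi' u v u' v' h h'
    · exact hr.trichotomy hG hi h hr'
    · exact Or.inr (Or.inl (hy.right.trans hc ((hp.step hG).trans hc hx'.left)))
    · exact Or.inr (Or.inr (Or.inl (hy'.right.trans hc ((hp.step hG).trans hc hx.left))))
    · exact Or.inr (Or.inr (Or.inr (Or.inl (ho.step hG hi hi' h h' hx hy hx' hy'))))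
    · exact Or.inr (Or.inr (Or.inr (Or.inr (ho.step hG hi' hi h' h hx' hy' hx hy))))

lemma exists_isCoding : ∀ n, ∃ F : (LaaksoData n).1 → ℕ → ℤ, IsCoding (LaaksoData n).2 (4 ^ n) F
  | 0 => by
    have hadj := laaksoData_zero_adj
    refine ⟨fun b m => Bool.rec 0 (if m = 0 then 1 else 0) b, laaksoData_connected 0, ?_, ?_, ?_⟩
    · rintro (_ | _)
      · exact ⟨true, (hadj _ _).2 (by decide)⟩
      · exact ⟨false, (hadj _ _).2 (by decide)⟩
    · rintro (_ | _) (_ | _) h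
      · exact absurd rfl ((hadj _ _).1 h)
      · exact ⟨0, by simp, Or.inl ⟨h, by simp⟩⟩
      · exact ⟨0, by simp, Or.inr ⟨h.symm, by simp⟩⟩
      · exact absurd rfl ((hadj _ _).1 h)
    · rintro i hi j hj (_ | _) (_ | _) (_ | _) (_ | _) h h'
      all_goals
        first
        | exact Or.inl ⟨rfl, rfl⟩
        | exact absurd rfl ((hadj _ _).1 h.1)
        | exact absurd rfl ((hadj _ _).1 h'.1)
        | have := h.2 0
          simp at this
          omega
        | have := h'.2 0
          simp at this
          omega
  | n + 1 => by
    obtain ⟨F, hF⟩ := exists_isCoding n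
    rw [pow_succ']
    exact ⟨stepCode _ F, hF.step⟩

end Coding

section Embedding

variable {V : Type} {G : SimpleGraph V} {F : V → ℕ → ℤ} {N : ℕ}

lemma IsCoding.exists_ascends (hF : IsCoding G N F) (p : V) :
    ∃ i < N, ∃ u v, Ascends G F i u v ∧ (p = u ∨ p = v) := by
  obtain ⟨q, hpq⟩ := hF.exists_adj p
  obtain ⟨i, hi, h | h⟩ := hF.ascends p q hpq
  · exact ⟨i, hi, p, q, h, Or.inl rfl⟩
  · exact ⟨i, hi, q, p, h, Or.inr rfl⟩

/-- Any two vertices of a graph with a coding are comparable or lie on opposite sides of a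
diamond. -/
lemma IsCoding.precedes_or_onSide (hF : IsCoding G N F) (p q : V) :
    Precedes G F N p q ∨ Precedes G F N q p ∨ ∃ (t s : V) (k l : ℕ), k + 2 * l ≤ N ∧
      (OnFirstSide G F N t s k l p ∧ OnSecondSide G F N t s k l q ∨
        OnFirstSide G F N t s k l q ∧ OnSecondSide G F N t s k l p) := by
  have hG := hF.connected
  obtain ⟨i, hi, u, v, h, hp⟩ := hF.exists_ascends p
  obtain ⟨j, hj, u', v', h', hq⟩ := hF.exists_ascends q
  have huv := h.precedes hi
  have huv' := h'.precedes hj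
  have hup : Precedes G F N u p := by rcases hp with rfl | rfl; exacts [.refl _, huv]
  have hpv : Precedes G F N p v := by rcases hp with rfl | rfl; exacts [huv, .refl _]
  have huq : Precedes G F N u' q := by rcases hq with rfl | rfl; exacts [.refl _, huv']
  have hqv : Precedes G F N q v' := by rcases hq with rfl | rfl; exacts [huv', .refl _]
  obtain ⟨rfl, rfl⟩ | hvu | hvu | ⟨t, s, k, l, hkl, hu, hv, hu', hv'⟩ |
    ⟨t, s, k, l, hkl, hu', hv', hu, hv⟩ := hF.edges i hi j hj u v u' v' h h'
  · rcases hp with rfl | rfl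
    · exact Or.inl huq
    · exact Or.inr (Or.inl hqv)
  · exact Or.inl (hpv.trans hG (hvu.trans hG huq))
  · exact Or.inr (Or.inl (hqv.trans hG (hvu.trans hG hup)))
  · refine Or.inr (Or.inr ⟨t, s, k, l, hkl, Or.inl ⟨?_, ?_⟩⟩)
    · rcases hp with rfl | rfl <;> assumption
    · rcases hq with rfl | rfl <;> assumption
  · refine Or.inr (Or.inr ⟨t, s, k, l, hkl, Or.inr ⟨?_, ?_⟩⟩)
    · rcases hq with rfl | rfl <;> assumption
    · rcases hp with rfl | rfl <;> assumption

lemma OnFirstSide.dist_le (hG : G.Connected) {t s p q : V} {k l : ℕ}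
    (hp : OnFirstSide G F N t s k l p) (hq : OnSecondSide G F N t s k l q) :
    (G.dist p q : ℤ) ≤
      2 * (|codeSum F p (k + l) - codeSum F p k - (codeSum F q (k + l) - codeSum F q k)| +
        |codeSum F p (k + 2 * l) - codeSum F p (k + l) -
          (codeSum F q (k + 2 * l) - codeSum F q (k + l))|) := by
  have t₁ := hG.dist_triangle (u := p) (v := t) (w := q)
  have t₂ := hG.dist_triangle (u := p) (v := s) (w := q)
  rw [G.dist_comm (u := p) (v := t)] at t₁
  rw [G.dist_comm (u := s) (v := q)] at t₂
  have p₁ := hp.left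
  have p₂ := hp.right
  have q₁ := hq.left
  have q₂ := hq.right
  have p₃ := hp.code
  have p₄ := hp.code'
  have q₃ := hq.code
  have q₄ := hq.code'
  have hl := hp.length
  unfold Precedes at p₁ p₂ q₁ q₂
  rw [abs_eq_max_neg, abs_eq_max_neg]
  omega

/-- Tail sums of the difference of two codes control the distance of the vertices. -/
lemma IsCoding.dist_le (hF : IsCoding G N F) {p q : V} {B : ℝ}
    (hB : ∀ k ≤ N, |∑ i ∈ Finset.Ico k N, ((F p i : ℝ) - F q i)| ≤ B) :
    (G.dist p q : ℝ) ≤ 8 * B := by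
  have key : ∀ k ≤ N, |((codeSum F p N - codeSum F q N - (codeSum F p k - codeSum F q k) : ℤ) : ℝ)|
      ≤ B := by
    intro k hk
    convert hB k hk using 2
    rw [Finset.sum_Ico_eq_sub _ hk, Finset.sum_sub_distrib, Finset.sum_sub_distrib]
    simp [codeSum]
  have h₀ := key 0 (Nat.zero_le _)
  have hB₀ : 0 ≤ B := (abs_nonneg _).trans h₀
  have diff : ∀ k ≤ N, ∀ m ≤ N, |((codeSum F p m - codeSum F p k -
      (codeSum F q m - codeSum F q k) : ℤ) : ℝ)| ≤ 2 * B := by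
    intro k hk m hm
    have h₁ := abs_le.1 (key k hk)
    have h₂ := abs_le.1 (key m hm)
    push_cast at h₁ h₂ ⊢
    rw [abs_le]
    constructor <;> linarith
  have side : ∀ k l, k + 2 * l ≤ N → (G.dist p q : ℤ) ≤
      2 * (|codeSum F p (k + l) - codeSum F p k - (codeSum F q (k + l) - codeSum F q k)| +
        |codeSum F p (k + 2 * l) - codeSum F p (k + l) -
          (codeSum F q (k + 2 * l) - codeSum F q (k + l))|) → (G.dist p q : ℝ) ≤ 8 * B := by
    intro k l hkl h
    have h₁ := diff k (by omega) (k + l) (by omega)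
    have h₂ := diff (k + l) (by omega) (k + 2 * l) hkl
    have h' := (Int.cast_le (R := ℝ)).2 h
    push_cast at h' h₁ h₂
    linarith
  have hD := abs_le.1 h₀
  simp only [codeSum, Finset.range_zero, Finset.sum_empty, sub_zero] at hD
  push_cast at hD
  obtain h | h | ⟨t, s, k, l, hkl, ⟨hp, hq⟩ | ⟨hq, hp⟩⟩ := hF.precedes_or_onSide p q
  · have h' := (Int.cast_le (R := ℝ)).2 h
    simp only [codeSum] at h'
    push_cast at h'
    linarith
  · have h' := (Int.cast_le (R := ℝ)).2 h
    simp only [codeSum] at h'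
    push_cast at h'
    rw [G.dist_comm]
    linarith
  · exact side k l hkl (hp.dist_le hF.connected hq)
  · refine side k l hkl ?_
    have := hq.dist_le hF.connected hp
    rw [G.dist_comm] at this
    rwa [abs_sub_comm, abs_sub_comm (codeSum F q (k + 2 * l) - codeSum F q (k + l))] at this

variable {X : Type} [NormedAddCommGroup X] [NormedSpace ℝ X]

/-- The map associated with a coding and a sequence of vectors. -/
def codeMap (F : V → ℕ → ℤ) (N : ℕ) (y : ℕ → X) (p : V) : X :=
  ∑ i ∈ Finset.range N, (F p i : ℝ) • y i

lemma codeMap_sub (y : ℕ → X) (p q : V) : codeMap F N y p - codeMap F N y q =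
    ∑ i ∈ Finset.range N, ((F p i : ℝ) - F q i) • y i := by
  simp only [codeMap, sub_smul, Finset.sum_sub_distrib]

lemma IsCoding.norm_codeMap_sub_le (hF : IsCoding G N F) {y : ℕ → X} {K : ℝ}
    (hy : ∀ i < N, ‖y i‖ ≤ K) (p q : V) :
    ‖codeMap F N y p - codeMap F N y q‖ ≤ K * G.dist p q := by
  have key : ∀ {i : ℕ}, i < N → ∀ {u v : V}, Ascends G F i u v →
      codeMap F N y v - codeMap F N y u = y i := by
    intro i hi u v h
    rw [codeMap_sub, Finset.sum_eq_single_of_mem i (Finset.mem_range.2 hi)]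
    · simp [h.2]
    · intro j _ hj
      simp [h.2, hj]
  refine hF.connected.norm_sub_le_mul_dist (fun u v huv => ?_) p q
  obtain ⟨i, hi, h | h⟩ := hF.ascends u v huv
  · rw [norm_sub_rev, key hi h]
    exact hy i hi
  · rw [key hi h]
    exact hy i hi

/-- The Laakso graphs embed with uniformly bounded distortion into a space with summing
sequences. -/
lemma HasSummingSequences.exists_laakso_embedding (h : HasSummingSequences X) :
    ∃ C : ℝ, 1 ≤ C ∧ ∀ n : ℕ, ∃ r : ℝ, 0 < r ∧ ∃ f : LaaksoV n → X,
      ∀ u v : LaaksoV n,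
        r * laaksoDist n u v ≤ ‖f u - f v‖ ∧ ‖f u - f v‖ ≤ r * C * laaksoDist n u v := by
  obtain ⟨K, hK, hy⟩ := h
  refine ⟨max 1 (8 * K ^ 2), le_max_left _ _, fun n => ⟨1 / (8 * K), by positivity, ?_⟩⟩
  obtain ⟨F, hF⟩ := exists_isCoding n
  obtain ⟨y, hyK, hy⟩ := hy (4 ^ n)
  refine ⟨codeMap F (4 ^ n) y, fun u v => ⟨?_, ?_⟩⟩
  · have hd : laaksoDist n u v ≤ _ := hF.dist_le fun k hk =>
      (codeMap_sub (F := F) y u v).symm ▸ hy (fun i => (F u i : ℝ) - F v i) k hk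
    rw [one_div, inv_mul_le_iff₀ (by positivity)]
    exact hd.trans_eq (mul_assoc _ _ _).symm
  · have hd : 0 ≤ laaksoDist n u v := Nat.cast_nonneg _
    calc ‖codeMap F (4 ^ n) y u - codeMap F (4 ^ n) y v‖
        ≤ K * laaksoDist n u v := hF.norm_codeMap_sub_le hyK u v
      _ = 1 / (8 * K) * (8 * K ^ 2) * laaksoDist n u v := by field_simp
      _ ≤ 1 / (8 * K) * max 1 (8 * K ^ 2) * laaksoDist n u v := by
        gcongr
        exact le_max_right _ _

end Embedding

end Auxiliary

/-- Johnson–Schechtman: a Banach space is nonsuperreflexive iff the Laakso graphs embed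
into it with uniformly bounded distortions. -/
theorem johnson_schechtman_laakso_characterization
    (X : Type) [NormedAddCommGroup X] [NormedSpace ℝ X] [CompleteSpace X] :
    ¬ SuperReflexive X ↔
      ∃ C : ℝ, 1 ≤ C ∧ ∀ n : ℕ, ∃ r : ℝ, 0 < r ∧ ∃ f : LaaksoV n → X,
        ∀ u v : LaaksoV n,
          r * laaksoDist n u v ≤ ‖f u - f v‖ ∧ ‖f u - f v‖ ≤ r * C * laaksoDist n u v := by
  constructor
  · intro h
    exact (hasSummingSequences_of_not_superReflexive h).exists_laakso_embedding
  · rintro ⟨C, -, h⟩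
    exact not_superReflexive_of_laakso h
end
end
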